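/- The bound quiver algebras T₁, T₃, T₁₇ from Han's Table T and W₁, W₂, W₃, W₅ from Han's Table W over an algebraically closed field K are τ-tilting infinite (for all admissible parameter values). -/

import Mathlib

/-!
Core definitions for τ-tilting theory of finite dimensional algebras.

Throughout, for an algebra `Λ`, *right* `Λ`-modules are formalized as left modules
over the opposite ring `Λᵐᵒᵖ` (the category `RMod Λ := ModuleCat Λᵐᵒᵖ`).

τ-rigidity is formalized via the standard projective-presentation criterion of
Auslander–Smalø/Adachi–Iyama–Reiten: a finitely generated module `M` is τ-rigid iff it admits
a (finite) projective presentation `P₁ → P₀ → M → 0` such that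
`Hom(P₀, M) → Hom(P₁, M)` is surjective.
-/

noncomputable section

namespace TwoPoint

/-- A module is indecomposable if it is nonzero and admits no nontrivial direct sum
decomposition. -/
def IsIndecModule (R : Type) [Ring R] (M : Type) [AddCommGroup M] [Module R M] : Prop :=
  Nontrivial M ∧ ∀ N₁ N₂ : Submodule R M, IsCompl N₁ N₂ → N₁ = ⊥ ∨ N₂ = ⊥

/-- `M` decomposes as a finite direct sum of indecomposable submodules having exactly `n`
isomorphism classes. -/
def HasIndecClassCount (R : Type) [Ring R] (M : ModuleCat.{0} R) (n : ℕ) : Prop :=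
  ∃ (k : ℕ) (N : Fin k → Submodule R M),
    DirectSum.IsInternal N ∧ (∀ i, IsIndecModule R (N i)) ∧
    ∃ c : Fin k → Fin n, Function.Surjective c ∧
      ∀ i j, (c i = c j ↔ Nonempty ((N i) ≃ₗ[R] (N j)))

/-- `M` is basic: it decomposes as a finite direct sum of pairwise nonisomorphic
indecomposable submodules. -/
def IsBasicModuleCat (R : Type) [Ring R] (M : ModuleCat.{0} R) : Prop :=
  ∃ (k : ℕ) (N : Fin k → Submodule R M),
    DirectSum.IsInternal N ∧ (∀ i, IsIndecModule R (N i)) ∧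
    ∀ i j, i ≠ j → IsEmpty ((N i) ≃ₗ[R] (N j))

/-- τ-rigidity, via the projective presentation criterion: there is a finite projective
presentation `P₁ —f→ P₀ —g→ M → 0` such that `Hom(—, M)` applied to `f` is surjective,
i.e. `Hom_Λ(M, τM) = 0`. -/
def IsTauRigidCat (R : Type) [Ring R] (M : ModuleCat.{0} R) : Prop :=
  Module.Finite R M ∧
  ∃ (P₁ P₀ : ModuleCat.{0} R) (f : P₁ →ₗ[R] P₀) (g : P₀ →ₗ[R] M),
    Module.Finite R P₁ ∧ Module.Projective R P₁ ∧
    Module.Finite R P₀ ∧ Module.Projective R P₀ ∧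
    Function.Surjective g ∧ LinearMap.range f = LinearMap.ker g ∧
    ∀ h : P₁ →ₗ[R] M, ∃ h' : P₀ →ₗ[R] M, h = h'.comp f

/-- Support τ-tilting module, via support τ-tilting pairs `(M, P)` (Adachi–Iyama–Reiten):
`M` is τ-rigid, `P` is finitely generated projective with `Hom(P, M) = 0`, and
`|M| + |P| = |R|` where `|X|` is the number of isomorphism classes of indecomposable
direct summands. -/
def IsSupportTauTiltingCat (R : Type) [Ring R] (M : ModuleCat.{0} R) : Prop :=
  IsTauRigidCat R M ∧
  ∃ (P : ModuleCat.{0} R) (p q r : ℕ),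
    Module.Finite R P ∧ Module.Projective R P ∧
    (∀ f : P →ₗ[R] M, f = 0) ∧
    HasIndecClassCount R M p ∧ HasIndecClassCount R P q ∧
    HasIndecClassCount R (ModuleCat.of R R) r ∧ p + q = r

/-- The category of (finitely generated) right `Λ`-modules, as left `Λᵐᵒᵖ`-modules. -/
abbrev RMod (Λ : Type) [Ring Λ] := ModuleCat.{0} Λᵐᵒᵖ

/-- Basic support τ-tilting right `Λ`-module. -/
def IsBasicSupportTauTilting (Λ : Type) [Ring Λ] (M : RMod Λ) : Prop :=
  IsSupportTauTiltingCat Λᵐᵒᵖ M ∧ IsBasicModuleCat Λᵐᵒᵖ M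

/-- `Λ` is τ-tilting finite: there are only finitely many isomorphism classes of basic
support τ-tilting right `Λ`-modules. -/
def IsTauTiltingFinite (Λ : Type) [Ring Λ] : Prop :=
  ∃ (n : ℕ) (L : Fin n → RMod Λ),
    ∀ M : RMod Λ, IsBasicSupportTauTilting Λ M → ∃ i, Nonempty (M ≃ₗ[Λᵐᵒᵖ] L i)

/-- `Λ` has exactly `n` isomorphism classes of basic support τ-tilting modules. -/
def SupportTauTiltingCount (Λ : Type) [Ring Λ] (n : ℕ) : Prop :=
  ∃ L : Fin n → RMod Λ,
    (∀ i, IsBasicSupportTauTilting Λ (L i)) ∧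
    (∀ i j, Nonempty ((L i) ≃ₗ[Λᵐᵒᵖ] (L j)) → i = j) ∧
    ∀ M : RMod Λ, IsBasicSupportTauTilting Λ M → ∃ i, Nonempty (M ≃ₗ[Λᵐᵒᵖ] L i)

/-- `Fac M ⊆ Fac N`: every factor module of a finite direct sum of copies of `M` is also a
factor module of a finite direct sum of copies of `N`.  This is the partial order on
support τ-tilting modules. -/
def FacLE (Λ : Type) [Ring Λ] (M N : RMod Λ) : Prop :=
  ∀ X : RMod Λ,
    (∃ (k : ℕ) (f : (Fin k → M) →ₗ[Λᵐᵒᵖ] X), Function.Surjective f) →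
    (∃ (k : ℕ) (f : (Fin k → N) →ₗ[Λᵐᵒᵖ] X), Function.Surjective f)

/-- The Hasse quiver of the poset `sτ-tilt Λ` is of type `H_{m,n}`: the poset of
isomorphism classes of basic support τ-tilting modules is isomorphic to the poset
consisting of a greatest element, a least element, and two incomparable chains with `m`
resp. `n` elements in between (hence two directed paths from `Λ` to `0` with `m` resp. `n`
intermediate vertices). -/
def HasseType (Λ : Type) [Ring Λ] (m n : ℕ) : Prop :=
  ∃ T : WithTop (WithBot (Fin m ⊕ Fin n)) → RMod Λ,
    (∀ x, IsBasicSupportTauTilting Λ (T x)) ∧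
    (∀ x y, Nonempty ((T x) ≃ₗ[Λᵐᵒᵖ] (T y)) → x = y) ∧
    (∀ M : RMod Λ, IsBasicSupportTauTilting Λ M → ∃ x, Nonempty (M ≃ₗ[Λᵐᵒᵖ] T x)) ∧
    ∀ x y, x ≤ y ↔ FacLE Λ (T x) (T y)

/-- `Λ` is τ-tilting finite with exactly `N` basic support τ-tilting modules and Hasse
quiver of type `H_{m,n}`. -/
def TauTiltingData (Λ : Type) [Ring Λ] (N m n : ℕ) : Prop :=
  IsTauTiltingFinite Λ ∧ SupportTauTiltingCount Λ N ∧ HasseType Λ m n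

/-- `B` is a factor algebra of `Λ`: there is a surjective `K`-algebra homomorphism
`Λ → B`. -/
def IsFactorAlgebra (K : Type) [CommRing K] (B Λ : Type) [Ring B] [Ring Λ]
    [Algebra K B] [Algebra K Λ] : Prop :=
  ∃ φ : Λ →ₐ[K] B, Function.Surjective φ

/-- `Λ` is a basic algebra: the regular right module decomposes into pairwise
nonisomorphic indecomposables. -/
def IsBasicAlgebra (Λ : Type) [Ring Λ] : Prop :=
  IsBasicModuleCat Λᵐᵒᵖ (ModuleCat.of Λᵐᵒᵖ Λᵐᵒᵖ)

/-- `Λ` is representation-finite: finitely many isomorphism classes of indecomposable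
finitely generated right modules. -/
def IsRepFinite (Λ : Type) [Ring Λ] : Prop :=
  ∃ (n : ℕ) (L : Fin n → RMod Λ), ∀ M : RMod Λ,
    Module.Finite Λᵐᵒᵖ M → IsIndecModule Λᵐᵒᵖ M → ∃ i, Nonempty (M ≃ₗ[Λᵐᵒᵖ] L i)

end TwoPoint

namespace TwoPoint

/-! ### Bound quiver algebras on two-point quivers

A two-point quiver is given by an arrow type `σ` together with source and target functions
`s t : σ → Fin 2`.  The corresponding bound quiver algebra `KQ/I` is presented as the
quotient of the free algebra on the two vertex idempotents and the arrows, by the path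
algebra relations together with the defining relations of `I` (paths are composed from
left to right, so a relation like `αμβ` is the product `α * μ * β`). -/

/-- Generators for the path algebra of a two-point quiver: two vertex idempotents and the
arrows. -/
inductive TPGen (σ : Type) : Type
  | v : Fin 2 → TPGen σ
  | ar : σ → TPGen σ

/-- The vertex idempotent generator. -/
def vtx (K : Type) [Field K] {σ : Type} (i : Fin 2) : FreeAlgebra K (TPGen σ) :=
  FreeAlgebra.ι K (TPGen.v i)

/-- The arrow generator. -/
def arr (K : Type) [Field K] {σ : Type} (a : σ) : FreeAlgebra K (TPGen σ) :=
  FreeAlgebra.ι K (TPGen.ar a)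

/-- The defining relations of a bound quiver algebra on a two-point quiver:
`e_i e_j = δ_{ij} e_i`, `e_1 + e_2 = 1`, `e_{s(a)} a = a = a e_{t(a)}`, together with the
prescribed relations `rels` (each pair `(x, y) ∈ rels` imposes `x = y`). -/
inductive QuivRel (K : Type) [Field K] (σ : Type) (s t : σ → Fin 2)
    (rels : Set (FreeAlgebra K (TPGen σ) × FreeAlgebra K (TPGen σ))) :
    FreeAlgebra K (TPGen σ) → FreeAlgebra K (TPGen σ) → Prop
  | idem (i : Fin 2) : QuivRel K σ s t rels (vtx K i * vtx K i) (vtx K i)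
  | orth (i j : Fin 2) : i ≠ j → QuivRel K σ s t rels (vtx K i * vtx K j) 0
  | vsum : QuivRel K σ s t rels (vtx K 0 + vtx K 1) 1
  | src (a : σ) : QuivRel K σ s t rels (vtx K (s a) * arr K a) (arr K a)
  | tgt (a : σ) : QuivRel K σ s t rels (arr K a * vtx K (t a)) (arr K a)
  | rel (p : FreeAlgebra K (TPGen σ) × FreeAlgebra K (TPGen σ)) :
      p ∈ rels → QuivRel K σ s t rels p.1 p.2

/-- The bound quiver algebra of a two-point quiver with relations `rels`. -/
abbrev BoundQuiverAlgebra (K : Type) [Field K] (σ : Type) (s t : σ → Fin 2)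
    (rels : Set (FreeAlgebra K (TPGen σ) × FreeAlgebra K (TPGen σ))) : Type :=
  RingQuot (QuivRel K σ s t rels)

/-! Concrete two-point quivers used below.  Vertices are `0` ("1") and `1` ("2"). -/

/- Quiver `μ : 1 → 2`, loop `β` at `2`. -/
namespace QA
def s : Fin 2 → Fin 2 := ![0, 1]
def t : Fin 2 → Fin 2 := ![1, 1]
def mu (K : Type) [Field K] : FreeAlgebra K (TPGen (Fin 2)) := arr K (0 : Fin 2)
def be (K : Type) [Field K] : FreeAlgebra K (TPGen (Fin 2)) := arr K (1 : Fin 2)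
end QA

/- Quiver: loop `α` at `1`, `μ : 1 → 2`, loop `β` at `2`. -/
namespace QB
def s : Fin 3 → Fin 2 := ![0, 0, 1]
def t : Fin 3 → Fin 2 := ![0, 1, 1]
def al (K : Type) [Field K] : FreeAlgebra K (TPGen (Fin 3)) := arr K (0 : Fin 3)
def mu (K : Type) [Field K] : FreeAlgebra K (TPGen (Fin 3)) := arr K (1 : Fin 3)
def be (K : Type) [Field K] : FreeAlgebra K (TPGen (Fin 3)) := arr K (2 : Fin 3)
end QB

/- Quiver: `μ : 1 → 2`, loops `β₁, β₂` at `2`. -/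
namespace QC
def s : Fin 3 → Fin 2 := ![0, 1, 1]
def t : Fin 3 → Fin 2 := ![1, 1, 1]
def mu (K : Type) [Field K] : FreeAlgebra K (TPGen (Fin 3)) := arr K (0 : Fin 3)
def b1 (K : Type) [Field K] : FreeAlgebra K (TPGen (Fin 3)) := arr K (1 : Fin 3)
def b2 (K : Type) [Field K] : FreeAlgebra K (TPGen (Fin 3)) := arr K (2 : Fin 3)
end QC

/- Quiver: loop `α` at `1`, `μ : 1 → 2`, `ν : 2 → 1`. -/
namespace QD
def s : Fin 3 → Fin 2 := ![0, 0, 1]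
def t : Fin 3 → Fin 2 := ![0, 1, 0]
def al (K : Type) [Field K] : FreeAlgebra K (TPGen (Fin 3)) := arr K (0 : Fin 3)
def mu (K : Type) [Field K] : FreeAlgebra K (TPGen (Fin 3)) := arr K (1 : Fin 3)
def nu (K : Type) [Field K] : FreeAlgebra K (TPGen (Fin 3)) := arr K (2 : Fin 3)
end QD

/- Quiver: loops `α` at `1` and `β` at `2`, `μ : 1 → 2`, `ν : 2 → 1`. -/
namespace QE
def s : Fin 4 → Fin 2 := ![0, 1, 0, 1]
def t : Fin 4 → Fin 2 := ![0, 1, 1, 0]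
def al (K : Type) [Field K] : FreeAlgebra K (TPGen (Fin 4)) := arr K (0 : Fin 4)
def be (K : Type) [Field K] : FreeAlgebra K (TPGen (Fin 4)) := arr K (1 : Fin 4)
def mu (K : Type) [Field K] : FreeAlgebra K (TPGen (Fin 4)) := arr K (2 : Fin 4)
def nu (K : Type) [Field K] : FreeAlgebra K (TPGen (Fin 4)) := arr K (3 : Fin 4)
end QE

/- Quiver: `μ : 1 → 2`, `ν : 2 → 1`. -/
namespace QF
def s : Fin 2 → Fin 2 := ![0, 1]
def t : Fin 2 → Fin 2 := ![1, 0]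
def mu (K : Type) [Field K] : FreeAlgebra K (TPGen (Fin 2)) := arr K (0 : Fin 2)
def nu (K : Type) [Field K] : FreeAlgebra K (TPGen (Fin 2)) := arr K (1 : Fin 2)
end QF

/- The Kronecker quiver: `μ₁, μ₂ : 1 → 2`. -/
namespace QG
def s : Fin 2 → Fin 2 := ![0, 0]
def t : Fin 2 → Fin 2 := ![1, 1]
end QG

/- Quiver: `μ₁, μ₂ : 1 → 2`, `ν₁, ν₂ : 2 → 1`. -/
namespace QH
def s : Fin 4 → Fin 2 := ![0, 0, 1, 1]
def t : Fin 4 → Fin 2 := ![1, 1, 0, 0]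
def mu1 (K : Type) [Field K] : FreeAlgebra K (TPGen (Fin 4)) := arr K (0 : Fin 4)
def mu2 (K : Type) [Field K] : FreeAlgebra K (TPGen (Fin 4)) := arr K (1 : Fin 4)
def nu1 (K : Type) [Field K] : FreeAlgebra K (TPGen (Fin 4)) := arr K (2 : Fin 4)
def nu2 (K : Type) [Field K] : FreeAlgebra K (TPGen (Fin 4)) := arr K (3 : Fin 4)
end QH

/- Quiver: loop `α` at `1`, `μ : 1 → 2`. -/
namespace QI
def s : Fin 2 → Fin 2 := ![0, 0]
def t : Fin 2 → Fin 2 := ![0, 1]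
def al (K : Type) [Field K] : FreeAlgebra K (TPGen (Fin 2)) := arr K (0 : Fin 2)
def mu (K : Type) [Field K] : FreeAlgebra K (TPGen (Fin 2)) := arr K (1 : Fin 2)
end QI

/- Quiver: loops `α₁, α₂` at `1`, `μ : 1 → 2`. -/
namespace QJ
def s : Fin 3 → Fin 2 := ![0, 0, 0]
def t : Fin 3 → Fin 2 := ![0, 0, 1]
def a1 (K : Type) [Field K] : FreeAlgebra K (TPGen (Fin 3)) := arr K (0 : Fin 3)
def a2 (K : Type) [Field K] : FreeAlgebra K (TPGen (Fin 3)) := arr K (1 : Fin 3)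
def mu (K : Type) [Field K] : FreeAlgebra K (TPGen (Fin 3)) := arr K (2 : Fin 3)
end QJ

/- Quiver: `μ₁, μ₂ : 1 → 2`, `ν : 2 → 1`. -/
namespace QK
def s : Fin 3 → Fin 2 := ![0, 0, 1]
def t : Fin 3 → Fin 2 := ![1, 1, 0]
def mu1 (K : Type) [Field K] : FreeAlgebra K (TPGen (Fin 3)) := arr K (0 : Fin 3)
def mu2 (K : Type) [Field K] : FreeAlgebra K (TPGen (Fin 3)) := arr K (1 : Fin 3)
def nu (K : Type) [Field K] : FreeAlgebra K (TPGen (Fin 3)) := arr K (2 : Fin 3)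
end QK

/- Quiver: `μ₁, μ₂, μ₃ : 1 → 2`. -/
namespace QL
def s : Fin 3 → Fin 2 := ![0, 0, 0]
def t : Fin 3 → Fin 2 := ![1, 1, 1]
end QL

/- Quiver: loop `α` at `1`, `μ₁, μ₂ : 1 → 2`. -/
namespace QM
def s : Fin 3 → Fin 2 := ![0, 0, 0]
def t : Fin 3 → Fin 2 := ![0, 1, 1]
def al (K : Type) [Field K] : FreeAlgebra K (TPGen (Fin 3)) := arr K (0 : Fin 3)
def mu1 (K : Type) [Field K] : FreeAlgebra K (TPGen (Fin 3)) := arr K (1 : Fin 3)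
def mu2 (K : Type) [Field K] : FreeAlgebra K (TPGen (Fin 3)) := arr K (2 : Fin 3)
end QM

end TwoPoint

namespace TwoPoint

/-! ### The algebras of Han's Table T -/

/-- `T₁` (`k₁k₄ ≠ k₂k₃`, `ℓ₁ℓ₄ ≠ ℓ₂ℓ₃`):
`ν₁μ₁ = ν₂μ₂ = (ℓ₁μ₁+ℓ₂μ₂)(k₁ν₁+k₂ν₂) = (ℓ₃μ₁+ℓ₄μ₂)(k₃ν₁+k₄ν₂) = 0`. -/
abbrev TabT1 (K : Type) [Field K] (k1 k2 k3 k4 l1 l2 l3 l4 : K) : Type :=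
  BoundQuiverAlgebra K (Fin 4) QH.s QH.t
    {(QH.nu1 K * QH.mu1 K, 0), (QH.nu2 K * QH.mu2 K, 0),
     ((l1 • QH.mu1 K + l2 • QH.mu2 K) * (k1 • QH.nu1 K + k2 • QH.nu2 K), 0),
     ((l3 • QH.mu1 K + l4 • QH.mu2 K) * (k3 • QH.nu1 K + k4 • QH.nu2 K), 0)}

/-- `T₂`: `α⁶ = α²μ = 0`. -/
abbrev TabT2 (K : Type) [Field K] : Type :=
  BoundQuiverAlgebra K (Fin 2) QI.s QI.t
    {(QI.al K ^ 6, 0), (QI.al K ^ 2 * QI.mu K, 0)}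

/-- `T₃`: `α² = β² = 0`. -/
abbrev TabT3 (K : Type) [Field K] : Type :=
  BoundQuiverAlgebra K (Fin 3) QB.s QB.t {(QB.al K ^ 2, 0), (QB.be K ^ 2, 0)}

/-- `T₄` (`n ≥ 2`): `α² = βⁿ = μβ = 0`. -/
abbrev TabT4 (K : Type) [Field K] (n : ℕ) : Type :=
  BoundQuiverAlgebra K (Fin 3) QB.s QB.t
    {(QB.al K ^ 2, 0), (QB.be K ^ n, 0), (QB.mu K * QB.be K, 0)}

/-- `T₅` (`m, n ≥ 2`): `αᵐ = βⁿ = αμ = μβ = 0`. -/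
abbrev TabT5 (K : Type) [Field K] (m n : ℕ) : Type :=
  BoundQuiverAlgebra K (Fin 3) QB.s QB.t
    {(QB.al K ^ m, 0), (QB.be K ^ n, 0), (QB.al K * QB.mu K, 0), (QB.mu K * QB.be K, 0)}

/-- `T₆`: `α² = β³ = 0`, `αμ = μβ²`. -/
abbrev TabT6 (K : Type) [Field K] : Type :=
  BoundQuiverAlgebra K (Fin 3) QB.s QB.t
    {(QB.al K ^ 2, 0), (QB.be K ^ 3, 0), (QB.al K * QB.mu K, QB.mu K * QB.be K ^ 2)}

/-- `T₇`: `α³ = β⁶ = 0`, `αμ = μβ`. -/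
abbrev TabT7 (K : Type) [Field K] : Type :=
  BoundQuiverAlgebra K (Fin 3) QB.s QB.t
    {(QB.al K ^ 3, 0), (QB.be K ^ 6, 0), (QB.al K * QB.mu K, QB.mu K * QB.be K)}

/-- `T₈`: `α⁴ = β⁴ = 0`, `αμ = μβ`. -/
abbrev TabT8 (K : Type) [Field K] : Type :=
  BoundQuiverAlgebra K (Fin 3) QB.s QB.t
    {(QB.al K ^ 4, 0), (QB.be K ^ 4, 0), (QB.al K * QB.mu K, QB.mu K * QB.be K)}

/-- `T₉` (`n ≥ 1`): `α² = μνμ = νμν = (ναμ)ⁿ = 0`. -/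
abbrev TabT9 (K : Type) [Field K] (n : ℕ) : Type :=
  BoundQuiverAlgebra K (Fin 3) QD.s QD.t
    {(QD.al K ^ 2, 0), (QD.mu K * QD.nu K * QD.mu K, 0), (QD.nu K * QD.mu K * QD.nu K, 0),
     ((QD.nu K * QD.al K * QD.mu K) ^ n, 0)}

/-- `T₁₀`: `α³ = μν = νμ = ναμ = 0`. -/
abbrev TabT10 (K : Type) [Field K] : Type :=
  BoundQuiverAlgebra K (Fin 3) QD.s QD.t
    {(QD.al K ^ 3, 0), (QD.mu K * QD.nu K, 0), (QD.nu K * QD.mu K, 0),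
     (QD.nu K * QD.al K * QD.mu K, 0)}

/-- `T₁₁`: `α³ = μν`, `νμ = να² = α²μ = 0`. -/
abbrev TabT11 (K : Type) [Field K] : Type :=
  BoundQuiverAlgebra K (Fin 3) QD.s QD.t
    {(QD.al K ^ 3, QD.mu K * QD.nu K), (QD.nu K * QD.mu K, 0), (QD.nu K * QD.al K ^ 2, 0),
     (QD.al K ^ 2 * QD.mu K, 0)}

/-- `T₁₂`: `α⁴ = μν`, `να = α²μ = 0`. -/
abbrev TabT12 (K : Type) [Field K] : Type :=
  BoundQuiverAlgebra K (Fin 3) QD.s QD.t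
    {(QD.al K ^ 4, QD.mu K * QD.nu K), (QD.nu K * QD.al K, 0), (QD.al K ^ 2 * QD.mu K, 0)}

/-- `T₁₃` (`m ≥ 2`, `n ≥ 1`): `αᵐ = να = αμ = (μν)ⁿ = 0`. -/
abbrev TabT13 (K : Type) [Field K] (m n : ℕ) : Type :=
  BoundQuiverAlgebra K (Fin 3) QD.s QD.t
    {(QD.al K ^ m, 0), (QD.nu K * QD.al K, 0), (QD.al K * QD.mu K, 0),
     ((QD.mu K * QD.nu K) ^ n, 0)}

/-- `T₁₄`: `α² = μν`, `ναμ = 0`. -/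
abbrev TabT14 (K : Type) [Field K] : Type :=
  BoundQuiverAlgebra K (Fin 3) QD.s QD.t
    {(QD.al K ^ 2, QD.mu K * QD.nu K), (QD.nu K * QD.al K * QD.mu K, 0)}

/-- `T₁₅`: `α³ = μν`, `να = α²μ = 0`. -/
abbrev TabT15 (K : Type) [Field K] : Type :=
  BoundQuiverAlgebra K (Fin 3) QD.s QD.t
    {(QD.al K ^ 3, QD.mu K * QD.nu K), (QD.nu K * QD.al K, 0), (QD.al K ^ 2 * QD.mu K, 0)}

/-- `T₁₆`: `α³ = μν`, `να = νμ = 0`. -/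
abbrev TabT16 (K : Type) [Field K] : Type :=
  BoundQuiverAlgebra K (Fin 3) QD.s QD.t
    {(QD.al K ^ 3, QD.mu K * QD.nu K), (QD.nu K * QD.al K, 0), (QD.nu K * QD.mu K, 0)}

/-- `T₁₇`: `α² = β² = νμ = μν = 0`. -/
abbrev TabT17 (K : Type) [Field K] : Type :=
  BoundQuiverAlgebra K (Fin 4) QE.s QE.t
    {(QE.al K ^ 2, 0), (QE.be K ^ 2, 0), (QE.nu K * QE.mu K, 0), (QE.mu K * QE.nu K, 0)}

/-- `T₁₈` (`m ≥ 2`, `n ≥ 1`): `α² = βᵐ = νμ = μβ = βν = (ναμ)ⁿ = 0`. -/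
abbrev TabT18 (K : Type) [Field K] (m n : ℕ) : Type :=
  BoundQuiverAlgebra K (Fin 4) QE.s QE.t
    {(QE.al K ^ 2, 0), (QE.be K ^ m, 0), (QE.nu K * QE.mu K, 0), (QE.mu K * QE.be K, 0),
     (QE.be K * QE.nu K, 0), ((QE.nu K * QE.al K * QE.mu K) ^ n, 0)}

/-- `T₁₉` (`m, n ≥ 2`, `r ≥ 1`): `αᵐ = βⁿ = (νμ)ʳ = αμ = να = μβ = βν = 0`. -/
abbrev TabT19 (K : Type) [Field K] (m n r : ℕ) : Type :=
  BoundQuiverAlgebra K (Fin 4) QE.s QE.t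
    {(QE.al K ^ m, 0), (QE.be K ^ n, 0), ((QE.nu K * QE.mu K) ^ r, 0),
     (QE.al K * QE.mu K, 0), (QE.nu K * QE.al K, 0), (QE.mu K * QE.be K, 0),
     (QE.be K * QE.nu K, 0)}

/-- `T₂₀` (`k ≠ 0`): `α² = μν`, `β² = νμ`, `βν = 0`, `αμ = kμβ`. -/
abbrev TabT20 (K : Type) [Field K] (k : K) : Type :=
  BoundQuiverAlgebra K (Fin 4) QE.s QE.t
    {(QE.al K ^ 2, QE.mu K * QE.nu K), (QE.be K ^ 2, QE.nu K * QE.mu K),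
     (QE.be K * QE.nu K, 0), (QE.al K * QE.mu K, k • (QE.mu K * QE.be K))}

/-- `T₂₁` (`k₁, k₂ ≠ 0`): `β² = νμ`, `να = βν`, `k₁α² = μν`, `αμ = k₂μβ`. -/
abbrev TabT21 (K : Type) [Field K] (k1 k2 : K) : Type :=
  BoundQuiverAlgebra K (Fin 4) QE.s QE.t
    {(QE.be K ^ 2, QE.nu K * QE.mu K), (QE.nu K * QE.al K, QE.be K * QE.nu K),
     (k1 • QE.al K ^ 2, QE.mu K * QE.nu K), (QE.al K * QE.mu K, k2 • (QE.mu K * QE.be K))}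

end TwoPoint

namespace TwoPoint

/-! ### The algebras of Han's Table W -/

/-- `W₁`: three parallel arrows `1 → 2`, no relations. -/
abbrev TabW1 (K : Type) [Field K] : Type :=
  BoundQuiverAlgebra K (Fin 3) QL.s QL.t ∅

/-- `W₂`: `μ₁ν = μ₂ν = 0`. -/
abbrev TabW2 (K : Type) [Field K] : Type :=
  BoundQuiverAlgebra K (Fin 3) QK.s QK.t
    {(QK.mu1 K * QK.nu K, 0), (QK.mu2 K * QK.nu K, 0)}

/-- `W₃`: `ν₂μ₁ = ν₁μ₂`, `μ₁ν₁ = μ₂ν₁ = μ₁ν₂ = μ₂ν₂ = ν₁μ₁ = 0`. -/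
abbrev TabW3 (K : Type) [Field K] : Type :=
  BoundQuiverAlgebra K (Fin 4) QH.s QH.t
    {(QH.nu2 K * QH.mu1 K, QH.nu1 K * QH.mu2 K), (QH.mu1 K * QH.nu1 K, 0),
     (QH.mu2 K * QH.nu1 K, 0), (QH.mu1 K * QH.nu2 K, 0), (QH.mu2 K * QH.nu2 K, 0),
     (QH.nu1 K * QH.mu1 K, 0)}

/-- `W₄`: `α₁² = α₂² = α₁α₂ = α₂α₁ = α₁μ = α₂μ = 0`. -/
abbrev TabW4 (K : Type) [Field K] : Type :=
  BoundQuiverAlgebra K (Fin 3) QJ.s QJ.t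
    {(QJ.a1 K ^ 2, 0), (QJ.a2 K ^ 2, 0), (QJ.a1 K * QJ.a2 K, 0), (QJ.a2 K * QJ.a1 K, 0),
     (QJ.a1 K * QJ.mu K, 0), (QJ.a2 K * QJ.mu K, 0)}

/-- `W₅`: `α² = αμ₁ = αμ₂ = 0`. -/
abbrev TabW5 (K : Type) [Field K] : Type :=
  BoundQuiverAlgebra K (Fin 3) QM.s QM.t
    {(QM.al K ^ 2, 0), (QM.al K * QM.mu1 K, 0), (QM.al K * QM.mu2 K, 0)}

/-- `W₆`: `α⁷ = α²μ = 0`. -/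
abbrev TabW6 (K : Type) [Field K] : Type :=
  BoundQuiverAlgebra K (Fin 2) QI.s QI.t {(QI.al K ^ 7, 0), (QI.al K ^ 2 * QI.mu K, 0)}

/-- `W₇`: `α⁴ = α³μ = 0`. -/
abbrev TabW7 (K : Type) [Field K] : Type :=
  BoundQuiverAlgebra K (Fin 2) QI.s QI.t {(QI.al K ^ 4, 0), (QI.al K ^ 3 * QI.mu K, 0)}

/-- `W₈`: `α² = β³ = αμ = 0`. -/
abbrev TabW8 (K : Type) [Field K] : Type :=
  BoundQuiverAlgebra K (Fin 3) QB.s QB.t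
    {(QB.al K ^ 2, 0), (QB.be K ^ 3, 0), (QB.al K * QB.mu K, 0)}

/-- `W₉`: `α³ = β³ = αμ = μβ² = 0`. -/
abbrev TabW9 (K : Type) [Field K] : Type :=
  BoundQuiverAlgebra K (Fin 3) QB.s QB.t
    {(QB.al K ^ 3, 0), (QB.be K ^ 3, 0), (QB.al K * QB.mu K, 0), (QB.mu K * QB.be K ^ 2, 0)}

/-- `W₁₀`: `α² = β⁴ = αμ = μβ² = 0`. -/
abbrev TabW10 (K : Type) [Field K] : Type :=
  BoundQuiverAlgebra K (Fin 3) QB.s QB.t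
    {(QB.al K ^ 2, 0), (QB.be K ^ 4, 0), (QB.al K * QB.mu K, 0), (QB.mu K * QB.be K ^ 2, 0)}

/-- `W₁₁`: `α² = β³ = αμβ = μβ² = 0`. -/
abbrev TabW11 (K : Type) [Field K] : Type :=
  BoundQuiverAlgebra K (Fin 3) QB.s QB.t
    {(QB.al K ^ 2, 0), (QB.be K ^ 3, 0), (QB.al K * QB.mu K * QB.be K, 0),
     (QB.mu K * QB.be K ^ 2, 0)}

/-- `W₁₂`: `α⁴ = β⁵ = μβ² = 0`, `αμ = μβ`. -/
abbrev TabW12 (K : Type) [Field K] : Type :=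
  BoundQuiverAlgebra K (Fin 3) QB.s QB.t
    {(QB.al K ^ 4, 0), (QB.be K ^ 5, 0), (QB.mu K * QB.be K ^ 2, 0),
     (QB.al K * QB.mu K, QB.mu K * QB.be K)}

/-- `W₁₃`: `α³ = β⁷ = μβ² = 0`, `αμ = μβ`. -/
abbrev TabW13 (K : Type) [Field K] : Type :=
  BoundQuiverAlgebra K (Fin 3) QB.s QB.t
    {(QB.al K ^ 3, 0), (QB.be K ^ 7, 0), (QB.mu K * QB.be K ^ 2, 0),
     (QB.al K * QB.mu K, QB.mu K * QB.be K)}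

/-- `W₁₄`: `α³ = μν = νμ = α²μ = 0`. -/
abbrev TabW14 (K : Type) [Field K] : Type :=
  BoundQuiverAlgebra K (Fin 3) QD.s QD.t
    {(QD.al K ^ 3, 0), (QD.mu K * QD.nu K, 0), (QD.nu K * QD.mu K, 0),
     (QD.al K ^ 2 * QD.mu K, 0)}

/-- `W₁₅`: `α³ = μν = αμ = 0`. -/
abbrev TabW15 (K : Type) [Field K] : Type :=
  BoundQuiverAlgebra K (Fin 3) QD.s QD.t
    {(QD.al K ^ 3, 0), (QD.mu K * QD.nu K, 0), (QD.al K * QD.mu K, 0)}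

/-- `W₁₆`: `α³ = μν = ναμ = να² = α²μ = 0`. -/
abbrev TabW16 (K : Type) [Field K] : Type :=
  BoundQuiverAlgebra K (Fin 3) QD.s QD.t
    {(QD.al K ^ 3, 0), (QD.mu K * QD.nu K, 0), (QD.nu K * QD.al K * QD.mu K, 0),
     (QD.nu K * QD.al K ^ 2, 0), (QD.al K ^ 2 * QD.mu K, 0)}

/-- `W₁₇`: `α⁴ = μν = νμ = αμ = να³ = 0`. -/
abbrev TabW17 (K : Type) [Field K] : Type :=
  BoundQuiverAlgebra K (Fin 3) QD.s QD.t
    {(QD.al K ^ 4, 0), (QD.mu K * QD.nu K, 0), (QD.nu K * QD.mu K, 0),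
     (QD.al K * QD.mu K, 0), (QD.nu K * QD.al K ^ 3, 0)}

/-- `W₁₈`: `α⁴ = μν = νμ = ναμ = να² = α²μ = 0`. -/
abbrev TabW18 (K : Type) [Field K] : Type :=
  BoundQuiverAlgebra K (Fin 3) QD.s QD.t
    {(QD.al K ^ 4, 0), (QD.mu K * QD.nu K, 0), (QD.nu K * QD.mu K, 0),
     (QD.nu K * QD.al K * QD.mu K, 0), (QD.nu K * QD.al K ^ 2, 0),
     (QD.al K ^ 2 * QD.mu K, 0)}

/-- `W₁₉`: `α⁵ = μν = νμ = να = α²μ = 0`. -/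
abbrev TabW19 (K : Type) [Field K] : Type :=
  BoundQuiverAlgebra K (Fin 3) QD.s QD.t
    {(QD.al K ^ 5, 0), (QD.mu K * QD.nu K, 0), (QD.nu K * QD.mu K, 0),
     (QD.nu K * QD.al K, 0), (QD.al K ^ 2 * QD.mu K, 0)}

/-- `W₂₀`: `α² = να = νμν = αμν = 0`. -/
abbrev TabW20 (K : Type) [Field K] : Type :=
  BoundQuiverAlgebra K (Fin 3) QD.s QD.t
    {(QD.al K ^ 2, 0), (QD.nu K * QD.al K, 0), (QD.nu K * QD.mu K * QD.nu K, 0),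
     (QD.al K * QD.mu K * QD.nu K, 0)}

/-- `W₂₁`: `α² = να = μνμ = 0`. -/
abbrev TabW21 (K : Type) [Field K] : Type :=
  BoundQuiverAlgebra K (Fin 3) QD.s QD.t
    {(QD.al K ^ 2, 0), (QD.nu K * QD.al K, 0), (QD.mu K * QD.nu K * QD.mu K, 0)}

/-- `W₂₂`: `α³ = νμ = να = αμν = α²μ = 0`. -/
abbrev TabW22 (K : Type) [Field K] : Type :=
  BoundQuiverAlgebra K (Fin 3) QD.s QD.t
    {(QD.al K ^ 3, 0), (QD.nu K * QD.mu K, 0), (QD.nu K * QD.al K, 0),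
     (QD.al K * QD.mu K * QD.nu K, 0), (QD.al K ^ 2 * QD.mu K, 0)}

/-- `W₂₃`: `α² = μν`, `α³ = α²μ = 0`. -/
abbrev TabW23 (K : Type) [Field K] : Type :=
  BoundQuiverAlgebra K (Fin 3) QD.s QD.t
    {(QD.al K ^ 2, QD.mu K * QD.nu K), (QD.al K ^ 3, 0), (QD.al K ^ 2 * QD.mu K, 0)}

/-- `W₂₄`: `α³ = μν`, `α⁴ = νμ = ναμ = να² = 0`. -/
abbrev TabW24 (K : Type) [Field K] : Type :=
  BoundQuiverAlgebra K (Fin 3) QD.s QD.t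
    {(QD.al K ^ 3, QD.mu K * QD.nu K), (QD.al K ^ 4, 0), (QD.nu K * QD.mu K, 0),
     (QD.nu K * QD.al K * QD.mu K, 0), (QD.nu K * QD.al K ^ 2, 0)}

/-- `W₂₅`: `α³ = β² = νμ = μν = να = μβ = βν = α²μ = 0`. -/
abbrev TabW25 (K : Type) [Field K] : Type :=
  BoundQuiverAlgebra K (Fin 4) QE.s QE.t
    {(QE.al K ^ 3, 0), (QE.be K ^ 2, 0), (QE.nu K * QE.mu K, 0), (QE.mu K * QE.nu K, 0),
     (QE.nu K * QE.al K, 0), (QE.mu K * QE.be K, 0), (QE.be K * QE.nu K, 0),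
     (QE.al K ^ 2 * QE.mu K, 0)}

/-- `W₂₆`: `α² = β² = νμ = αμ = να = βν = 0`. -/
abbrev TabW26 (K : Type) [Field K] : Type :=
  BoundQuiverAlgebra K (Fin 4) QE.s QE.t
    {(QE.al K ^ 2, 0), (QE.be K ^ 2, 0), (QE.nu K * QE.mu K, 0), (QE.al K * QE.mu K, 0),
     (QE.nu K * QE.al K, 0), (QE.be K * QE.nu K, 0)}

/-- `W₂₇`: `α² = μν`, `β² = νμ = αμ = μβ = βνα = 0`. -/
abbrev TabW27 (K : Type) [Field K] : Type :=
  BoundQuiverAlgebra K (Fin 4) QE.s QE.t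
    {(QE.al K ^ 2, QE.mu K * QE.nu K), (QE.be K ^ 2, 0), (QE.nu K * QE.mu K, 0),
     (QE.al K * QE.mu K, 0), (QE.mu K * QE.be K, 0), (QE.be K * QE.nu K * QE.al K, 0)}

/-- `W₂₈`: `α² = μν`, `β² = νμ = αμ = βν = 0`. -/
abbrev TabW28 (K : Type) [Field K] : Type :=
  BoundQuiverAlgebra K (Fin 4) QE.s QE.t
    {(QE.al K ^ 2, QE.mu K * QE.nu K), (QE.be K ^ 2, 0), (QE.nu K * QE.mu K, 0),
     (QE.al K * QE.mu K, 0), (QE.be K * QE.nu K, 0)}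

/-- `W₂₉`: `α² = μν`, `β² = νμ = να = μβ = 0`. -/
abbrev TabW29 (K : Type) [Field K] : Type :=
  BoundQuiverAlgebra K (Fin 4) QE.s QE.t
    {(QE.al K ^ 2, QE.mu K * QE.nu K), (QE.be K ^ 2, 0), (QE.nu K * QE.mu K, 0),
     (QE.nu K * QE.al K, 0), (QE.mu K * QE.be K, 0)}

/-- `W₃₀`: `α² = μν`, `β² = νμ = να = βν = αμβ = 0`. -/
abbrev TabW30 (K : Type) [Field K] : Type :=
  BoundQuiverAlgebra K (Fin 4) QE.s QE.t
    {(QE.al K ^ 2, QE.mu K * QE.nu K), (QE.be K ^ 2, 0), (QE.nu K * QE.mu K, 0),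
     (QE.nu K * QE.al K, 0), (QE.be K * QE.nu K, 0), (QE.al K * QE.mu K * QE.be K, 0)}

/-- `W₃₁`: `αμ = μβ`, `α² = β³ = μν = να = βν = μβ² = 0`. -/
abbrev TabW31 (K : Type) [Field K] : Type :=
  BoundQuiverAlgebra K (Fin 4) QE.s QE.t
    {(QE.al K * QE.mu K, QE.mu K * QE.be K), (QE.al K ^ 2, 0), (QE.be K ^ 3, 0),
     (QE.mu K * QE.nu K, 0), (QE.nu K * QE.al K, 0), (QE.be K * QE.nu K, 0),
     (QE.mu K * QE.be K ^ 2, 0)}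

/-- `W₃₂`: `αμ = μβ`, `α² = β² = να = βν = μνμ = νμν = 0`. -/
abbrev TabW32 (K : Type) [Field K] : Type :=
  BoundQuiverAlgebra K (Fin 4) QE.s QE.t
    {(QE.al K * QE.mu K, QE.mu K * QE.be K), (QE.al K ^ 2, 0), (QE.be K ^ 2, 0),
     (QE.nu K * QE.al K, 0), (QE.be K * QE.nu K, 0), (QE.mu K * QE.nu K * QE.mu K, 0),
     (QE.nu K * QE.mu K * QE.nu K, 0)}

/-- `W₃₃`: `αμ = μβ`, `α³ = β³ = νμ = μν = να = βν = μβ² = α²μ = 0`. -/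
abbrev TabW33 (K : Type) [Field K] : Type :=
  BoundQuiverAlgebra K (Fin 4) QE.s QE.t
    {(QE.al K * QE.mu K, QE.mu K * QE.be K), (QE.al K ^ 3, 0), (QE.be K ^ 3, 0),
     (QE.nu K * QE.mu K, 0), (QE.mu K * QE.nu K, 0), (QE.nu K * QE.al K, 0),
     (QE.be K * QE.nu K, 0), (QE.mu K * QE.be K ^ 2, 0), (QE.al K ^ 2 * QE.mu K, 0)}

/-- `W₃₄`: `αμ = μβ`, `α³ = β² = νμ = να = βν = α²μ = 0`. -/
abbrev TabW34 (K : Type) [Field K] : Type :=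
  BoundQuiverAlgebra K (Fin 4) QE.s QE.t
    {(QE.al K * QE.mu K, QE.mu K * QE.be K), (QE.al K ^ 3, 0), (QE.be K ^ 2, 0),
     (QE.nu K * QE.mu K, 0), (QE.nu K * QE.al K, 0), (QE.be K * QE.nu K, 0),
     (QE.al K ^ 2 * QE.mu K, 0)}

end TwoPoint

namespace TwoPoint

section Modules
variable {R : Type} [Ring R]

theorem isIndecModule_of_idempotent {M : Type} [AddCommGroup M] [Module R M] [Nontrivial M]
    (h : ∀ e : M →ₗ[R] M, (∀ x, e (e x) = e x) → (∀ x, e x = 0) ∨ ∀ x, e x = x) :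
    IsIndecModule R M := by
  refine ⟨inferInstance, fun N₁ N₂ hN => ?_⟩
  have hr : LinearMap.range (Submodule.projection N₁ N₂ hN) = N₁ := by simp
  have hk : LinearMap.ker (Submodule.projection N₁ N₂ hN) = N₂ := by simp
  rcases h (Submodule.projection N₁ N₂ hN) (fun x => by simp) with h0 | h1
  · left
    rw [← hr, LinearMap.range_eq_bot]
    exact LinearMap.ext h0
  · right
    rw [← hk, LinearMap.ker_eq_bot']
    intro x hx
    rw [← h1 x, hx]

theorem IsIndecModule.of_equiv {M N : Type} [AddCommGroup M] [Module R M] [AddCommGroup N]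
    [Module R N] (e : M ≃ₗ[R] N) (h : IsIndecModule R M) : IsIndecModule R N := by
  obtain ⟨h1, h2⟩ := h
  refine ⟨e.symm.toEquiv.nontrivial, fun N₁ N₂ hN => ?_⟩
  have := h2 _ _ (OrderIso.isCompl (Submodule.orderIsoMapComap e.symm) hN)
  simpa using this

theorem exists_decomposition_of_isCompl {M : Type} [AddCommGroup M] [Module R M]
    {A B : Submodule R M} (h : IsCompl A B) (hA : IsIndecModule R A) (hB : IsIndecModule R B)
    (hAB : IsEmpty (A ≃ₗ[R] B)) :
    ∃ N : Fin 2 → Submodule R M, DirectSum.IsInternal N ∧ (∀ i, IsIndecModule R (N i)) ∧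
      ∀ i j, i ≠ j → IsEmpty ((N i) ≃ₗ[R] (N j)) := by
  refine ⟨![A, B], ?_, ?_, ?_⟩
  · rw [DirectSum.isInternal_submodule_iff_isCompl _ (i := 0) (j := 1) (by decide)
      (by ext x; fin_cases x <;> simp)]
    simpa using h
  · intro i
    fin_cases i
    · exact hA
    · exact hB
  · intro i j hij
    fin_cases i <;> fin_cases j
    · exact absurd rfl hij
    · exact hAB
    · exact ⟨fun e => hAB.false e.symm⟩
    · exact absurd rfl hij

theorem hasIndecClassCount_of_basic {M : ModuleCat.{0} R} {k : ℕ} {N : Fin k → Submodule R M}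
    (h1 : DirectSum.IsInternal N) (h2 : ∀ i, IsIndecModule R (N i))
    (h3 : ∀ i j, i ≠ j → IsEmpty ((N i) ≃ₗ[R] (N j))) : HasIndecClassCount R M k :=
  ⟨k, N, h1, h2, id, Function.surjective_id, fun i j =>
    ⟨fun h => by rw [show i = j from h]; exact ⟨LinearEquiv.refl _ _⟩,
     fun ⟨e⟩ => by_contra fun h => (h3 i j h).false e⟩⟩

theorem hasIndecClassCount_punit : HasIndecClassCount R (ModuleCat.of R PUnit) 0 := by
  refine ⟨0, Fin.elim0, ?_, fun i => i.elim0, id, Function.surjective_id, fun i => i.elim0⟩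
  constructor
  · intro x y _
    exact DFinsupp.ext fun i => i.elim0
  · intro x
    exact ⟨0, Subsingleton.elim _ _⟩

theorem exists_decomposition_prod {M N : Type} [AddCommGroup M] [Module R M] [AddCommGroup N]
    [Module R N] (hM : IsIndecModule R M) (hN : IsIndecModule R N) (hMN : IsEmpty (M ≃ₗ[R] N)) :
    ∃ L : Fin 2 → Submodule R (M × N), DirectSum.IsInternal L ∧ (∀ i, IsIndecModule R (L i)) ∧
      ∀ i j, i ≠ j → IsEmpty ((L i) ≃ₗ[R] (L j)) := by
  have e1 := LinearEquiv.ofInjective (LinearMap.inl R M N) LinearMap.inl_injective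
  have e2 := LinearEquiv.ofInjective (LinearMap.inr R M N) LinearMap.inr_injective
  exact exists_decomposition_of_isCompl LinearMap.isCompl_range_inl_inr (hM.of_equiv e1)
    (hN.of_equiv e2) ⟨fun e => hMN.false ((e1.trans e).trans e2.symm)⟩

/-- A finite projective presentation of a module. -/
structure Presentation (R : Type) [Ring R] (M : Type) [AddCommGroup M] [Module R M] where
  P₁ : Type
  P₀ : Type
  [ab₁ : AddCommGroup P₁]
  [ab₀ : AddCommGroup P₀]
  [mod₁ : Module R P₁]
  [mod₀ : Module R P₀]
  f : P₁ →ₗ[R] P₀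
  g : P₀ →ₗ[R] M
  fin₁ : Module.Finite R P₁
  proj₁ : Module.Projective R P₁
  fin₀ : Module.Finite R P₀
  proj₀ : Module.Projective R P₀
  surj : Function.Surjective g
  exact' : LinearMap.range f = LinearMap.ker g

attribute [instance] Presentation.ab₁ Presentation.ab₀ Presentation.mod₁ Presentation.mod₀

/-- Every morphism from the syzygy cover of the presentation to `N` extends to the cover. -/
def Presentation.Rigid {M : Type} [AddCommGroup M] [Module R M] (p : Presentation R M)
    (N : Type) [AddCommGroup N] [Module R N] : Prop :=
  ∀ h : p.P₁ →ₗ[R] N, ∃ h' : p.P₀ →ₗ[R] N, h = h'.comp p.f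

theorem Presentation.finite {M : Type} [AddCommGroup M] [Module R M] (p : Presentation R M) :
    Module.Finite R M :=
  have := p.fin₀
  Module.Finite.of_surjective p.g p.surj

theorem isTauRigidCat_prod {M N : Type} [AddCommGroup M] [Module R M] [AddCommGroup N]
    [Module R N] (p : Presentation R M) (q : Presentation R N) (hMM : p.Rigid M)
    (hMN : p.Rigid N) (hNM : q.Rigid M) (hNN : q.Rigid N) :
    IsTauRigidCat R (ModuleCat.of R (M × N)) := by
  have := p.finite
  have := q.finite
  have := p.fin₀
  have := p.fin₁
  have := q.fin₀
  have := q.fin₁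
  have := p.proj₀
  have := p.proj₁
  have := q.proj₀
  have := q.proj₁
  refine ⟨inferInstanceAs (Module.Finite R (M × N)), ModuleCat.of R (p.P₁ × q.P₁),
    ModuleCat.of R (p.P₀ × q.P₀), p.f.prodMap q.f, p.g.prodMap q.g,
    inferInstanceAs (Module.Finite R (p.P₁ × q.P₁)),
    inferInstanceAs (Module.Projective R (p.P₁ × q.P₁)),
    inferInstanceAs (Module.Finite R (p.P₀ × q.P₀)),
    inferInstanceAs (Module.Projective R (p.P₀ × q.P₀)), ?_, ?_, ?_⟩
  · exact Prod.map_surjective.mpr ⟨p.surj, q.surj⟩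
  · rw [LinearMap.range_prodMap, LinearMap.ker_prodMap, p.exact', q.exact']
  · intro (h : p.P₁ × q.P₁ →ₗ[R] M × N)
    obtain ⟨a, ha⟩ := hMM (LinearMap.fst R M N ∘ₗ h ∘ₗ LinearMap.inl R _ _)
    obtain ⟨b, hb⟩ := hMN (LinearMap.snd R M N ∘ₗ h ∘ₗ LinearMap.inl R _ _)
    obtain ⟨c, hc⟩ := hNM (LinearMap.fst R M N ∘ₗ h ∘ₗ LinearMap.inr R _ _)
    obtain ⟨d, hd⟩ := hNN (LinearMap.snd R M N ∘ₗ h ∘ₗ LinearMap.inr R _ _)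
    refine ⟨LinearMap.coprod (a.prod b) (c.prod d), ?_⟩
    apply LinearMap.ext
    rintro ⟨x, y⟩
    have ha' := LinearMap.congr_fun ha x
    have hb' := LinearMap.congr_fun hb x
    have hc' := LinearMap.congr_fun hc y
    have hd' := LinearMap.congr_fun hd y
    simp only [LinearMap.comp_apply, LinearMap.fst_apply, LinearMap.snd_apply,
      LinearMap.inl_apply, LinearMap.inr_apply] at ha' hb' hc' hd'
    have : h (x, y) = h (x, 0) + h (0, y) := by rw [← map_add]; simp
    change h (x, y) = _
    rw [this]
    refine Prod.ext ?_ ?_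
    · simp [ha', hc']
    · simp [hb', hd']

end Modules

/-- An infinite family of indecomposable modules whose consecutive members are mutually rigid
and which is separated by the dimension of the morphism space into a fixed module. -/
theorem not_isTauTiltingFinite_of_family (K : Type) [Field K] (Λ : Type) [Ring Λ]
    (hR : HasIndecClassCount Λᵐᵒᵖ (ModuleCat.of Λᵐᵒᵖ Λᵐᵒᵖ) 2)
    (M : ℕ → Type) [∀ n, AddCommGroup (M n)] [∀ n, Module Λᵐᵒᵖ (M n)]
    (hM : ∀ n, IsIndecModule Λᵐᵒᵖ (M n)) (p : ∀ n, Presentation Λᵐᵒᵖ (M n))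
    (hrig : ∀ n m, n ≤ m + 1 → (p n).Rigid (M m))
    (S : Type) [AddCommGroup S] [Module Λᵐᵒᵖ S] [Module K S] [SMulCommClass Λᵐᵒᵖ K S]
    (d : ℕ → ℕ) (hd : StrictMono d) (hS : ∀ n, Nonempty ((M n →ₗ[Λᵐᵒᵖ] S) ≃ₗ[K] (Fin (d n) → K))) :
    ¬ IsTauTiltingFinite Λ := by
  rintro ⟨N, L, hL⟩
  have hinv : ∀ n m, Nonempty (M n ≃ₗ[Λᵐᵒᵖ] M m) → n = m := by
    rintro n m ⟨e⟩
    obtain ⟨a⟩ := hS n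
    obtain ⟨b⟩ := hS m
    have := ((a.symm.trans (LinearEquiv.congrLeft S K e)).trans b).finrank_eq
    simp only [Module.finrank_fin_fun] at this
    exact hd.injective this
  have hdec n := exists_decomposition_prod (hM n) (hM (n + 1))
    ⟨fun e => by simpa using hinv _ _ ⟨e⟩⟩
  have hT : ∀ n, IsBasicSupportTauTilting Λ (ModuleCat.of Λᵐᵒᵖ (M n × M (n + 1))) := by
    intro n
    obtain ⟨Q, h1, h2, h3⟩ := hdec n
    refine ⟨⟨isTauRigidCat_prod (p n) (p (n + 1)) (hrig _ _ (by lia)) (hrig _ _ (by lia))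
      (hrig _ _ (by lia)) (hrig _ _ (by lia)), ModuleCat.of _ PUnit, 2, 0, 2, ?_, ?_, ?_,
      ?_, hasIndecClassCount_punit, hR, rfl⟩, 2, Q, h1, h2, h3⟩
    · exact inferInstanceAs (Module.Finite Λᵐᵒᵖ PUnit)
    · exact inferInstanceAs (Module.Projective Λᵐᵒᵖ PUnit)
    · intro f
      apply LinearMap.ext
      intro x
      rw [show x = 0 from Subsingleton.elim (α := PUnit) _ _, map_zero, map_zero]
    · exact hasIndecClassCount_of_basic (M := ModuleCat.of Λᵐᵒᵖ (M n × M (n + 1))) h1 h2 h3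
  choose c hc using fun n => hL _ (hT n)
  obtain ⟨n, m, hnm, hcc⟩ := Finite.exists_ne_map_eq_of_infinite c
  obtain ⟨e1⟩ := hc n
  obtain ⟨e2⟩ := hc m
  rw [hcc] at e1
  have e : (M n × M (n + 1)) ≃ₗ[Λᵐᵒᵖ] (M m × M (m + 1)) := e1.trans e2.symm
  obtain ⟨a⟩ := hS n
  obtain ⟨a'⟩ := hS (n + 1)
  obtain ⟨b⟩ := hS m
  obtain ⟨b'⟩ := hS (m + 1)
  have := (((a.prodCongr a').symm.trans (LinearMap.coprodEquiv K)).trans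
    ((LinearEquiv.congrLeft S K e).trans ((LinearMap.coprodEquiv K).symm.trans
      (b.prodCongr b')))).finrank_eq
  simp only [Module.finrank_prod, Module.finrank_fin_fun] at this
  rcases lt_or_gt_of_ne hnm with h | h
  · have := hd h
    have := hd (show n + 1 < m + 1 by lia)
    lia
  · have := hd h
    have := hd (show m + 1 < n + 1 by lia)
    lia

open Polynomial in
/-- A two-vertex path algebra modulo relations which are homogeneous for the weight `wt` of the
arrows. The grading is recorded by the coaction `δ`. Arrows act on the left, so that
`ar a = v (t a) * ar a * v (s a)`. -/
structure GradedKit (K R σ : Type) [Field K] [Ring R] [Algebra K R] [Fintype σ] where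
  v : Fin 2 → R
  ar : σ → R
  s : σ → Fin 2
  t : σ → Fin 2
  wt : σ → ℕ
  idem : ∀ i, v i * v i = v i
  orth : ∀ i j, i ≠ j → v i * v j = 0
  vsum : v 0 + v 1 = 1
  src : ∀ a, ar a * v (s a) = ar a
  tgt : ∀ a, v (t a) * ar a = ar a
  δ : R →ₐ[K] R[X]
  δ_v : ∀ i, δ (v i) = C (v i)
  δ_ar : ∀ a, δ (ar a) = C (ar a) * X ^ wt a
  eval_δ : ∀ r, (δ r).eval 1 = r
  decomp : ∀ r, ∃ (c : Fin 2 → K) (y : σ → R), r = ∑ i, c i • v i + ∑ a, ar a * y a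
  wt_zero_mul : ∀ a b, wt a = 0 → wt b = 0 → ar a * ar b = 0

namespace GradedKit

variable {K R σ : Type} [Field K] [Ring R] [Algebra K R] [Fintype σ] (Q : GradedKit K R σ)

/-- Elements all of whose homogeneous components have degree at least `k`. -/
def J (k : ℕ) : Submodule K R where
  carrier := {r | ∀ i < k, (Q.δ r).coeff i = 0}
  add_mem' {a b} ha hb i hi := by simp [ha i hi, hb i hi]
  zero_mem' i _ := by simp
  smul_mem' c x hx i hi := by simp [hx i hi]

theorem mem_J_zero (r : R) : r ∈ Q.J 0 := fun i hi => absurd hi (Nat.not_lt_zero i)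

theorem mul_mem_J {k l : ℕ} {r s : R} (hr : r ∈ Q.J k) (hs : s ∈ Q.J l) : r * s ∈ Q.J (k + l) := by
  intro n hn
  rw [map_mul, Polynomial.coeff_mul]
  refine Finset.sum_eq_zero fun x hx => ?_
  rw [Finset.HasAntidiagonal.mem_antidiagonal] at hx
  by_cases h : x.1 < k
  · rw [hr _ h, zero_mul]
  · rw [hs _ (by lia), mul_zero]

theorem J_mul_left {k : ℕ} (r : R) {s : R} (hs : s ∈ Q.J k) : r * s ∈ Q.J k := by
  simpa using Q.mul_mem_J (Q.mem_J_zero r) hs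

theorem J_mul_right {k : ℕ} {r : R} (hr : r ∈ Q.J k) (s : R) : r * s ∈ Q.J k := by
  simpa using Q.mul_mem_J hr (Q.mem_J_zero s)

theorem J_anti {k l : ℕ} (h : k ≤ l) {r : R} (hr : r ∈ Q.J l) : r ∈ Q.J k :=
  fun i hi => hr i (by lia)

theorem ar_mem_J (a : σ) : Q.ar a ∈ Q.J (Q.wt a) := by
  intro i hi
  rw [Q.δ_ar, Polynomial.coeff_C_mul, Polynomial.coeff_X_pow, if_neg (by lia), mul_zero]

theorem eq_zero_of_mem_J {r : R} (h : ∀ k, r ∈ Q.J k) : r = 0 := by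
  have : Q.δ r = 0 := Polynomial.ext fun i => by simpa using h (i + 1) i (by lia)
  rw [← Q.eval_δ r, this, Polynomial.eval_zero]

theorem eq_sum_coeff {r : R} {k : ℕ} (h : (Q.δ r).natDegree < k) :
    r = ∑ i ∈ Finset.range k, (Q.δ r).coeff i := by
  conv_lhs => rw [← Q.eval_δ r, Polynomial.eval_eq_sum_range' h]
  simp

theorem v_zero_mul_one : Q.v 0 * Q.v 1 = 0 := Q.orth 0 1 (by decide)

theorem v_one_mul_zero : Q.v 1 * Q.v 0 = 0 := Q.orth 1 0 (by decide)

theorem exists_sq_mem_J (i : Fin 2) (r : R) :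
    ∃ c : K, (Q.v i * r * Q.v i - c • Q.v i) * (Q.v i * r * Q.v i - c • Q.v i) ∈ Q.J 1 := by
  classical
  have hv : ∀ i j, Q.v i * Q.v j = if i = j then Q.v i else 0 := by
    intro i j
    split_ifs with h
    · rw [← h, Q.idem]
    · exact Q.orth _ _ h
  let W : Submodule K R := Submodule.span K (Set.range fun a : {a : σ // Q.wt a = 0} => Q.ar a)
  have hWW : ∀ x ∈ W, ∀ y ∈ W, x * y = 0 := by
    intro x hx y hy
    induction hx using Submodule.span_induction with
    | mem x h =>
      induction hy using Submodule.span_induction with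
      | mem y h' =>
        obtain ⟨a, rfl⟩ := h
        obtain ⟨b, rfl⟩ := h'
        exact Q.wt_zero_mul _ _ a.2 b.2
      | zero => simp
      | add y z _ _ h1 h2 => rw [mul_add, h1, h2, add_zero]
      | smul c y _ h1 => rw [mul_smul_comm, h1, smul_zero]
    | zero => simp
    | add y z _ _ h1 h2 => rw [add_mul, h1, h2, add_zero]
    | smul c y _ h1 => rw [smul_mul_assoc, h1, smul_zero]
  have hvW : ∀ x ∈ W, Q.v i * x * Q.v i ∈ W := by
    intro x hx
    induction hx using Submodule.span_induction with
    | mem x h =>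
      obtain ⟨a, rfl⟩ := h
      have e : Q.v i * Q.ar a * Q.v i = if i = Q.t a ∧ Q.s a = i then Q.ar a else 0 := by
        conv_lhs => rw [← Q.src a, ← Q.tgt a, mul_assoc, mul_assoc, mul_assoc, hv,
          ← mul_assoc, hv]
        by_cases h1 : i = Q.t a <;> by_cases h2 : Q.s a = i
        · simp only [h1, h2, if_true, and_self]
          rw [← h1, ← h2, Q.src, h2, h1, Q.tgt]
        · rw [if_neg h2, if_neg (fun h : _ ∧ _ => h2 h.2), mul_zero, mul_zero]
        all_goals rw [if_neg h1, if_neg (fun h : _ ∧ _ => h1 h.1), zero_mul]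
      rw [e]
      split_ifs
      · exact Submodule.subset_span ⟨a, rfl⟩
      · exact zero_mem _
    | zero => simp
    | add y z _ _ h1 h2 => rw [mul_add, add_mul]; exact add_mem h1 h2
    | smul c y _ h1 => rw [mul_smul_comm, smul_mul_assoc]; exact W.smul_mem _ h1
  have har : ∀ a y, Q.ar a * y ∈ W ⊔ Q.J 1 := by
    intro a y
    by_cases ha : Q.wt a = 0
    · obtain ⟨c, z, rfl⟩ := Q.decomp y
      rw [mul_add, Finset.mul_sum, Finset.mul_sum]
      refine add_mem (sum_mem fun j _ => ?_) (sum_mem fun b _ => ?_)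
      · rw [mul_smul_comm]
        refine Submodule.smul_mem _ _ ?_
        have : Q.ar a * Q.v j = Q.ar a * (Q.v (Q.s a) * Q.v j) := by rw [← mul_assoc, Q.src]
        rw [this, hv]
        split_ifs
        · rw [Q.src]
          exact Submodule.mem_sup_left (Submodule.subset_span ⟨⟨a, ha⟩, rfl⟩)
        · rw [mul_zero]; exact zero_mem _
      · rw [← mul_assoc]
        by_cases hb : Q.wt b = 0
        · rw [Q.wt_zero_mul a b ha hb, zero_mul]; exact zero_mem _
        · exact Submodule.mem_sup_right (Q.J_mul_right (Q.J_mul_left _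
            (Q.J_anti (by lia) (Q.ar_mem_J b))) _)
    · exact Submodule.mem_sup_right (Q.J_mul_right (Q.J_anti (by lia) (Q.ar_mem_J a)) _)
  obtain ⟨c, y, hr⟩ := Q.decomp r
  have h1 : (∑ a, Q.ar a * y a) ∈ W ⊔ Q.J 1 := sum_mem fun a _ => har a _
  obtain ⟨n, hn, j, hj, hnj⟩ := Submodule.mem_sup.mp h1
  refine ⟨c i, ?_⟩
  have e : Q.v i * r * Q.v i - c i • Q.v i = Q.v i * n * Q.v i + Q.v i * j * Q.v i := by
    rw [hr, ← hnj]
    have : Q.v i * (∑ j, c j • Q.v j) * Q.v i = c i • Q.v i := by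
      rw [Finset.mul_sum, Finset.sum_mul, Finset.sum_eq_single i]
      · rw [mul_smul_comm, smul_mul_assoc, Q.idem, Q.idem]
      · intro b _ hb
        rw [mul_smul_comm, smul_mul_assoc, Q.orth _ _ (Ne.symm hb)]; simp
      · simp
    rw [mul_add, add_mul, this, mul_add, add_mul]
    abel
  have hj' : Q.v i * j * Q.v i ∈ Q.J 1 := Q.J_mul_right (Q.J_mul_left _ hj) _
  rw [e, add_mul, mul_add, hWW _ (hvW n hn) _ (hvW n hn), zero_add]
  exact add_mem (Q.J_mul_left _ hj') (Q.J_mul_right hj' _)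

section Filtration

variable {M : Type} [AddCommGroup M] [Module R M] [Module K M] [IsScalarTower K R M]
  {ι : Type} [Fintype ι] (w : ι → M)

/-- The degree filtration on a module generated by `w`. -/
def F (k : ℕ) : Submodule K M where
  carrier := {m | ∃ x : ι → R, (∀ i, x i ∈ Q.J k) ∧ m = ∑ i, x i • w i}
  add_mem' := by
    rintro a b ⟨x, hx, rfl⟩ ⟨y, hy, rfl⟩
    exact ⟨x + y, fun i => add_mem (hx i) (hy i), by simp [add_smul, Finset.sum_add_distrib]⟩
  zero_mem' := ⟨0, fun i => zero_mem _, by simp⟩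
  smul_mem' := by
    rintro c a ⟨x, hx, rfl⟩
    exact ⟨c • x, fun i => (Q.J k).smul_mem c (hx i), by simp [Finset.smul_sum]⟩

theorem smul_mem_F {k l : ℕ} {r : R} {m : M} (hr : r ∈ Q.J k) (hm : m ∈ Q.F w l) :
    r • m ∈ Q.F w (k + l) := by
  obtain ⟨x, hx, rfl⟩ := hm
  exact ⟨fun i => r * x i, fun i => Q.mul_mem_J hr (hx i), by simp [Finset.smul_sum, mul_smul]⟩

theorem map_mem_F {l k : ℕ} (e : M →ₗ[R] M) (h : ∀ i, e (w i) ∈ Q.F w l) {m : M}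
    (hm : m ∈ Q.F w k) : e m ∈ Q.F w (k + l) := by
  obtain ⟨x, hx, rfl⟩ := hm
  rw [map_sum]
  refine sum_mem fun i _ => ?_
  rw [map_smul]
  exact Q.smul_mem_F w (hx i) (h i)

theorem idempotent_trivial (hgen : ∀ m, m ∈ Q.F w 0) (hsep : ∀ m, (∀ k, m ∈ Q.F w k) → m = 0)
    (e : M →ₗ[R] M) (he : ∀ x, e (e x) = e x) (c : K)
    (hc : ∀ i, e (e (w i) - c • w i) - c • (e (w i) - c • w i) ∈ Q.F w 1) :
    (∀ x, e x = 0) ∨ ∀ x, e x = x := by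
  let D : M →ₗ[R] M := (e - c • LinearMap.id) ∘ₗ (e - c • LinearMap.id)
  have hD : ∀ x, D x = e (e x - c • x) - c • (e x - c • x) := fun x => by simp [D]
  have hDF : ∀ k m, m ∈ Q.F w k → D m ∈ Q.F w (k + 1) := fun k m hm =>
    Q.map_mem_F w D (fun i => by rw [hD]; exact hc i) hm
  have hec : ∀ (k : K) x, e (k • x) = k • e x := fun k x => by
    rw [algebra_compatible_smul R, map_smul, ← algebra_compatible_smul R]
  by_cases h0 : c = 0
  · left
    intro x
    refine hsep _ fun k => ?_
    induction k with
    | zero => exact hgen _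
    | succ k ih =>
      have := hDF _ _ ih
      rw [hD] at this
      simpa [h0, he] using this
  · right
    intro x
    have : e x - x = 0 := by
      refine hsep _ fun k => ?_
      induction k with
      | zero => exact hgen _
      | succ k ih =>
        have := hDF _ _ ih
        have h1 : e (e x - x) = 0 := by rw [map_sub, he, sub_self]
        rw [hD, h1, zero_sub, map_neg, hec, h1, smul_zero, neg_zero, zero_sub, smul_neg, neg_neg,
          smul_smul] at this
        have h2 := (Q.F w (k + 1)).smul_mem ((c * c)⁻¹) this
        rwa [inv_smul_smul₀ (mul_self_ne_zero.mpr h0)] at h2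
    exact sub_eq_zero.mp this

end Filtration

end GradedKit

section RepMod
variable {K R V : Type} [Field K] [Ring R] [Algebra K R] [AddCommGroup V] [Module K V]

/-- The module given by a representation of an algebra on a vector space. -/
def RepMod (_ : R →ₐ[K] Module.End K V) : Type := V

variable (Φ : R →ₐ[K] Module.End K V)

instance : AddCommGroup (RepMod Φ) := inferInstanceAs (AddCommGroup V)
instance : Module K (RepMod Φ) := inferInstanceAs (Module K V)
instance : Module R (RepMod Φ) := Module.compHom V Φ.toRingHom

theorem RepMod.smul_def (r : R) (x : RepMod Φ) : r • x = (Φ r : V →ₗ[K] V) x := rfl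

instance : IsScalarTower K R (RepMod Φ) :=
  ⟨fun c r x => by simp only [RepMod.smul_def, map_smul]; rfl⟩

end RepMod

namespace GradedKit

variable {K R σ : Type} [Field K] [Ring R] [Algebra K R] [Fintype σ] (Q : GradedKit K R σ)

/-- The indecomposable projective module `R v i`. -/
def P (i : Fin 2) : Submodule R R where
  carrier := {x | x * Q.v i = x}
  add_mem' {a b} ha hb := by
    simp only [Set.mem_ofPred_eq] at *
    rw [add_mul, ha, hb]
  zero_mem' := by simp
  smul_mem' c x hx := by
    simp only [Set.mem_ofPred_eq, smul_eq_mul] at *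
    rw [mul_assoc, hx]

theorem mem_P {i : Fin 2} {x : R} : x ∈ Q.P i ↔ x * Q.v i = x := Iff.rfl

/-- Right multiplication by `v i`. -/
def toP (i : Fin 2) : R →ₗ[R] Q.P i where
  toFun x := ⟨x * Q.v i, by rw [mem_P, mul_assoc, Q.idem]⟩
  map_add' x y := Subtype.ext (add_mul _ _ _)
  map_smul' x y := Subtype.ext (mul_assoc _ _ _)

theorem toP_subtype (i : Fin 2) : Q.toP i ∘ₗ (Q.P i).subtype = LinearMap.id :=
  LinearMap.ext fun x => Subtype.ext x.2

instance (i : Fin 2) : Module.Finite R (Q.P i) :=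
  Module.Finite.of_surjective (Q.toP i) fun x =>
    ⟨x, LinearMap.congr_fun (Q.toP_subtype i) x⟩

instance (i : Fin 2) : Module.Projective R (Q.P i) :=
  Module.Projective.of_split _ _ (Q.toP_subtype i)

instance (i : Fin 2) (κ : Type) [Fintype κ] [DecidableEq κ] :
    Module.Projective R (κ → Q.P i) :=
  Module.Projective.of_equiv' (DirectSum.linearEquivFunOnFintype R κ fun _ => Q.P i)

/-- The generator of `P i`. -/
def gen (i : Fin 2) : Q.P i := ⟨Q.v i, Q.idem i⟩

theorem eq_smul_gen {i : Fin 2} (x : Q.P i) : x = (x : R) • Q.gen i := Subtype.ext x.2.symm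

/-- A presentation `(R v 1)^κ → (R v 0)^ι` given by a matrix homogeneous of degree one. -/
structure Pres where
  ι : Type
  κ : Type
  [fι : Fintype ι]
  [fκ : Fintype κ]
  [dι : DecidableEq ι]
  [dκ : DecidableEq κ]
  ρ : κ → ι → R
  v_ρ : ∀ j i, Q.v 1 * ρ j i = ρ j i
  ρ_v : ∀ j i, ρ j i * Q.v 0 = ρ j i
  δ_ρ : ∀ j i, Q.δ (ρ j i) = Polynomial.C (ρ j i) * Polynomial.X

attribute [instance] Pres.fι Pres.fκ Pres.dι Pres.dκ

namespace Pres
variable {Q} (p : Q.Pres)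

/-- The presentation map. -/
def f : (p.κ → Q.P 1) →ₗ[R] (p.ι → Q.P 0) where
  toFun x i := ⟨∑ j, (x j : R) * p.ρ j i, by
    rw [mem_P, Finset.sum_mul]
    simp only [mul_assoc, p.ρ_v]⟩
  map_add' x y := by
    ext i
    simp [add_mul, Finset.sum_add_distrib]
  map_smul' r x := by
    ext i
    simp [Finset.mul_sum, mul_assoc]

/-- The module with the given presentation. -/
def M : Type := (p.ι → Q.P 0) ⧸ LinearMap.range p.f

instance : AddCommGroup p.M := inferInstanceAs (AddCommGroup ((p.ι → Q.P 0) ⧸ LinearMap.range p.f))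
instance : Module R p.M := inferInstanceAs (Module R ((p.ι → Q.P 0) ⧸ LinearMap.range p.f))
instance : Module K p.M := inferInstanceAs (Module K ((p.ι → Q.P 0) ⧸ LinearMap.range p.f))
instance : IsScalarTower K R p.M :=
  inferInstanceAs (IsScalarTower K R ((p.ι → Q.P 0) ⧸ LinearMap.range p.f))

/-- The projective cover. -/
def proj : (p.ι → Q.P 0) →ₗ[R] p.M := Submodule.mkQ _

theorem proj_surjective : Function.Surjective p.proj := Submodule.mkQ_surjective _

theorem ker_proj : LinearMap.ker p.proj = LinearMap.range p.f := Submodule.ker_mkQ _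

/-- The generators. -/
def w (i : p.ι) : p.M := p.proj (Pi.single i (Q.gen 0))

theorem proj_apply (x : p.ι → Q.P 0) : p.proj x = ∑ i, (x i : R) • p.w i := by
  have : x = ∑ i, (x i : R) • (Pi.single i (Q.gen 0) : p.ι → Q.P 0) := by
    simp_rw [← Pi.single_smul, ← eq_smul_gen]
    exact (Finset.univ_sum_single x).symm
  conv_lhs => rw [this]
  simp only [map_sum, map_smul, w]

theorem v_smul_w (i : p.ι) : Q.v 0 • p.w i = p.w i := by
  rw [w, ← map_smul, ← Pi.single_smul]
  exact congrArg (fun z => p.proj (Pi.single i z)) (Subtype.ext (Q.idem 0))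

theorem rel (j : p.κ) : ∑ i, p.ρ j i • p.w i = 0 := by
  have h : p.proj (p.f (Pi.single j (Q.gen 1))) = 0 := by
    rw [← LinearMap.mem_ker, ker_proj]
    exact ⟨_, rfl⟩
  rw [proj_apply] at h
  rw [← h]
  refine Finset.sum_congr rfl fun i _ => ?_
  congr 1
  change _ = ∑ j', ((Pi.single j (Q.gen 1) : p.κ → Q.P 1) j' : R) * p.ρ j' i
  rw [Finset.sum_eq_single j]
  · rw [Pi.single_eq_same]
    exact (p.v_ρ j i).symm
  · intro b _ hb
    rw [Pi.single_eq_of_ne hb]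
    simp
  · simp

theorem exists_eq_sum (m : p.M) : ∃ x : p.ι → R, m = ∑ i, x i • p.w i := by
  obtain ⟨x, rfl⟩ := p.proj_surjective m
  exact ⟨_, p.proj_apply x⟩

theorem mem_F_zero (m : p.M) : m ∈ Q.F p.w 0 := by
  obtain ⟨x, hx⟩ := p.exists_eq_sum m
  exact ⟨x, fun i => Q.mem_J_zero _, hx⟩

theorem hom_ext {N : Type} [AddCommGroup N] [Module R N] {a b : p.M →ₗ[R] N}
    (h : ∀ i, a (p.w i) = b (p.w i)) : a = b := by
  apply LinearMap.ext
  intro m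
  obtain ⟨x, rfl⟩ := p.exists_eq_sum m
  simp [h]

theorem eq_zero_of_mem_F (m : p.M) (h : ∀ k, m ∈ Q.F p.w k) : m = 0 := by
  obtain ⟨x, rfl⟩ := p.proj_surjective m
  obtain ⟨k, hk⟩ : ∃ k, ∀ i, (Q.δ (x i)).natDegree < k :=
    ⟨∑ i, (Q.δ (x i)).natDegree + 1, fun i => Nat.lt_succ_of_le
      (Finset.single_le_sum (f := fun i => (Q.δ (x i : R)).natDegree)
        (fun _ _ => Nat.zero_le _) (Finset.mem_univ i))⟩
  obtain ⟨y, hy, hxy⟩ := h k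
  let y' : p.ι → Q.P 0 := fun i => Q.toP 0 (y i)
  have hy' : p.proj y' = p.proj x := by
    rw [hxy, proj_apply]
    refine Finset.sum_congr rfl fun i _ => ?_
    change (y i * Q.v 0) • p.w i = _
    rw [mul_smul, v_smul_w]
  have hxy' : x - y' ∈ LinearMap.range p.f := by
    rw [← ker_proj, LinearMap.mem_ker, map_sub, hy', sub_self]
  obtain ⟨z, hz⟩ := hxy'
  rw [← LinearMap.mem_ker, ker_proj]
  refine ⟨fun j => Q.toP 1 (∑ s ∈ Finset.range (k - 1), (Q.δ (z j)).coeff s), ?_⟩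
  funext i
  apply Subtype.ext
  change ∑ j, (∑ s ∈ Finset.range (k - 1), (Q.δ (z j)).coeff s) * Q.v 1 * p.ρ j i = x i
  have h1 : (x i : R) = (∑ j, (z j : R) * p.ρ j i) + y i * Q.v 0 := by
    have := congrArg Subtype.val (congrFun hz i)
    change (∑ j, (z j : R) * p.ρ j i) = x i - y i * Q.v 0 at this
    rw [this, sub_add_cancel]
  have h2 : ∀ s < k, (Q.δ (x i)).coeff s =
      ∑ j, (Q.δ (z j) * Polynomial.X).coeff s * p.ρ j i := by
    intro s hs
    have : (Q.δ (y i * Q.v 0)).coeff s = 0 := Q.J_mul_right (hy i) _ s hs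
    conv_lhs => rw [h1, map_add, Polynomial.coeff_add, this, add_zero, map_sum,
      Polynomial.finsetSum_coeff]
    refine Finset.sum_congr rfl fun j _ => ?_
    rw [map_mul, p.δ_ρ, ← Polynomial.X_mul_C, ← mul_assoc, Polynomial.coeff_mul_C]
  rw [Q.eq_sum_coeff (hk i), Finset.sum_congr rfl fun s hs => h2 s (Finset.mem_range.mp hs),
    Finset.sum_comm]
  refine Finset.sum_congr rfl fun j _ => ?_
  rw [mul_assoc, p.v_ρ, ← Finset.sum_mul]
  congr 1
  rcases k with _ | k
  · exact absurd (hk i) (Nat.not_lt_zero _)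
  · rw [Finset.sum_range_succ']
    simp [Polynomial.coeff_mul_X]

theorem exists_lift {N : Type} [AddCommGroup N] [Module R N] (φ : p.ι → N)
    (h0 : ∀ i, Q.v 0 • φ i = φ i) (h : ∀ j, ∑ i, p.ρ j i • φ i = 0) :
    ∃ g : p.M →ₗ[R] N, ∀ i, g (p.w i) = φ i := by
  let g₀ : (p.ι → Q.P 0) →ₗ[R] N :=
    ∑ i, (LinearMap.toSpanSingleton R N (φ i)) ∘ₗ (Q.P 0).subtype ∘ₗ LinearMap.proj i
  have hg₀ : ∀ x, g₀ x = ∑ i, (x i : R) • φ i := fun x => by simp [g₀]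
  refine ⟨Submodule.liftQ _ g₀ ?_, fun i => ?_⟩
  · rintro _ ⟨z, rfl⟩
    rw [LinearMap.mem_ker, hg₀]
    change ∑ i, (∑ j, (z j : R) * p.ρ j i) • φ i = 0
    simp_rw [Finset.sum_smul, mul_smul]
    rw [Finset.sum_comm]
    simp_rw [← Finset.smul_sum, h, smul_zero, Finset.sum_const_zero]
  · change g₀ (Pi.single i (Q.gen 0)) = φ i
    rw [hg₀, Finset.sum_eq_single i]
    · rw [Pi.single_eq_same]
      exact h0 i
    · intro b _ hb
      rw [Pi.single_eq_of_ne hb]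
      simp
    · simp

/-- The presentation as a projective presentation. -/
def presentation : Presentation R p.M where
  P₁ := p.κ → Q.P 1
  P₀ := p.ι → Q.P 0
  f := p.f
  g := p.proj
  fin₁ := inferInstance
  proj₁ := inferInstance
  fin₀ := inferInstance
  proj₀ := inferInstance
  surj := p.proj_surjective
  exact' := p.ker_proj.symm

theorem rigid {N : Type} [AddCommGroup N] [Module R N]
    (H : ∀ h : p.κ → N, (∀ j, Q.v 1 • h j = h j) →
      ∃ φ : p.ι → N, ∀ j, ∑ i, p.ρ j i • φ i = h j) : p.presentation.Rigid N := by
  intro (h : (p.κ → Q.P 1) →ₗ[R] N)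
  obtain ⟨φ, hφ⟩ := H (fun j => h (Pi.single j (Q.gen 1))) fun j => by
    rw [← map_smul, ← Pi.single_smul]
    exact congrArg (fun z => h (Pi.single j z)) (Subtype.ext (Q.idem 1))
  let g₀ : (p.ι → Q.P 0) →ₗ[R] N :=
    ∑ i, (LinearMap.toSpanSingleton R N (φ i)) ∘ₗ (Q.P 0).subtype ∘ₗ LinearMap.proj i
  have hg₀ : ∀ x, g₀ x = ∑ i, (x i : R) • φ i := fun x => by simp [g₀]
  refine ⟨g₀, ?_⟩
  apply LinearMap.ext
  intro (z : p.κ → Q.P 1)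
  change h z = g₀ (p.f z)
  rw [hg₀]
  change _ = ∑ i, (∑ j, (z j : R) * p.ρ j i) • φ i
  simp_rw [Finset.sum_smul, mul_smul]
  rw [Finset.sum_comm]
  simp_rw [← Finset.smul_sum, hφ, ← map_smul, ← Pi.single_smul, ← eq_smul_gen, ← map_sum]
  rw [Finset.univ_sum_single]

variable (Φ : R →ₐ[K] Module.End K K)

theorem nonempty_hom_equiv (h1 : Φ (Q.v 1) = 0) :
    Nonempty ((p.M →ₗ[R] RepMod Φ) ≃ₗ[K] (p.ι → K)) := by
  have hv0 : Φ (Q.v 0) = 1 := by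
    have := congrArg Φ Q.vsum
    rwa [map_add, h1, add_zero, map_one] at this
  refine ⟨LinearEquiv.ofBijective
    { toFun := fun g i => (g (p.w i) : RepMod Φ)
      map_add' := fun _ _ => rfl
      map_smul' := fun _ _ => rfl } ⟨?_, ?_⟩⟩
  · intro a b hab
    exact p.hom_ext fun i => congrFun hab i
  · intro c
    obtain ⟨g, hg⟩ := p.exists_lift (N := RepMod Φ) c
      (fun i => by rw [RepMod.smul_def, hv0]; rfl) (fun j => by
        refine Finset.sum_eq_zero fun i _ => ?_
        rw [← p.v_ρ, mul_smul, RepMod.smul_def, h1]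
        rfl)
    exact ⟨g, funext hg⟩

theorem isIndecModule [Nonempty p.ι] (h1 : Φ (Q.v 1) = 0)
    (h : ∀ e : p.M →ₗ[R] p.M, ∃ c : K, ∀ i, 
      e (e (p.w i) - c • p.w i) - c • (e (p.w i) - c • p.w i) ∈ Q.F p.w 1) :
    IsIndecModule R p.M := by
  have : Nontrivial p.M := by
    by_contra hn
    rw [not_nontrivial_iff_subsingleton] at hn
    obtain ⟨E⟩ := p.nonempty_hom_equiv Φ h1
    have : Subsingleton (p.ι → K) := E.symm.toEquiv.subsingleton
    exact not_subsingleton _ this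
  refine isIndecModule_of_idempotent fun e he => ?_
  obtain ⟨c, hc⟩ := h e
  exact Q.idempotent_trivial p.w p.mem_F_zero p.eq_zero_of_mem_F e he c hc

end Pres

theorem isIndecModule_P (i : Fin 2) (hi : Q.v i ≠ 0) : IsIndecModule R (Q.P i) := by
  have : Nontrivial (Q.P i) := ⟨Q.gen i, 0, fun h => hi (congrArg Subtype.val h)⟩
  refine isIndecModule_of_idempotent fun e he => ?_
  obtain ⟨c, hc⟩ := Q.exists_sq_mem_J i (e (Q.gen i))
  have hF : ∀ {k : ℕ} {m : Q.P i}, m ∈ Q.F (fun _ : Unit => Q.gen i) k ↔ (m : R) ∈ Q.J k := by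
    intro k m
    constructor
    · rintro ⟨x, hx, rfl⟩
      rw [Fintype.sum_unique]
      exact Q.J_mul_right (hx ()) (Q.v i)
    · intro h
      exact ⟨fun _ => m, fun _ => h, by simpa using Q.eq_smul_gen m⟩
  refine Q.idempotent_trivial (fun _ : Unit => Q.gen i) (fun m => hF.mpr (Q.mem_J_zero _))
    (fun m hm => Subtype.ext (Q.eq_zero_of_mem_J fun k => hF.mp (hm k))) e he c fun _ => ?_
  rw [hF]
  have hge : Q.v i * (e (Q.gen i) : R) * Q.v i = e (Q.gen i) := by
    have h1 : Q.v i • Q.gen i = Q.gen i := Subtype.ext (Q.idem i)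
    have h2 : Q.v i * (e (Q.gen i) : R) = e (Q.gen i) := by
      conv_rhs => rw [← h1, map_smul]
      rfl
    rw [h2]
    exact (e (Q.gen i)).2
  rw [hge] at hc
  have hex : ∀ x : Q.P i, (e x : R) = x * e (Q.gen i) := fun x => by
    conv_lhs => rw [Q.eq_smul_gen x, map_smul]
    rfl
  convert hc using 1
  have hg : (Q.v i : R) * e (Q.gen i) = e (Q.gen i) := by
    conv_lhs => rw [← hge, ← mul_assoc, ← mul_assoc, Q.idem]
    rw [hge]
  push_cast
  rw [hex]
  push_cast
  rw [mul_sub, mul_smul_comm]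
  congr 2
  rw [sub_mul]
  have : ((e (Q.gen i) : R)) * Q.v i = e (Q.gen i) := (e (Q.gen i)).2
  change _ = e (Q.gen i) * Q.v i - c • Q.v i * Q.v i
  rw [this, smul_mul_assoc, Q.idem]
  rfl

theorem hasIndecClassCount_two (Φ : R →ₐ[K] Module.End K K) (h1 : Φ (Q.v 1) = 0)
    (hv1 : Q.v 1 ≠ 0) : HasIndecClassCount R (ModuleCat.of R R) 2 := by
  have hv0' : Φ (Q.v 0) = 1 := by
    have := congrArg Φ Q.vsum
    rwa [map_add, h1, add_zero, map_one] at this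
  have hv0 : Q.v 0 ≠ 0 := by
    intro h
    rw [h, map_zero] at hv0'
    exact zero_ne_one hv0'
  have hc : IsCompl (Q.P 0) (Q.P 1) := by
    constructor
    · rw [Submodule.disjoint_def]
      intro x h0 h1
      rw [mem_P] at h0 h1
      rw [← h1, ← h0, mul_assoc, Q.v_zero_mul_one, mul_zero]
    · rw [codisjoint_iff, eq_top_iff]
      intro x _
      rw [← mul_one x, ← Q.vsum, mul_add]
      exact Submodule.add_mem_sup (Q.toP 0 x).2 (Q.toP 1 x).2
  obtain ⟨N, hN1, hN2, hN3⟩ := exists_decomposition_of_isCompl hc (Q.isIndecModule_P 0 hv0)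
    (Q.isIndecModule_P 1 hv1) ⟨fun E => by
      let g : Q.P 0 →ₗ[R] RepMod Φ :=
        (LinearMap.toSpanSingleton R (RepMod Φ) (1 : K)) ∘ₗ (Q.P 0).subtype
      have hg : g (Q.gen 0) = (1 : K) := by
        change Φ (Q.v 0) 1 = 1
        rw [hv0']; rfl
      have : g (E.symm (E (Q.gen 0))) = (0 : K) := by
        rw [Q.eq_smul_gen (E (Q.gen 0)), map_smul, map_smul]
        have : Q.gen 1 = Q.v 1 • Q.gen 1 := Subtype.ext (Q.idem 1).symm
        rw [this, map_smul, map_smul, RepMod.smul_def Φ (Q.v 1), h1]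
        exact map_zero (Φ _)
      rw [E.symm_apply_apply, hg] at this
      exact one_ne_zero (α := K) this⟩
  exact hasIndecClassCount_of_basic (M := ModuleCat.of R R) hN1 hN2 hN3

end GradedKit

theorem exists_factor_of_surjective {K A B Y : Type} [Field K] [AddCommGroup A] [Module K A]
    [AddCommGroup B] [Module K B] [AddCommGroup Y] [Module K Y] (S : A →ₗ[K] B)
    (hS : Function.Surjective S) (T : A →ₗ[K] Y) (h : ∀ a, S a = 0 → T a = 0) :
    ∃ φ : B →ₗ[K] Y, ∀ a, φ (S a) = T a := by
  obtain ⟨s, hs⟩ := LinearMap.exists_rightInverse_of_surjective S (LinearMap.range_eq_top.mpr hS)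
  refine ⟨T ∘ₗ s, fun a => ?_⟩
  have h1 : S (s (S a)) = S a := LinearMap.congr_fun hs (S a)
  have := h (s (S a) - a) (by rw [map_sub, h1, sub_self])
  rw [map_sub] at this
  exact sub_eq_zero.mp this

/-- The tower of dimension vectors of the preprojective modules of a generalized Kronecker
quiver, together with its multiplication maps. -/
structure Tower (K : Type) [Field K] (q : ℕ) where
  d : ℕ → ℕ
  d_zero : d 0 = 0
  d_one : d 1 = 1
  x : ∀ n, Fin q → (Fin (d n) → K) →ₗ[K] (Fin (d (n + 1)) → K)
  comm : ∀ n g, ∑ k, x (n + 1) k (x n k g) = 0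
  gen : ∀ n (c : Fin (d (n + 2)) → K), ∃ a : Fin q → Fin (d (n + 1)) → K, ∑ k, x (n + 1) k (a k) = c
  ker : ∀ n (a : Fin q → Fin (d (n + 1)) → K), ∑ k, x (n + 1) k (a k) = 0 →
    ∃ g, ∀ k, a k = x n k g

namespace Tower
variable {K : Type} [Field K] {q : ℕ}

theorem exists_next {m n : ℕ} (x : Fin q → (Fin m → K) →ₗ[K] (Fin n → K)) :
    ∃ (l : ℕ) (y : Fin q → (Fin n → K) →ₗ[K] (Fin l → K)),
      (∀ g, ∑ k, y k (x k g) = 0) ∧ (∀ c, ∃ a : Fin q → Fin n → K, ∑ k, y k (a k) = c) ∧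
      ∀ a : Fin q → Fin n → K, ∑ k, y k (a k) = 0 → ∃ g, ∀ k, a k = x k g := by
  let N := LinearMap.range (LinearMap.pi x)
  let b := Module.finBasis K ((Fin q → Fin n → K) ⧸ N)
  let E := b.equivFun
  let T : (Fin q → Fin n → K) →ₗ[K] _ := E.toLinearMap ∘ₗ N.mkQ
  have hT : ∀ a, ∑ k, T (Pi.single k (a k)) = T a := fun a => by
    rw [← map_sum, Finset.univ_sum_single]
  refine ⟨_, fun k => T ∘ₗ LinearMap.single K (fun _ => Fin n → K) k, ?_, ?_, ?_⟩
  · intro g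
    refine (hT fun k => x k g).trans ?_
    change E (N.mkQ _) = 0
    rw [LinearEquiv.map_eq_zero_iff, Submodule.mkQ_apply, Submodule.Quotient.mk_eq_zero]
    exact ⟨g, rfl⟩
  · intro c
    obtain ⟨a, ha⟩ := N.mkQ_surjective (E.symm c)
    refine ⟨a, (hT a).trans ?_⟩
    change E (N.mkQ a) = c
    rw [ha, LinearEquiv.apply_symm_apply]
  · intro a ha
    have : T a = 0 := (hT a).symm.trans ha
    change E (N.mkQ a) = 0 at this
    rw [LinearEquiv.map_eq_zero_iff, Submodule.mkQ_apply, Submodule.Quotient.mk_eq_zero] at this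
    obtain ⟨g, hg⟩ := this
    exact ⟨g, fun k => (congrFun hg k).symm⟩

theorem nonempty (K : Type) [Field K] (q : ℕ) : Nonempty (Tower K q) := by
  choose l y h1 h2 h3 using
    fun s : (Σ m n : ℕ, Fin q → (Fin m → K) →ₗ[K] (Fin n → K)) => exists_next s.2.2
  let st : ℕ → Σ m n : ℕ, Fin q → (Fin m → K) →ₗ[K] (Fin n → K) := fun n =>
    Nat.rec ⟨0, 1, 0⟩ (fun _ s => ⟨s.2.1, l s, y s⟩) n
  exact ⟨{ d := fun n => (st n).1
           d_zero := rfl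
           d_one := rfl
           x := fun n => (st n).2.2
           comm := fun n => h1 (st n)
           gen := fun n => h2 (st n)
           ker := fun n => h3 (st n) }⟩

variable (T : Tower K q)

/-- The `n`-th term of the tower. -/
abbrev C (n : ℕ) : Type := Fin (T.d n) → K

theorem eq_zero (g : T.C 0) : g = 0 := by
  have : IsEmpty (Fin (T.d 0)) := by rw [T.d_zero]; infer_instance
  exact Subsingleton.elim _ _

theorem x_injective (hq : 2 ≤ q) (n : ℕ) (k : Fin q) : Function.Injective (T.x n k) := by
  induction n generalizing k with
  | zero => exact fun a b _ => by rw [T.eq_zero a, T.eq_zero b]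
  | succ n ih =>
    rw [injective_iff_map_eq_zero]
    intro a ha
    obtain ⟨g, hg⟩ := T.ker n (Pi.single k a) (by
      rw [Finset.sum_eq_single k]
      · rwa [Pi.single_eq_same]
      · intro l _ hl
        rw [Pi.single_eq_of_ne hl, map_zero]
      · simp)
    obtain ⟨l, hl⟩ : ∃ l, l ≠ k := by
      have : Nontrivial (Fin q) := Fin.nontrivial_iff_two_le.mpr hq
      exact exists_ne k
    have h1 := hg l
    rw [Pi.single_eq_of_ne hl] at h1
    have h2 : g = 0 := ih l (by rw [← h1, map_zero])
    have h3 := hg k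
    rwa [Pi.single_eq_same, h2, map_zero] at h3

theorem d_add (hq : 2 ≤ q) (n : ℕ) : T.d (n + 2) + T.d n = q * T.d (n + 1) := by
  let S : (Fin q → T.C (n + 1)) →ₗ[K] T.C (n + 2) :=
    ∑ k, T.x (n + 1) k ∘ₗ LinearMap.proj k
  have hS : ∀ a, S a = ∑ k, T.x (n + 1) k (a k) := fun a => by simp [S]
  have h1 : LinearMap.range S = ⊤ := LinearMap.range_eq_top.mpr fun c => by
    obtain ⟨a, ha⟩ := T.gen n c
    exact ⟨a, by rw [hS, ha]⟩
  have h2 : LinearMap.ker S = LinearMap.range (LinearMap.pi (T.x n)) := by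
    ext a
    rw [LinearMap.mem_ker, hS]
    constructor
    · intro h
      obtain ⟨g, hg⟩ := T.ker n a h
      exact ⟨g, funext fun k => (hg k).symm⟩
    · rintro ⟨g, rfl⟩
      exact T.comm n g
  have h3 := LinearMap.finrank_range_add_finrank_ker S
  rw [h1, h2, finrank_top, LinearMap.finrank_range_of_inj] at h3
  · simpa [Module.finrank_pi_fintype] using h3
  · intro a b hab
    exact T.x_injective hq n ⟨0, by lia⟩ (congrFun hab ⟨0, by lia⟩)

theorem d_strictMono (hq : 2 ≤ q) : StrictMono T.d := by
  refine strictMono_nat_of_lt_succ fun n => ?_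
  induction n with
  | zero => rw [T.d_zero, T.d_one]; exact Nat.zero_lt_one
  | succ n ih =>
    have := T.d_add hq n
    have : 2 * T.d (n + 1) ≤ q * T.d (n + 1) := Nat.mul_le_mul_right _ hq
    change T.d (n + 1) < T.d (n + 2)
    lia

theorem exists_lift {n : ℕ} {Y : Type} [AddCommGroup Y] [Module K Y]
    (ψ : Fin q → T.C (n + 1) →ₗ[K] Y) (h : ∀ g, ∑ k, ψ k (T.x n k g) = 0) :
    ∃ φ : T.C (n + 2) →ₗ[K] Y, ∀ k a, φ (T.x (n + 1) k a) = ψ k a := by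
  obtain ⟨φ, hφ⟩ := exists_factor_of_surjective
    (∑ k, T.x (n + 1) k ∘ₗ LinearMap.proj k : (Fin q → T.C (n + 1)) →ₗ[K] T.C (n + 2))
    (fun c => by
      obtain ⟨a, ha⟩ := T.gen n c
      exact ⟨a, by simp [ha]⟩)
    (∑ k, ψ k ∘ₗ LinearMap.proj k) (fun a ha => by
      obtain ⟨g, hg⟩ := T.ker n a (by simpa using ha)
      simpa [hg] using h g)
  refine ⟨φ, fun k a => ?_⟩
  have := hφ (Pi.single k a)
  simpa [Pi.single_apply, apply_ite, Finset.sum_ite_eq'] using this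

theorem exists_extension (n m : ℕ) (hnm : n ≤ m + 1) (H : Fin q → T.C n →ₗ[K] T.C (m + 1)) :
    ∃ (φ : T.C (n + 1) →ₗ[K] T.C (m + 1)) (g : T.C n →ₗ[K] T.C m),
      ∀ k a, φ (T.x n k a) = H k a + T.x m k (g a) := by
  induction n generalizing m with
  | zero => exact ⟨0, 0, fun k a => by rw [T.eq_zero a]; simp⟩
  | succ n ih =>
    obtain ⟨g, hg⟩ : ∃ g : T.C (n + 1) →ₗ[K] T.C m,
        ∀ b, ∑ k, (H k (T.x n k b) + T.x m k (g (T.x n k b))) = 0 := by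
      rcases m with _ | m
      · obtain rfl : n = 0 := by lia
        exact ⟨0, fun b => by rw [T.eq_zero b]; simp⟩
      · obtain ⟨s, hs⟩ := LinearMap.exists_rightInverse_of_surjective
          (∑ k, T.x (m + 1) k ∘ₗ LinearMap.proj k : (Fin q → T.C (m + 1)) →ₗ[K] T.C (m + 2))
          (LinearMap.range_eq_top.mpr fun c => by
            obtain ⟨a, ha⟩ := T.gen m c
            exact ⟨a, by simp [ha]⟩)
        obtain ⟨φ, g, hφ⟩ := ih m (by lia) fun k =>
          LinearMap.proj k ∘ₗ s ∘ₗ (-∑ k, H k ∘ₗ T.x n k)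
        refine ⟨φ, fun b => ?_⟩
        have h1 := LinearMap.congr_fun hs ((-∑ k, H k ∘ₗ T.x n k) b)
        simp only [LinearMap.comp_apply, LinearMap.sum_apply, LinearMap.proj_apply,
          LinearMap.id_apply, LinearMap.neg_apply] at h1
        simp only [hφ, map_add, Finset.sum_add_distrib, T.comm, add_zero]
        simp only [LinearMap.comp_apply, LinearMap.sum_apply, LinearMap.proj_apply,
          LinearMap.neg_apply, h1, add_neg_cancel]
    obtain ⟨φ, hφ⟩ := T.exists_lift (n := n) (fun k => H k + T.x m k ∘ₗ g) hg
    exact ⟨φ, g, hφ⟩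

theorem exists_eq_smul (hq : 2 ≤ q) (n : ℕ) (φ : T.C (n + 1) →ₗ[K] T.C (n + 1))
    (h : ∀ a, ∑ k, T.x (n + 1) k (φ (T.x n k a)) = 0) : ∃ c : K, ∀ a, φ a = c • a := by
  induction n with
  | zero =>
    have : Unique (Fin (T.d (0 + 1))) := by rw [zero_add, T.d_one]; infer_instance
    refine ⟨φ (fun _ => 1) default, fun a => ?_⟩
    have : a = a default • (fun _ => 1) := by
      funext i
      simp [Unique.eq_default i]
    conv_lhs => rw [this, map_smul]
    funext i
    simp [Unique.eq_default i, mul_comm]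
  | succ n ih =>
    choose g hg using fun a => T.ker (n + 1) (fun k => φ (T.x (n + 1) k a)) (h a)
    let k₀ : Fin q := ⟨0, by lia⟩
    have hinj := T.x_injective hq (n + 1) k₀
    let G : T.C (n + 1) →ₗ[K] T.C (n + 1) :=
      { toFun := g
        map_add' := fun a b => hinj (by rw [map_add, ← hg, ← hg, ← hg, map_add, map_add])
        map_smul' := fun c a => hinj (by rw [map_smul, ← hg, ← hg, map_smul, map_smul]; rfl) }
    obtain ⟨c, hc⟩ := ih G fun b => by
      change ∑ k, T.x (n + 1) k (g (T.x n k b)) = 0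
      simp_rw [← hg, ← map_sum, T.comm, map_zero]
    refine ⟨c, fun a => ?_⟩
    obtain ⟨b, rfl⟩ := T.gen n a
    rw [map_sum, Finset.smul_sum]
    refine Finset.sum_congr rfl fun k _ => ?_
    rw [hg, show g (b k) = c • b k from hc (b k), map_smul]

end Tower

namespace GradedKit
variable {K R σ : Type} [Field K] [Ring R] [Algebra K R] [Fintype σ] (Q : GradedKit K R σ)

theorem exists_mul_v_zero (r : R) :
    ∃ (c : K) (y : σ → R), r * Q.v 0 = c • Q.v 0 + ∑ a, Q.ar a * y a := by
  obtain ⟨c, y, hr⟩ := Q.decomp r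
  refine ⟨c 0, fun a => y a * Q.v 0, ?_⟩
  conv_lhs => rw [hr]
  rw [add_mul, Fin.sum_univ_two, add_mul, smul_mul_assoc, smul_mul_assoc, Q.idem,
    Q.v_one_mul_zero, smul_zero, add_zero, Finset.sum_mul]
  simp_rw [mul_assoc]

end GradedKit

/-- A graded kit whose arrows of `μ` behave like a generalized Kronecker quiver. -/
structure KroneckerKit (K R σ : Type) [Field K] [Ring R] [Algebra K R] [Fintype σ] (q : ℕ)
    extends GradedKit K R σ where
  two_le : 2 ≤ q
  μ : Fin q → σ
  s_μ : ∀ k, s (μ k) = 0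
  t_μ : ∀ k, t (μ k) = 1
  wt_eq : ∀ a, wt a = 1
  corner : ∀ r, ∃ (c : Fin q → K) (y : Fin q → R),
    v 1 * r * v 0 = ∑ i, ar (μ i) * (c i • 1 + y i) ∧ ∀ i k, k ≠ i → ar (μ k) * y i = 0
  rep : ∀ (m n : ℕ) (x : Fin q → (Fin m → K) →ₗ[K] (Fin n → K)),
    ∃ Φ : R →ₐ[K] Module.End K ((Fin m → K) × (Fin n → K)),
      (∀ u, Φ (v 0) u = (u.1, 0)) ∧ (∀ u, Φ (v 1) u = (0, u.2)) ∧
      (∀ k u, Φ (ar (μ k)) u = (0, x k u.1)) ∧ ∀ a u, (Φ (ar a) u).1 = 0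
  aug : ∃ Φ : R →ₐ[K] Module.End K K, Φ (v 1) = 0

namespace KroneckerKit
variable {K R σ : Type} [Field K] [Ring R] [Algebra K R] [Fintype σ] {q : ℕ}
  (Q : KroneckerKit K R σ q) (T : Tower K q)

/-- The presentation of the `n`-th module. -/
@[reducible] def pres (n : ℕ) : Q.Pres where
  ι := Fin (T.d (n + 1))
  κ := Fin (T.d n)
  ρ j i := ∑ k, T.x n k (Pi.single j 1) i • Q.ar (Q.μ k)
  v_ρ j i := by
    rw [Finset.mul_sum]
    refine Finset.sum_congr rfl fun k _ => ?_
    rw [mul_smul_comm, ← Q.t_μ k, Q.tgt]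
  ρ_v j i := by
    rw [Finset.sum_mul]
    refine Finset.sum_congr rfl fun k _ => ?_
    rw [smul_mul_assoc, ← Q.s_μ k, Q.src]
  δ_ρ j i := by
    simp_rw [map_sum, map_smul, Q.δ_ar, Q.wt_eq, pow_one, Finset.sum_mul]
    simp_rw [← smul_mul_assoc, Polynomial.smul_C]

/-- The generators of the `n`-th module. -/
def w (n : ℕ) (i : Fin (T.d (n + 1))) : (Q.pres T n).M := (Q.pres T n).w i

/-- The linear combinations of the generators of the `n`-th module. -/
def comb (n : ℕ) : T.C (n + 1) →ₗ[K] (Q.pres T n).M :=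
  ∑ i, (LinearMap.toSpanSingleton K _ (Q.w T n i)) ∘ₗ LinearMap.proj i

theorem comb_apply {n : ℕ} (a : T.C (n + 1)) : Q.comb T n a = ∑ i, a i • Q.w T n i := by
  simp [comb]

theorem comb_single {n : ℕ} (i : Fin (T.d (n + 1))) :
    Q.comb T n (Pi.single i 1) = Q.w T n i := by
  rw [comb_apply, Finset.sum_eq_single i]
  · simp
  · intro b _ hb
    rw [Pi.single_eq_of_ne hb, zero_smul]
  · simp

theorem v_smul_w {n : ℕ} (i : Fin (T.d (n + 1))) : Q.v 0 • Q.w T n i = Q.w T n i :=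
  (Q.pres T n).v_smul_w i

theorem exists_eq_sum {n : ℕ} (m : (Q.pres T n).M) :
    ∃ x : Fin (T.d (n + 1)) → R, m = ∑ i, x i • Q.w T n i :=
  (Q.pres T n).exists_eq_sum m

theorem sum_ρ_smul {N : Type} [AddCommGroup N] [Module R N] [Module K N] [IsScalarTower K R N]
    (n : ℕ) (φ : T.C (n + 1) →ₗ[K] N) (j : Fin (T.d n)) :
    ∑ i, (Q.pres T n).ρ j i • φ (Pi.single i 1) =
      ∑ k, Q.ar (Q.μ k) • φ (T.x n k (Pi.single j 1)) := by
  change ∑ i, (∑ k, T.x n k (Pi.single j 1) i • Q.ar (Q.μ k)) • φ (Pi.single i 1) = _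
  simp_rw [Finset.sum_smul]
  rw [Finset.sum_comm]
  refine Finset.sum_congr rfl fun k _ => ?_
  conv_rhs => rw [LinearMap.pi_apply_eq_sum_univ φ, Finset.smul_sum]
  refine Finset.sum_congr rfl fun i _ => ?_
  have : (fun j' => if i = j' then (1 : K) else 0) = (Pi.single i 1 : Fin (T.d (n + 1)) → K) := by
    funext j'
    simp [Pi.single_apply, eq_comm]
  rw [this, smul_assoc, smul_comm]

theorem comb_rel (n : ℕ) (g : T.C n) :
    ∑ k, Q.ar (Q.μ k) • Q.comb T n (T.x n k g) = 0 := by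
  let L : T.C n →ₗ[K] (Q.pres T n).M :=
    ∑ k, (Module.toModuleEnd K (S := R) (Q.pres T n).M (Q.ar (Q.μ k))) ∘ₗ
      Q.comb T n ∘ₗ T.x n k
  have hL : ∀ g, L g = ∑ k, Q.ar (Q.μ k) • Q.comb T n (T.x n k g) := fun g => by
    simp only [L, LinearMap.sum_apply, LinearMap.comp_apply]
    rfl
  have : L = 0 := by
    refine LinearMap.pi_ext' fun j => LinearMap.ext_ring ?_
    change L (Pi.single j 1) = 0
    rw [hL, ← Q.sum_ρ_smul T n (Q.comb T n) j, ← (Q.pres T n).rel j]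
    exact Finset.sum_congr rfl fun i _ => congrArg _ (Q.comb_single T i)
  rw [← hL, this, LinearMap.zero_apply]

theorem exists_sub_comb_mem_F {n : ℕ} (m : (Q.pres T n).M) :
    ∃ a : T.C (n + 1), m - Q.comb T n a ∈ Q.F (Q.w T n) 1 := by
  obtain ⟨x, rfl⟩ := Q.exists_eq_sum T m
  choose c y hcy using fun i => Q.exists_mul_v_zero (x i)
  refine ⟨c, fun i => ∑ a, Q.ar a * y i a, fun i => ?_, ?_⟩
  · refine sum_mem fun a _ => Q.J_mul_right ?_ _
    rw [← Q.wt_eq a]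
    exact Q.ar_mem_J a
  · rw [comb_apply, ← Finset.sum_sub_distrib]
    refine Finset.sum_congr rfl fun i _ => ?_
    have h1 : x i • Q.w T n i = (x i * Q.v 0) • Q.w T n i := by
      rw [mul_smul, v_smul_w]
    rw [h1, hcy, add_smul, smul_assoc, v_smul_w, add_sub_cancel_left]

theorem rigid (n m : ℕ) (hnm : n ≤ m + 1) :
    (Q.pres T n).presentation.Rigid (Q.pres T m).M := by
  refine GradedKit.Pres.rigid _ fun (h : Fin (T.d n) → (Q.pres T m).M) hv => ?_
  let M := (Q.pres T m).M
  have hdec : ∀ j, ∃ (a : Fin q → T.C (m + 1)) (z : Fin q → M),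
      h j = ∑ k, Q.ar (Q.μ k) • (Q.comb T m (a k) + z k) ∧
      ∀ i k, k ≠ i → Q.ar (Q.μ k) • z i = 0 := by
    intro j
    obtain ⟨x, hx⟩ := Q.exists_eq_sum T (h j)
    choose c y hcy hy using fun i => Q.corner (x i)
    refine ⟨fun k i => c i k, fun k => ∑ i, y i k • Q.w T m i, ?_, ?_⟩
    · rw [← hv j, hx, Finset.smul_sum]
      have : ∀ i, Q.v 1 • x i • Q.w T m i =
          ∑ k, Q.ar (Q.μ k) • (c i k • Q.w T m i + y i k • Q.w T m i) := by
        intro i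
        conv_lhs => rw [← v_smul_w, ← mul_smul, ← mul_smul, hcy, Finset.sum_smul]
        simp_rw [mul_smul, add_smul, smul_assoc, one_smul]
      simp_rw [this]
      rw [Finset.sum_comm]
      refine Finset.sum_congr rfl fun k _ => ?_
      rw [← Finset.smul_sum, Finset.sum_add_distrib, comb_apply]
    · intro i k hk
      rw [Finset.smul_sum]
      exact Finset.sum_eq_zero fun l _ => by rw [← mul_smul, hy l i k hk, zero_smul]
  choose a z haz hz using hdec
  let B := Pi.basisFun K (Fin (T.d n))
  let H : Fin q → T.C n →ₗ[K] T.C (m + 1) := fun k => B.constr K fun j => a j k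
  have hH : ∀ k j, H k (Pi.single j 1) = a j k := fun k j => by
    have := B.constr_basis K (fun j => a j k) j
    rwa [Pi.basisFun_apply] at this
  let Z : Fin q → T.C n →ₗ[K] M := fun k => B.constr K fun j => z j k
  have hZ : ∀ k j, Z k (Pi.single j 1) = z j k := fun k j => by
    have := B.constr_basis K (fun j => z j k) j
    rwa [Pi.basisFun_apply] at this
  have hZ0 : ∀ i k, k ≠ i → ∀ u, Q.ar (Q.μ k) • Z i u = 0 := by
    intro i k hk u
    simp only [Z, Module.Basis.constr_apply_fintype, Finset.smul_sum]
    exact Finset.sum_eq_zero fun j _ => by rw [smul_comm, hz j i k hk, smul_zero]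
  obtain ⟨φ, g, hφ⟩ := T.exists_extension n m hnm H
  choose l hl using fun k => LinearMap.exists_leftInverse_of_injective (T.x n k)
    (LinearMap.ker_eq_bot.mpr (T.x_injective Q.two_le n k))
  let ψ : T.C (n + 1) →ₗ[K] M := Q.comb T m ∘ₗ φ + ∑ i, Z i ∘ₗ l i
  refine ⟨fun i : Fin (T.d (n + 1)) => ψ (Pi.single i 1), fun (j : Fin (T.d n)) => ?_⟩
  refine (Q.sum_ρ_smul T n ψ j).trans ?_
  rw [haz]
  have h1 : ∀ k, Q.ar (Q.μ k) • ψ (T.x n k (Pi.single j 1)) =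
      Q.ar (Q.μ k) • (Q.comb T m (a j k) + z j k) +
      Q.ar (Q.μ k) • Q.comb T m (T.x m k (g (Pi.single j 1))) := by
    intro k
    simp only [ψ, LinearMap.add_apply, LinearMap.comp_apply, LinearMap.sum_apply, hφ, hH, map_add,
      smul_add]
    rw [Finset.smul_sum, Finset.sum_eq_single k]
    · rw [show l k (T.x n k (Pi.single j 1)) = Pi.single j 1 from
        LinearMap.congr_fun (hl k) _, hZ]
      abel
    · intro i _ hi
      exact hZ0 i k hi.symm _
    · simp
  simp_rw [h1]
  rw [Finset.sum_add_distrib, Q.comb_rel, add_zero]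

theorem isIndecModule (n : ℕ) : IsIndecModule R (Q.pres T n).M := by
  obtain ⟨Ψ, hΨ⟩ := Q.aug
  have hd : 0 < T.d (n + 1) :=
    lt_of_le_of_lt (Nat.zero_le _) (T.d_strictMono Q.two_le n.lt_succ_self)
  have : Nonempty (Q.pres T n).ι := ⟨(⟨0, hd⟩ : Fin (T.d (n + 1)))⟩
  refine (Q.pres T n).isIndecModule Ψ hΨ fun e => ?_
  set M := (Q.pres T n).M
  let w : Fin (T.d (n + 1)) → M := Q.w T n
  obtain ⟨Φ, h0, h1, hμ, har⟩ := Q.rep _ _ (T.x (n + 1))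
  let N := RepMod Φ
  let emb : T.C (n + 1) →ₗ[K] N := LinearMap.inl K (T.C (n + 1)) (T.C (n + 2))
  let snd : N →ₗ[K] T.C (n + 2) := LinearMap.snd K (T.C (n + 1)) (T.C (n + 2))
  let fst : N →ₗ[K] T.C (n + 1) := LinearMap.fst K (T.C (n + 1)) (T.C (n + 2))
  obtain ⟨θ, hθ⟩ := (Q.pres T n).exists_lift
    (fun i : Fin (T.d (n + 1)) => emb (Pi.single i 1)) (fun i => h0 _) (fun j => by
      refine (Q.sum_ρ_smul T n emb j).trans ?_
      have : ∀ k, Q.ar (Q.μ k) • emb (T.x n k (Pi.single j 1)) =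
          ((0, T.x (n + 1) k (T.x n k (Pi.single j 1))) : T.C (n + 1) × T.C (n + 2)) :=
        fun k => hμ k _
      simp_rw [this]
      have h2 : ∑ k, LinearMap.inr K (T.C (n + 1)) (T.C (n + 2))
          (T.x (n + 1) k (T.x n k (Pi.single j 1))) = 0 := by
        rw [← map_sum, T.comm, map_zero]
      exact h2)
  have hθ' : ∀ i : Fin (T.d (n + 1)), θ (w i) = emb (Pi.single i 1) := hθ
  have hθK : ∀ (c : K) (x : M), θ (c • x) = c • θ x := fun c x => by
    rw [algebra_compatible_smul R, map_smul, ← algebra_compatible_smul R]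
  have hF : ∀ t ∈ Q.F w 1, fst (θ t) = 0 := by
    rintro _ ⟨x, hx, rfl⟩
    rw [map_sum, map_sum]
    refine Finset.sum_eq_zero fun i _ => ?_
    obtain ⟨c, y, hcy⟩ := Q.exists_mul_v_zero (x i)
    have hc : c • Q.v 0 = 0 := by
      have h3 := Q.J_mul_right (hx i) (Q.v 0) 0 Nat.zero_lt_one
      rw [hcy, map_add, Polynomial.coeff_add, map_smul, Q.δ_v, map_sum,
        Polynomial.finsetSum_coeff, Polynomial.coeff_smul, Polynomial.coeff_C_zero] at h3
      rwa [Finset.sum_eq_zero, add_zero] at h3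
      intro a _
      refine Q.J_mul_right (k := 1) ?_ _ 0 Nat.zero_lt_one
      rw [← Q.wt_eq a]
      exact Q.ar_mem_J a
    rw [hc, zero_add] at hcy
    have hw : x i • w i = ∑ a, Q.ar a • y a • w i := by
      conv_lhs => rw [show w i = Q.v 0 • w i from (Q.v_smul_w T i).symm,
        ← mul_smul, hcy, Finset.sum_smul]
      simp_rw [mul_smul]
    rw [hw, map_sum, map_sum]
    refine Finset.sum_eq_zero fun a _ => ?_
    rw [map_smul]
    exact har a _
  have hcomb : ∀ a : T.C (n + 1), fst (θ (Q.comb T n a)) = a := by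
    intro a
    rw [comb_apply]
    change fst (θ (∑ i : Fin (T.d (n + 1)), a i • w i)) = a
    simp_rw [map_sum, hθK, map_smul, hθ']
    change ∑ i, a i • (Pi.single i 1 : T.C (n + 1)) = a
    simp_rw [← Pi.single_smul, smul_eq_mul, mul_one]
    exact Finset.univ_sum_single a
  have heK : ∀ (c : K) (x : M), e (c • x) = c • e x := fun c x => by
    rw [algebra_compatible_smul R, map_smul, ← algebra_compatible_smul R]
  let φ : T.C (n + 1) →ₗ[K] T.C (n + 1) :=
    { toFun := fun a => fst (θ (e (Q.comb T n a)))
      map_add' := fun a b => by rw [map_add, map_add, map_add, map_add]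
      map_smul' := fun c a => by rw [map_smul, heK, hθK, map_smul]; rfl }
  have hφ : ∀ b, ∑ k, T.x (n + 1) k (φ (T.x n k b)) = 0 := by
    intro b
    have h3 := congrArg (fun z => snd (θ (e z))) (Q.comb_rel T n b)
    simp only [map_sum, map_zero] at h3
    rw [← h3]
    refine Finset.sum_congr rfl fun k _ => ?_
    rw [map_smul, map_smul]
    exact (congrArg Prod.snd (hμ k _)).symm
  obtain ⟨c, hc⟩ := T.exists_eq_smul Q.two_le n φ hφ
  have hfin : ∀ i, e (w i) - c • w i ∈ Q.F w 1 := by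
    intro i
    obtain ⟨a, ha⟩ := Q.exists_sub_comb_mem_F T (e (w i))
    have h4 := hF _ ha
    rw [map_sub, map_sub, hcomb, sub_eq_zero] at h4
    have h5 : a = c • (Pi.single i 1 : T.C (n + 1)) := by
      rw [← h4, ← hc]
      exact congrArg (fun z => fst (θ (e z))) (Q.comb_single T i).symm
    rw [h5, map_smul] at ha
    have h6 : Q.comb T n (Pi.single i 1 : T.C (n + 1)) = w i := Q.comb_single T i
    rwa [h6] at ha
  refine ⟨c, fun i => ?_⟩
  refine sub_mem ?_ ?_
  · exact Q.map_mem_F w (l := 0) e (fun i => (Q.pres T n).mem_F_zero _) (hfin i)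
  · exact Submodule.smul_mem _ _ (hfin i)

end KroneckerKit

theorem KroneckerKit.not_isTauTiltingFinite {K Λ σ : Type} [Field K] [Ring Λ] [Algebra K Λ]
    [Fintype σ] {q : ℕ} (Q : KroneckerKit K Λᵐᵒᵖ σ q) : ¬ IsTauTiltingFinite Λ := by
  obtain ⟨T⟩ := Tower.nonempty K q
  obtain ⟨Φ, hΦ⟩ := Q.aug
  have hv1 : Q.v 1 ≠ 0 := by
    intro h
    obtain ⟨Ψ, -, h1, -⟩ := Q.rep 0 1 0
    have := h1 (0, 1)
    rw [h, map_zero] at this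
    have := congrFun (congrArg Prod.snd this) 0
    exact zero_ne_one (α := K) this
  exact not_isTauTiltingFinite_of_family K Λ (Q.hasIndecClassCount_two Φ hΦ hv1)
    (fun n => (Q.pres T n).M) (Q.isIndecModule T) (fun n => (Q.pres T n).presentation)
    (Q.rigid T) (RepMod Φ) (fun n => T.d (n + 1))
    (fun a b h => T.d_strictMono Q.two_le (by lia))
    fun n => (Q.pres T n).nonempty_hom_equiv Φ hΦ

namespace Ladder

variable (K : Type) [Field K]

/-- The free `K[ε]`-module of rank `n`, realized by finitely supported sequences. -/
def E (n : ℕ) : Submodule K (ℕ → K × K) where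
  carrier := {f | ∀ i, n ≤ i → f i = 0}
  add_mem' ha hb i hi := by rw [Pi.add_apply, ha i hi, hb i hi, add_zero]
  zero_mem' _ _ := rfl
  smul_mem' c f hf i hi := by rw [Pi.smul_apply, hf i hi, smul_zero]

/-- The operator `(a, b) ↦ (0, a)` on sequences. -/
def eps₀ : (ℕ → K × K) →ₗ[K] (ℕ → K × K) where
  toFun f i := (0, (f i).1)
  map_add' f g := by ext i <;> simp
  map_smul' c f := by ext i <;> simp

/-- The reflection on sequences. -/
def up₀ : (ℕ → K × K) →ₗ[K] (ℕ → K × K) where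
  toFun f i := (if i = 0 then (f 0).1 else (f (i - 1)).2, (f (i + 1)).1)
  map_add' f g := by ext i <;> by_cases h : i = 0 <;> simp [h]
  map_smul' c f := by ext i <;> by_cases h : i = 0 <;> simp [h]

theorem eps₀_apply (f : ℕ → K × K) (i : ℕ) : eps₀ K f i = (0, (f i).1) := rfl

theorem up₀_zero (f : ℕ → K × K) : up₀ K f 0 = ((f 0).1, (f 1).1) := rfl

theorem up₀_succ (f : ℕ → K × K) (i : ℕ) : up₀ K f (i + 1) = ((f i).2, (f (i + 2)).1) := rfl

theorem up₀_up₀ (f : ℕ → K × K) : up₀ K (up₀ K f) = f := by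
  funext i
  rcases i with _ | i
  · simp [up₀_zero, up₀_succ]
  · rcases i with _ | i <;> simp [up₀_zero, up₀_succ]

variable {K}

theorem up₀_mem {n : ℕ} {f : ℕ → K × K} (hf : f ∈ E K n) : up₀ K f ∈ E K (n + 1) := by
  intro i hi
  obtain ⟨i, rfl⟩ : ∃ j, i = j + 1 := ⟨i - 1, by lia⟩
  rw [up₀_succ, hf i (by lia), hf (i + 2) (by lia)]
  rfl

/-- Multiplication by `ε`. -/
def eps (n : ℕ) : E K n →ₗ[K] E K n :=
  (eps₀ K).restrict fun f hf i hi => by rw [eps₀_apply, hf i hi]; rfl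

/-- The reflection map. -/
def up (n : ℕ) : E K n →ₗ[K] E K (n + 1) :=
  (up₀ K).restrict fun _ hf => up₀_mem hf

/-- The inclusion of the first components. -/
def s (n : ℕ) : E K n →ₗ[K] E K n where
  toFun f := ⟨fun i => ((f.1 i).1, 0), fun i hi => by simp [f.2 i hi]⟩
  map_add' f g := by ext i <;> simp
  map_smul' c f := by ext i <;> simp

/-- The second components, moved to the first components. -/
def t (n : ℕ) : E K n →ₗ[K] E K n where
  toFun f := ⟨fun i => ((f.1 i).2, 0), fun i hi => by simp [f.2 i hi]⟩
  map_add' f g := by ext i <;> simp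
  map_smul' c f := by ext i <;> simp

/-- The basis of `E n` over `K[ε]`. -/
def basis {n : ℕ} (i : Fin n) : E K n :=
  ⟨Pi.single (i : ℕ) (1, 0), fun j hj => by rw [Pi.single_eq_of_ne (by lia)]⟩

theorem coe_eps {n : ℕ} (f : E K n) : (eps n f : ℕ → K × K) = eps₀ K f := rfl

theorem coe_up {n : ℕ} (f : E K n) : (up n f : ℕ → K × K) = up₀ K f := rfl

theorem eps_eps {n : ℕ} (f : E K n) : eps n (eps n f) = 0 := by
  ext i <;> simp [coe_eps, eps₀_apply]

theorem coe_up_up {n : ℕ} (f : E K n) : (up (n + 1) (up n f) : ℕ → K × K) = f := by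
  rw [coe_up, coe_up, up₀_up₀]

theorem eps_up_up {n : ℕ} (f : E K n) :
    eps (n + 2) (up (n + 1) (up n f)) = up (n + 1) (up n (eps n f)) := by
  apply Subtype.ext
  rw [coe_eps, coe_up_up, coe_up_up, coe_eps]

theorem up_injective (n : ℕ) : Function.Injective (up (K := K) n) := by
  intro f g h
  apply Subtype.ext
  rw [← coe_up_up f, ← coe_up_up g, h]

theorem eq_zero (f : E K 0) : f = 0 := Subtype.ext (funext fun i => f.2 i (Nat.zero_le i))

theorem s_add_eps_t {n : ℕ} (f : E K n) : s n f + eps n (t n f) = f := by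
  ext i <;> simp [coe_eps, eps₀_apply, s, t]

theorem s_eps {n : ℕ} (f : E K n) : s n (eps n f) = 0 := by
  ext i <;> simp [coe_eps, eps₀_apply, s]

theorem t_eps {n : ℕ} (f : E K n) : t n (eps n f) = s n f := by
  ext i <;> simp [coe_eps, eps₀_apply, s, t]

theorem exists_eq_up_add {n : ℕ} (f : E K (n + 2)) :
    ∃ a b : E K (n + 1), up (n + 1) a + eps (n + 2) (up (n + 1) b) = f := by
  let d : ℕ → K × K := Pi.single n ((f.1 n).2, 0) + Pi.single (n + 1) ((f.1 (n + 1)).2, 0)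
  have hd : ∀ i, (d i).2 = 0 := fun i => by
    by_cases h : i = n <;> by_cases h' : i = n + 1 <;> simp [d, h, h']
  have hb : up₀ K d ∈ E K (n + 1) := by
    intro i hi
    obtain ⟨i, rfl⟩ : ∃ j, i = j + 1 := ⟨i - 1, by lia⟩
    rw [up₀_succ, hd]
    simp [d, show i + 2 ≠ n by lia, show i + 1 ≠ n by lia]
  have ha : up₀ K (f - eps₀ K d) ∈ E K (n + 1) := by
    intro i hi
    obtain ⟨i, rfl⟩ : ∃ j, i = j + 1 := ⟨i - 1, by lia⟩
    rw [up₀_succ]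
    simp only [Pi.sub_apply, eps₀_apply, f.2 (i + 2) (by lia)]
    rcases (by lia : i = n ∨ i = n + 1 ∨ n + 2 ≤ i) with rfl | rfl | h
    · simp [d]
    · simp [d]
    · simp [f.2 i h, d, show i ≠ n by lia, show i ≠ n + 1 by lia, Pi.single_apply]
  refine ⟨⟨_, ha⟩, ⟨_, hb⟩, Subtype.ext ?_⟩
  rw [Submodule.coe_add, coe_eps, coe_up, coe_up, up₀_up₀, up₀_up₀, sub_add_cancel]

theorem exists_of_up_add_eq_zero {n : ℕ} (a b : E K (n + 1))
    (h : up (n + 1) a + eps (n + 2) (up (n + 1) b) = 0) :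
    ∃ g : E K n, b = up n g ∧ a = -up n (eps n g) := by
  have h' : up₀ K a.1 = -eps₀ K (up₀ K b.1) := by
    have := congrArg Subtype.val h
    exact eq_neg_of_add_eq_zero_left this
  have hg : up₀ K b.1 ∈ E K n := by
    intro i hi
    ext
    · have := congrArg Prod.snd (congrFun h' i)
      simp only [Pi.neg_apply, eps₀_apply, Prod.snd_neg] at this
      have h2 : (up₀ K a.1 i).2 = (a.1 (i + 1)).1 := rfl
      rw [h2, a.2 (i + 1) (by lia)] at this
      simpa using this.symm
    · have h2 : (up₀ K b.1 i).2 = (b.1 (i + 1)).1 := rfl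
      rw [h2, b.2 (i + 1) (by lia)]
      rfl
  refine ⟨⟨_, hg⟩, Subtype.ext ?_, Subtype.ext ?_⟩
  · rw [coe_up, up₀_up₀]
  · rw [Submodule.coe_neg, coe_up, coe_eps, ← map_neg, ← h', up₀_up₀]

theorem eq_sum_basis {n : ℕ} (f : E K n) :
    f = ∑ i : Fin n, ((f.1 i).1 • basis i + (f.1 i).2 • eps n (basis i)) := by
  apply Subtype.ext
  funext j
  simp only [Submodule.coe_sum, Finset.sum_apply, Submodule.coe_add, Submodule.coe_smul,
    Pi.add_apply, Pi.smul_apply, coe_eps, eps₀_apply, basis]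
  by_cases hj : j < n
  · rw [Finset.sum_eq_single ⟨j, hj⟩]
    · ext <;> simp
    · intro i _ hi
      have : j ≠ (i : ℕ) := fun h => hi (Fin.ext h.symm)
      simp [Pi.single_eq_of_ne this]
    · simp
  · rw [f.2 j (by lia), Finset.sum_eq_zero]
    intro i _
    have : j ≠ (i : ℕ) := by lia
    simp [Pi.single_eq_of_ne this]

theorem exists_lift {n : ℕ} {Y : Type} [AddCommGroup Y] [Module K Y] (A : Y →ₗ[K] Y)
    (hA : ∀ y, A (A y) = 0) (ψ : E K (n + 1) →ₗ[K] Y)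
    (hψ : ∀ g, ψ (up n (eps n g)) = A (ψ (up n g))) :
    ∃ φ : E K (n + 2) →ₗ[K] Y, (∀ a, φ (eps _ a) = A (φ a)) ∧ ∀ a, φ (up _ a) = ψ a := by
  let S : (E K (n + 1) × E K (n + 1)) →ₗ[K] E K (n + 2) :=
    (up (n + 1)).coprod (eps (n + 2) ∘ₗ up (n + 1))
  have hS : Function.Surjective S := fun f => by
    obtain ⟨a, b, h⟩ := exists_eq_up_add f
    exact ⟨(a, b), h⟩
  obtain ⟨φ, hφ⟩ := exists_factor_of_surjective S hS (ψ.coprod (A ∘ₗ ψ)) (by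
    rintro ⟨a, b⟩ hab
    obtain ⟨g, rfl, rfl⟩ := exists_of_up_add_eq_zero a b hab
    change ψ (-up n (eps n g)) + A (ψ (up n g)) = 0
    rw [map_neg, hψ, neg_add_cancel])
  have hφ' : ∀ a b, φ (up (n + 1) a + eps (n + 2) (up (n + 1) b)) = ψ a + A (ψ b) :=
    fun a b => hφ (a, b)
  refine ⟨φ, fun f => ?_, fun a => ?_⟩
  · obtain ⟨a, b, rfl⟩ := exists_eq_up_add f
    rw [hφ', map_add A, hA, map_add, eps_eps, add_zero, add_zero]
    simpa using hφ' 0 a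
  · simpa using hφ' a 0

theorem exists_section (n : ℕ) : ∃ σ₁ σ₂ : E K (n + 2) →ₗ[K] E K (n + 1),
    ∀ f, up (n + 1) (σ₁ f) + eps (n + 2) (up (n + 1) (σ₂ f)) = f := by
  let S : (E K (n + 1) × E K (n + 1)) →ₗ[K] E K (n + 2) :=
    (up (n + 1)).coprod (eps (n + 2) ∘ₗ up (n + 1))
  have hS : Function.Surjective S := fun f => by
    obtain ⟨a, b, h⟩ := exists_eq_up_add f
    exact ⟨(a, b), h⟩
  obtain ⟨r, hr⟩ := LinearMap.exists_rightInverse_of_surjective S (LinearMap.range_eq_top.mpr hS)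
  exact ⟨LinearMap.fst K _ _ ∘ₗ r, LinearMap.snd K _ _ ∘ₗ r, fun f => LinearMap.congr_fun hr f⟩

theorem exists_extension : ∀ (n m : ℕ), n ≤ m + 1 → ∀ h : E K n →ₗ[K] E K (m + 1),
    ∃ (φ : E K (n + 1) →ₗ[K] E K (m + 1)) (g : E K n →ₗ[K] E K m),
      (∀ a, φ (eps _ a) = eps _ (φ a)) ∧ (∀ a, g (eps _ a) = eps _ (g a)) ∧
      ∀ a, φ (up n a) = h a + up m (g a)
  | 0, m, _, h => ⟨0, 0, by simp, by simp, fun a => by simp [eq_zero a]⟩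
  | 1, m, _, h => by
    obtain ⟨φ, h1, h2⟩ := exists_lift (eps (m + 1)) eps_eps h fun g => by simp [eq_zero g]
    exact ⟨φ, 0, h1, by simp, by simp [h2]⟩
  | n + 2, 0, hn, h => by lia
  | n + 2, m + 1, hn, h => by
    let H : E K (n + 1) →ₗ[K] E K (m + 2) :=
      h ∘ₗ up (n + 1) ∘ₗ eps (n + 1) - eps (m + 2) ∘ₗ h ∘ₗ up (n + 1)
    have hH : ∀ c, H c = h (up _ (eps _ c)) - eps _ (h (up _ c)) := fun c => rfl
    have hH' : ∀ c, H (eps _ c) = -eps _ (H c) := fun c => by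
      simp [hH, eps_eps]
    obtain ⟨σ₂, σ₁, hσ⟩ := exists_section (K := K) m
    have hσ' : ∀ f, eps _ f = eps (m + 2) (up (m + 1) (σ₂ f)) := fun f => by
      conv_lhs => rw [← hσ f, map_add, eps_eps, add_zero]
    let h' : E K (n + 1) →ₗ[K] E K (m + 1) := σ₁ ∘ₗ H ∘ₗ s (n + 1) - σ₂ ∘ₗ H ∘ₗ t (n + 1)
    have hh : ∀ c, h' c = σ₁ (H (s _ c)) - σ₂ (H (t _ c)) := fun c => rfl
    have hh' : ∀ c, eps _ (up _ (h' c)) - up _ (h' (eps _ c)) = H c := fun c => by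
      rw [hh, hh, s_eps, t_eps, map_sub, map_sub, ← hσ', map_zero, map_zero, zero_sub, map_neg]
      conv_rhs => rw [← s_add_eps_t c, map_add, hH', ← hσ (H (s _ c))]
      abel
    obtain ⟨g, g', h1, h2, h3⟩ := exists_extension (n + 1) m (by lia) h'
    obtain ⟨φ, h4, h5⟩ := exists_lift (eps (m + 2)) eps_eps (h + up (m + 1) ∘ₗ g) fun c => by
      have h6 := hh' c
      rw [hH] at h6
      have h7 : eps _ (up _ (up _ (g' c))) = up _ (up _ (g' (eps _ c))) := by
        rw [h2, eps_up_up]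
      simp only [LinearMap.add_apply, LinearMap.comp_apply, h3, map_add, h7]
      rw [← sub_eq_zero] at h6 ⊢
      rw [← neg_eq_zero, ← h6]
      abel
    exact ⟨φ, g, h4, h1, fun a => h5 a⟩

theorem exists_restrict {n : ℕ} (φ : E K (n + 1) →ₗ[K] E K (n + 1))
    (h2 : ∀ a, eps _ (up _ (φ (up n a))) = up _ (φ (up n (eps _ a)))) :
    ∃ g : E K n →ₗ[K] E K n, (∀ a, g (eps _ a) = eps _ (g a)) ∧ ∀ a, φ (up n a) = up n (g a) := by
  obtain ⟨l, hl⟩ := LinearMap.exists_leftInverse_of_injective (up (K := K) n)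
    (LinearMap.ker_eq_bot.mpr (up_injective n))
  have hl' : ∀ a, l (up n a) = a := LinearMap.congr_fun hl
  have key : ∀ a, ∃ g, φ (up n a) = up n g ∧ φ (up n (eps _ a)) = up n (eps n g) := fun a => by
    obtain ⟨g, hg, hg'⟩ := exists_of_up_add_eq_zero (-φ (up n (eps _ a))) (φ (up n a))
      (by rw [h2, map_neg, neg_add_cancel])
    exact ⟨g, hg, neg_inj.mp hg'⟩
  refine ⟨l ∘ₗ φ ∘ₗ up n, fun a => ?_, fun a => ?_⟩
  · obtain ⟨g, hg, hg'⟩ := key a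
    simp only [LinearMap.comp_apply, hg, hg', hl']
  · obtain ⟨g, hg, -⟩ := key a
    simp only [LinearMap.comp_apply, hg, hl']

theorem exists_sq_eq_zero : ∀ (n : ℕ) (φ : E K (n + 1) →ₗ[K] E K (n + 1)),
    (∀ a, φ (eps _ a) = eps _ (φ a)) →
    (∀ a, eps _ (up _ (φ (up n a))) = up _ (φ (up n (eps _ a)))) →
    ∃ c : K, ∀ a, φ (φ a - c • a) - c • (φ a - c • a) = 0
  | 0, φ, h1, _ => by
    let x := φ (basis 0)
    have hx : x = (x.1 0).1 • basis 0 + (x.1 0).2 • eps 1 (basis 0) := by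
      conv_lhs => rw [eq_sum_basis x]
      simp
    have h3 : ∀ a : E K 1, φ a - (x.1 0).1 • a = (x.1 0).2 • eps 1 a := fun a => by
      have ha : a = (a.1 0).1 • basis 0 + (a.1 0).2 • eps 1 (basis 0) := by
        conv_lhs => rw [eq_sum_basis a]
        simp
      rw [ha]
      simp only [map_add, map_smul, h1, eps_eps, smul_zero, add_zero]
      rw [show φ (basis 0) = x from rfl]
      conv_lhs => enter [1]; rw [hx]
      simp only [map_add, map_smul, eps_eps, smul_zero, add_zero]
      module
    exact ⟨_, fun a => by rw [h3, h3, map_smul, eps_eps, smul_zero, smul_zero]⟩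
  | n + 1, φ, h1, h2 => by
    obtain ⟨g, h3, h4⟩ := exists_restrict φ h2
    obtain ⟨c, hc⟩ := exists_sq_eq_zero n g h3 fun a => by
      rw [← h4, ← h4, ← eps_up_up, h1]
    have h5 : ∀ a b, φ (up _ a + eps _ (up _ b)) = up _ (g a) + eps _ (up _ (g b)) :=
      fun a b => by rw [map_add, h1, h4, h4]
    have h6 : ∀ a b, φ (up _ a + eps _ (up _ b)) - c • (up _ a + eps _ (up _ b)) =
        up _ (g a - c • a) + eps _ (up _ (g b - c • b)) := fun a b => by
      rw [h5]
      simp only [map_sub, map_smul]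
      module
    refine ⟨c, fun f => ?_⟩
    obtain ⟨a, b, rfl⟩ := exists_eq_up_add f
    rw [h6, h6, hc, hc]
    simp

end Ladder

namespace Ladder
variable {K : Type} [Field K]

theorem exists_map {n : ℕ} {N : Type} [AddCommGroup N] [Module K N] (y z : Fin n → N) :
    ∃ h : E K n →ₗ[K] N, (∀ j, h (basis j) = y j) ∧ ∀ j, h (eps n (basis j)) = z j := by
  let h : E K n →ₗ[K] N :=
    { toFun := fun f => ∑ i : Fin n, ((f.1 i).1 • y i + (f.1 i).2 • z i)
      map_add' := fun f g => by
        simp only [Submodule.coe_add, Pi.add_apply, Prod.fst_add, Prod.snd_add, add_smul]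
        rw [← Finset.sum_add_distrib]
        exact Finset.sum_congr rfl fun i _ => by abel
      map_smul' := fun c f => by
        simp [Finset.smul_sum, mul_smul] }
  have hh : ∀ f, h f = ∑ i : Fin n, ((f.1 i).1 • y i + (f.1 i).2 • z i) := fun f => rfl
  have hb : ∀ i j : Fin n, i ≠ j → (basis (K := K) j).1 (i : ℕ) = 0 := fun i j hij =>
    Pi.single_eq_of_ne (fun h => hij (Fin.ext h)) _
  have hb' : ∀ j : Fin n, (basis (K := K) j).1 (j : ℕ) = (1, 0) := fun j => Pi.single_eq_same _ _
  refine ⟨h, fun j => ?_, fun j => ?_⟩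
  · rw [hh, Finset.sum_eq_single j]
    · simp [hb']
    · intro i _ hij
      simp [hb i j hij]
    · simp
  · rw [hh, Finset.sum_eq_single j]
    · simp [coe_eps, eps₀_apply, hb']
    · intro i _ hij
      simp [coe_eps, eps₀_apply, hb i j hij]
    · simp

theorem hom_ext {n : ℕ} {N : Type} [AddCommGroup N] [Module K N] {f g : E K n →ₗ[K] N}
    (h : ∀ j, f (basis j) = g (basis j)) (h' : ∀ j, f (eps n (basis j)) = g (eps n (basis j))) :
    f = g := by
  apply LinearMap.ext
  intro a
  rw [eq_sum_basis a]
  simp only [map_sum, map_add, map_smul, h, h']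

end Ladder

open Ladder

/-- A graded kit for a quiver with an arrow `μ : 0 → 1` between vertices carrying loops `α` and
`β` of square zero. -/
structure LoopKit (K R σ : Type) [Field K] [Ring R] [Algebra K R] [Fintype σ]
    extends GradedKit K R σ where
  α : σ
  β : σ
  μ : σ
  s_α : s α = 0
  s_β : s β = 1
  t_β : t β = 1
  s_μ : s μ = 0
  t_μ : t μ = 1
  wt_α : wt α = 0
  wt_β : wt β = 0
  wt_μ : wt μ = 1
  wt_cases : ∀ a, a = α ∨ a = β ∨ wt a = 1
  corner : ∀ r, ∃ (c : Fin 4 → K) (p q : R), ar μ * p = 0 ∧ ar μ * q = 0 ∧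
    v 1 * r * v 0 = ar μ * (c 0 • 1 + c 1 • ar α + ar α * p) +
      ar β * ar μ * (c 2 • 1 + c 3 • ar α + ar α * q)
  rep : ∀ (A B : Type) [AddCommGroup A] [Module K A] [AddCommGroup B] [Module K B]
    (x : A →ₗ[K] B) (a : A →ₗ[K] A) (b : B →ₗ[K] B), (∀ y, a (a y) = 0) → (∀ y, b (b y) = 0) →
    ∃ Φ : R →ₐ[K] Module.End K (A × B),
      (∀ u, Φ (v 0) u = (u.1, 0)) ∧ (∀ u, Φ (v 1) u = (0, u.2)) ∧
      (∀ u, Φ (ar α) u = (a u.1, 0)) ∧ (∀ u, Φ (ar β) u = (0, b u.2)) ∧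
      (∀ u, Φ (ar μ) u = (0, x u.1)) ∧ ∀ c, c ≠ α → ∀ u, (Φ (ar c) u).1 = 0
  aug : ∃ Φ : R →ₐ[K] Module.End K K, Φ (v 1) = 0

namespace LoopKit
variable {K R σ : Type} [Field K] [Ring R] [Algebra K R] [Fintype σ] (Q : LoopKit K R σ)

/-- The element `a + b α`. -/
def coef : K × K →ₗ[K] R where
  toFun p := p.1 • 1 + p.2 • Q.ar Q.α
  map_add' p q := by
    simp only [Prod.fst_add, Prod.snd_add, add_smul]
    abel
  map_smul' c p := by simp [mul_smul]

theorem coef_apply (p : K × K) : Q.coef p = p.1 • 1 + p.2 • Q.ar Q.α := rfl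

theorem v_β : Q.v 1 * Q.ar Q.β = Q.ar Q.β := by rw [← Q.t_β, Q.tgt]

theorem v_μ : Q.v 1 * Q.ar Q.μ = Q.ar Q.μ := by rw [← Q.t_μ, Q.tgt]

theorem μ_v : Q.ar Q.μ * Q.v 0 = Q.ar Q.μ := by rw [← Q.s_μ, Q.src]

theorem α_v : Q.ar Q.α * Q.v 0 = Q.ar Q.α := by rw [← Q.s_α, Q.src]

theorem β_v : Q.ar Q.β * Q.v 0 = 0 := by
  rw [← Q.src Q.β, Q.s_β, mul_assoc, Q.v_one_mul_zero, mul_zero]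

theorem α_sq : Q.ar Q.α * Q.ar Q.α = 0 := Q.wt_zero_mul _ _ Q.wt_α Q.wt_α

theorem β_sq : Q.ar Q.β * Q.ar Q.β = 0 := Q.wt_zero_mul _ _ Q.wt_β Q.wt_β

theorem α_smul_α_smul {N : Type} [AddCommGroup N] [Module R N] (x : N) :
    Q.ar Q.α • Q.ar Q.α • x = 0 := by rw [← mul_smul, α_sq, zero_smul]

theorem μ_coef_v (p : K × K) : Q.ar Q.μ * Q.coef p * Q.v 0 = Q.ar Q.μ * Q.coef p := by
  rw [coef_apply, mul_assoc, add_mul, smul_mul_assoc, smul_mul_assoc, α_v, one_mul, mul_add,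
    mul_add, mul_smul_comm, mul_smul_comm, mul_smul_comm, μ_v, mul_one]

theorem δ_coef (p : K × K) : Q.δ (Q.coef p) = Polynomial.C (Q.coef p) := by
  rw [coef_apply, map_add, map_smul, map_smul, map_one, Q.δ_ar, Q.wt_α, pow_zero, mul_one,
    map_add, ← Polynomial.smul_C, ← Polynomial.smul_C, Polynomial.C_1]

/-- The presentation of the `n`-th module. -/
@[reducible] def pres (n : ℕ) : Q.Pres where
  ι := Fin (n + 1)
  κ := Fin n
  ρ j i := Q.ar Q.β * (Q.ar Q.μ * Q.coef ((up n (basis j)).1 i)) -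
    Q.ar Q.μ * Q.coef ((up n (eps n (basis j))).1 i)
  v_ρ j i := by rw [mul_sub, ← mul_assoc (Q.v 1) (Q.ar Q.β), v_β, ← mul_assoc (Q.v 1) (Q.ar Q.μ), v_μ]
  ρ_v j i := by rw [sub_mul, mul_assoc, μ_coef_v, μ_coef_v]
  δ_ρ j i := by
    simp only [map_sub, map_mul, δ_coef, Q.δ_ar, Q.wt_β, Q.wt_μ, pow_zero, pow_one, mul_one]
    simp only [mul_assoc, Polynomial.X_mul_C, sub_mul]

/-- The generators of the `n`-th module. -/
def w (n : ℕ) (i : Fin (n + 1)) : (Q.pres n).M := (Q.pres n).w i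

/-- The combinations of the generators of the `n`-th module. -/
def comb (n : ℕ) : E K (n + 1) →ₗ[K] (Q.pres n).M where
  toFun f := ∑ i : Fin (n + 1), Q.coef (f.1 i) • Q.w n i
  map_add' f g := by
    simp only [Submodule.coe_add, Pi.add_apply, map_add, add_smul, Finset.sum_add_distrib]
  map_smul' c f := by
    simp only [Submodule.coe_smul, Pi.smul_apply, map_smul, smul_assoc, Finset.smul_sum,
      RingHom.id_apply]

theorem comb_apply {n : ℕ} (f : E K (n + 1)) :
    Q.comb n f = ∑ i : Fin (n + 1), Q.coef (f.1 i) • Q.w n i := rfl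

theorem comb_basis {n : ℕ} (i : Fin (n + 1)) : Q.comb n (basis i) = Q.w n i := by
  rw [comb_apply, Finset.sum_eq_single i]
  · rw [show (basis (K := K) i).1 (i : ℕ) = (1, 0) from Pi.single_eq_same _ _, coef_apply]
    simp
  · intro j _ hj
    rw [show (basis (K := K) i).1 (j : ℕ) = 0 from
      Pi.single_eq_of_ne (fun h => hj (Fin.ext h)) _, map_zero, zero_smul]
  · simp

theorem comb_eps {n : ℕ} (f : E K (n + 1)) : Q.comb n (eps _ f) = Q.ar Q.α • Q.comb n f := by
  rw [comb_apply, comb_apply, Finset.smul_sum]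
  refine Finset.sum_congr rfl fun i _ => ?_
  rw [← mul_smul, coe_eps, eps₀_apply, coef_apply, coef_apply, mul_add, mul_smul_comm,
    mul_smul_comm, α_sq]
  simp

theorem v_smul_w {n : ℕ} (i : Fin (n + 1)) : Q.v 0 • Q.w n i = Q.w n i :=
  (Q.pres n).v_smul_w i

theorem exists_eq_sum {n : ℕ} (m : (Q.pres n).M) :
    ∃ x : Fin (n + 1) → R, m = ∑ i, x i • Q.w n i := (Q.pres n).exists_eq_sum m

section
variable {N : Type} [AddCommGroup N] [Module R N] [Module K N] [IsScalarTower K R N]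

theorem sum_coef_smul {n : ℕ} (φ : E K n →ₗ[K] N) (hφ : ∀ a, φ (eps _ a) = Q.ar Q.α • φ a)
    (f : E K n) : ∑ i : Fin n, Q.coef (f.1 i) • φ (basis i) = φ f := by
  conv_rhs => rw [eq_sum_basis f, map_sum]
  refine Finset.sum_congr rfl fun i _ => ?_
  rw [map_add, map_smul, map_smul, hφ, coef_apply, add_smul, smul_assoc, smul_assoc, one_smul]

theorem sum_ρ_smul (n : ℕ) (φ : E K (n + 1) →ₗ[K] N)
    (hφ : ∀ a, φ (eps _ a) = Q.ar Q.α • φ a) (j : Fin n) :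
    ∑ i, (Q.pres n).ρ j i • φ (basis i) =
      Q.ar Q.β • Q.ar Q.μ • φ (up n (basis j)) - Q.ar Q.μ • φ (up n (eps n (basis j))) := by
  rw [← Q.sum_coef_smul φ hφ, ← Q.sum_coef_smul φ hφ]
  simp only [Finset.smul_sum]
  rw [← Finset.sum_sub_distrib]
  refine Finset.sum_congr rfl fun i _ => ?_
  rw [sub_smul, mul_smul, mul_smul, mul_smul]

theorem exists_higher : ∀ (n : ℕ) (ζ ζ' : Fin n → N), (∀ j, Q.ar Q.μ • ζ j = 0) →
    (∀ j, Q.ar Q.μ • ζ' j = 0) → ∃ φ : E K (n + 1) →ₗ[K] N,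
    (∀ a, φ (eps _ a) = Q.ar Q.α • φ a) ∧
    (∀ j, Q.ar Q.μ • φ (up n (basis j)) = Q.ar Q.μ • Q.ar Q.α • ζ j) ∧
    ∀ j, Q.ar Q.μ • φ (up n (eps n (basis j))) = Q.ar Q.μ • Q.ar Q.α • ζ' j
  | 0, _, _, _, _ => ⟨0, by simp, fun j => j.elim0, fun j => j.elim0⟩
  | n + 1, ζ, ζ', h, h' => by
    obtain ⟨H, hH, hH'⟩ := exists_map (K := K) ζ ζ'
    let A : N →ₗ[K] N := Module.toModuleEnd K (S := R) N (Q.ar Q.α)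
    let B : N →ₗ[K] N := Module.toModuleEnd K (S := R) N (Q.ar Q.μ)
    have hB : ∀ a, Q.ar Q.μ • H a = 0 := fun a => by
      have : B ∘ₗ H = 0 := hom_ext (fun j => by
        change Q.ar Q.μ • H (basis j) = 0
        rw [hH, h]) fun j => by
        change Q.ar Q.μ • H (eps _ (basis j)) = 0
        rw [hH', h']
      exact LinearMap.congr_fun this a
    obtain ⟨l, hl⟩ := LinearMap.exists_leftInverse_of_injective (up (K := K) n)
      (LinearMap.ker_eq_bot.mpr (up_injective n))
    have hl' : ∀ a, l (up n a) = a := LinearMap.congr_fun hl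
    obtain ⟨φ, h1, h2⟩ := Ladder.exists_lift A Q.α_smul_α_smul
      (A ∘ₗ H + H ∘ₗ up n ∘ₗ eps n ∘ₗ l) fun g => by
        change Q.ar Q.α • H _ + H (up n (eps n (l (up n (eps n g))))) =
          Q.ar Q.α • (Q.ar Q.α • H _ + H (up n (eps n (l (up n g)))))
        rw [hl', hl', eps_eps, map_zero, map_zero, add_zero, smul_add, Q.α_smul_α_smul, zero_add]
    have h3 : ∀ a, Q.ar Q.μ • φ (up (n + 1) a) = Q.ar Q.μ • Q.ar Q.α • H a := fun a => by
      rw [h2]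
      change Q.ar Q.μ • (Q.ar Q.α • H a + H (up n (eps n (l a)))) = _
      rw [smul_add, hB, add_zero]
    exact ⟨φ, h1, fun j => by rw [h3, hH], fun j => by rw [h3, hH']⟩

end

theorem comb_rel (n : ℕ) (a : E K n) :
    Q.ar Q.β • Q.ar Q.μ • Q.comb n (up n a) = Q.ar Q.μ • Q.comb n (up n (eps n a)) := by
  let A (r : R) : (Q.pres n).M →ₗ[K] (Q.pres n).M := Module.toModuleEnd K (S := R) _ r
  have hb : ∀ j, Q.ar Q.β • Q.ar Q.μ • Q.comb n (up n (basis j)) =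
      Q.ar Q.μ • Q.comb n (up n (eps n (basis j))) := fun j => by
    rw [← sub_eq_zero, ← Q.sum_ρ_smul n (Q.comb n) Q.comb_eps j, ← (Q.pres n).rel j]
    exact Finset.sum_congr rfl fun i _ => congrArg _ (Q.comb_basis i)
  have : A (Q.ar Q.β) ∘ₗ A (Q.ar Q.μ) ∘ₗ Q.comb n ∘ₗ up n =
      A (Q.ar Q.μ) ∘ₗ Q.comb n ∘ₗ up n ∘ₗ eps n := by
    refine hom_ext hb fun j => ?_
    change Q.ar Q.β • Q.ar Q.μ • Q.comb n (up n (eps n (basis j))) =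
      Q.ar Q.μ • Q.comb n (up n (eps n (eps n (basis j))))
    rw [← hb, ← mul_smul, β_sq, eps_eps, map_zero, map_zero, smul_zero, zero_smul]
  exact LinearMap.congr_fun this a

theorem rigid (n m : ℕ) (hnm : n ≤ m + 1) :
    (Q.pres n).presentation.Rigid (Q.pres m).M := by
  refine GradedKit.Pres.rigid _ fun (h : Fin n → (Q.pres m).M) hv => ?_
  have hdec : ∀ j, ∃ (a b : E K (m + 1)) (y z : (Q.pres m).M),
      Q.ar Q.μ • y = 0 ∧ Q.ar Q.μ • z = 0 ∧
      h j = Q.ar Q.μ • (Q.comb m a + Q.ar Q.α • y) +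
        Q.ar Q.β • Q.ar Q.μ • (Q.comb m b + Q.ar Q.α • z) := by
    intro j
    obtain ⟨x, hx⟩ := Q.exists_eq_sum (h j)
    choose c p q hp hq hc using fun i => Q.corner (x i)
    refine ⟨∑ i, (c i 0 • basis i + c i 1 • eps _ (basis i)),
      ∑ i, (c i 2 • basis i + c i 3 • eps _ (basis i)),
      ∑ i, p i • Q.w m i, ∑ i, q i • Q.w m i, ?_, ?_, ?_⟩
    · rw [Finset.smul_sum]
      exact Finset.sum_eq_zero fun i _ => by rw [← mul_smul, hp, zero_smul]
    · rw [Finset.smul_sum]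
      exact Finset.sum_eq_zero fun i _ => by rw [← mul_smul, hq, zero_smul]
    · rw [← hv j, hx]
      simp only [map_sum, map_add, map_smul, comb_basis, comb_eps, Finset.smul_sum,
        ← Finset.sum_add_distrib]
      refine Finset.sum_congr rfl fun i _ => ?_
      conv_lhs => rw [← v_smul_w, ← mul_smul, ← mul_smul, hc]
      simp only [add_smul, mul_smul, smul_assoc, one_smul, smul_add]
  choose a b y z hy hz hab using hdec
  obtain ⟨H, hH, hH'⟩ := exists_map (K := K) b (-a)
  obtain ⟨φ, g, h1, h2, h3⟩ := exists_extension n m hnm H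
  obtain ⟨ψ, h4, h5, h6⟩ : ∃ ψ : E K (n + 1) →ₗ[K] (Q.pres m).M,
      (∀ a, ψ (eps _ a) = Q.ar Q.α • ψ a) ∧
      (∀ j, Q.ar Q.μ • ψ (up n (basis j)) = Q.ar Q.μ • Q.ar Q.α • z j) ∧
      ∀ j, Q.ar Q.μ • ψ (up n (eps n (basis j))) = Q.ar Q.μ • Q.ar Q.α • (-y j) :=
    Q.exists_higher n z (fun j => -y j) hz fun j => by rw [smul_neg, hy, neg_zero]
  have h7 : ∀ a, (Q.comb m ∘ₗ φ + ψ) (eps _ a) = Q.ar Q.α • (Q.comb m ∘ₗ φ + ψ) a := fun a => by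
    simp only [LinearMap.add_apply, LinearMap.comp_apply, h1, comb_eps, h4, smul_add]
  refine ⟨fun i : Fin (n + 1) => (Q.comb m ∘ₗ φ + ψ) (basis i), fun (j : Fin n) => ?_⟩
  refine (Q.sum_ρ_smul n _ h7 j).trans ?_
  rw [hab]
  simp only [LinearMap.add_apply, LinearMap.comp_apply, smul_add, h5, h6, h3, map_add, hH, hH',
    Q.comb_rel, h2, Pi.neg_apply, map_neg, smul_neg]
  abel

theorem exists_sub_mem (S : Submodule K R) (h1 : ∀ a y, Q.wt a = 1 → Q.ar a * y ∈ S)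
    (h2 : ∀ a, ∀ y ∈ S, Q.ar a * y ∈ S) (r : R) :
    ∃ p : K × K, r * Q.v 0 - Q.coef p * Q.v 0 ∈ S := by
  have h3 : ∀ a y, Q.wt a = 0 → ∃ d : K, Q.ar a * (y * Q.v 0) - d • (Q.ar a * Q.v 0) ∈ S := by
    intro a y ha
    obtain ⟨d, z, hz⟩ := Q.exists_mul_v_zero y
    refine ⟨d, ?_⟩
    rw [hz, mul_add, mul_smul_comm, add_sub_cancel_left, Finset.mul_sum]
    refine sum_mem fun b _ => ?_
    by_cases hb : Q.wt b = 0
    · rw [← mul_assoc, Q.wt_zero_mul a b ha hb, zero_mul]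
      exact zero_mem _
    · refine h2 _ _ (h1 _ _ ?_)
      rcases Q.wt_cases b with rfl | rfl | h
      · exact absurd Q.wt_α hb
      · exact absurd Q.wt_β hb
      · exact h
  have h4 : ∀ a y, ∃ d : K, Q.ar a * (y * Q.v 0) - d • Q.ar Q.α ∈ S := by
    intro a y
    rcases Q.wt_cases a with rfl | rfl | h
    · obtain ⟨d, hd⟩ := h3 _ y Q.wt_α
      rw [α_v] at hd
      exact ⟨d, hd⟩
    · obtain ⟨d, hd⟩ := h3 _ y Q.wt_β
      rw [β_v, smul_zero] at hd
      exact ⟨0, by rwa [zero_smul]⟩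
    · exact ⟨0, by rw [zero_smul, sub_zero]; exact h1 _ _ h⟩
  obtain ⟨c, y, hy⟩ := Q.exists_mul_v_zero r
  choose d hd using fun a => h4 a (y a)
  refine ⟨(c, ∑ a, d a), ?_⟩
  have h5 : r * Q.v 0 = c • Q.v 0 + ∑ a, Q.ar a * (y a * Q.v 0) := by
    conv_lhs => rw [← Q.idem, ← mul_assoc, hy, add_mul, smul_mul_assoc, Q.idem, Finset.sum_mul]
    simp_rw [mul_assoc]
  rw [h5, coef_apply, add_mul, smul_mul_assoc, smul_mul_assoc, α_v, one_mul, add_sub_add_left_eq_sub,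
    Finset.sum_smul, ← Finset.sum_sub_distrib]
  exact sum_mem fun a _ => hd a

theorem exists_sub_comb_mem_F {n : ℕ} (m : (Q.pres n).M) :
    ∃ a : E K (n + 1), m - Q.comb n a ∈ Q.F (Q.w n) 1 := by
  obtain ⟨x, rfl⟩ := Q.exists_eq_sum m
  choose p hp using fun i => Q.exists_sub_mem (Q.J 1)
    (fun a y ha => Q.J_mul_right (ha ▸ Q.ar_mem_J a) y) (fun a y hy => Q.J_mul_left _ hy) (x i)
  refine ⟨∑ i, ((p i).1 • basis i + (p i).2 • eps _ (basis i)), _, hp, ?_⟩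
  rw [map_sum, ← Finset.sum_sub_distrib]
  refine Finset.sum_congr rfl fun i _ => ?_
  rw [map_add, map_smul, map_smul, comb_eps, comb_basis, sub_smul, mul_smul, mul_smul, v_smul_w,
    coef_apply, add_smul, smul_assoc, smul_assoc, one_smul]

theorem isIndecModule (n : ℕ) : IsIndecModule R (Q.pres n).M := by
  obtain ⟨Ψ, hΨ⟩ := Q.aug
  have : Nonempty (Q.pres n).ι := ⟨(0 : Fin (n + 1))⟩
  refine (Q.pres n).isIndecModule Ψ hΨ fun e => ?_
  set M := (Q.pres n).M
  let w : Fin (n + 1) → M := Q.w n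
  obtain ⟨Φ, h0, h1, hα, hβ, hμ, har⟩ := Q.rep (E K (n + 1)) (E K (n + 2)) (up (n + 1))
    (eps (n + 1)) (eps (n + 2)) eps_eps eps_eps
  let N := RepMod Φ
  let emb : E K (n + 1) →ₗ[K] N := LinearMap.inl K (E K (n + 1)) (E K (n + 2))
  let snd : N →ₗ[K] E K (n + 2) := LinearMap.snd K (E K (n + 1)) (E K (n + 2))
  let fst : N →ₗ[K] E K (n + 1) := LinearMap.fst K (E K (n + 1)) (E K (n + 2))
  have hemb : ∀ a, emb (eps _ a) = Q.ar Q.α • emb a := fun a => (hα (emb a)).symm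
  have hμβ : ∀ u : N, snd (Q.ar Q.β • Q.ar Q.μ • u) = eps _ (up _ (fst u)) := fun u => by
    have h2 : Q.ar Q.μ • u = (0, up (n + 1) (fst u)) := hμ u
    rw [h2]
    exact congrArg Prod.snd (hβ _)
  have hμs : ∀ u : N, snd (Q.ar Q.μ • u) = up _ (fst u) := fun u => congrArg Prod.snd (hμ u)
  have hfμ : ∀ u : N, fst (Q.ar Q.μ • u) = 0 := fun u => congrArg Prod.fst (hμ u)
  have hfβ : ∀ u : N, fst (Q.ar Q.β • u) = 0 := fun u => congrArg Prod.fst (hβ u)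
  have hfα : ∀ u : N, fst (Q.ar Q.α • u) = eps _ (fst u) := fun u => congrArg Prod.fst (hα u)
  obtain ⟨θ, hθ⟩ := (Q.pres n).exists_lift
    (fun i : Fin (n + 1) => emb (basis i)) (fun i => h0 _) (fun j => by
      refine (Q.sum_ρ_smul n emb hemb j).trans (Prod.ext ?_ ?_)
      · change fst (_ - _) = 0
        rw [map_sub, hfμ, hfβ, sub_zero]
      · change snd (_ - _) = 0
        rw [map_sub, hμβ, hμs]
        change eps _ (up _ (up n (basis j))) - up _ (up n (eps n (basis j))) = 0
        rw [eps_up_up, sub_self])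
  have hθ' : ∀ i : Fin (n + 1), θ (w i) = emb (basis i) := hθ
  have hθK : ∀ (c : K) (x : M), θ (c • x) = c • θ x := fun c x => by
    rw [algebra_compatible_smul R, map_smul, ← algebra_compatible_smul R]
  have heK : ∀ (c : K) (x : M), e (c • x) = c • e x := fun c x => by
    rw [algebra_compatible_smul R, map_smul, ← algebra_compatible_smul R]
  let S : Submodule K R :=
    { carrier := {r | ∀ u : N, fst (r • u) = 0}
      add_mem' := fun {a b} ha hb u => by rw [add_smul, map_add, ha, hb, add_zero]
      zero_mem' := fun u => by rw [zero_smul, map_zero]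
      smul_mem' := fun c r hr u => by rw [smul_assoc, map_smul, hr, smul_zero] }
  have hF : ∀ t ∈ Q.F w 1, fst (θ t) = 0 := by
    rintro _ ⟨x, hx, rfl⟩
    rw [map_sum, map_sum]
    refine Finset.sum_eq_zero fun i _ => ?_
    obtain ⟨p, hp⟩ := Q.exists_sub_mem (Q.J 1 ⊓ S)
      (fun a y ha => ⟨Q.J_mul_right (ha ▸ Q.ar_mem_J a) y, fun u => by
        rw [mul_smul]
        refine har a (fun h => ?_) _
        rw [h, Q.wt_α] at ha
        exact zero_ne_one ha⟩)
      (fun a y hy => ⟨Q.J_mul_left _ hy.1, fun u => by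
        rw [mul_smul]
        by_cases h : a = Q.α
        · rw [h, hfα, hy.2, map_zero]
        · exact har a h _⟩) (x i)
    have h2 : Q.coef p * Q.v 0 = 0 := by
      have h3 := sub_mem (Q.J_mul_right (hx i) (Q.v 0)) hp.1 0 Nat.zero_lt_one
      rwa [sub_sub_cancel, map_mul, δ_coef, Q.δ_v, ← Polynomial.C_mul, Polynomial.coeff_C_zero]
        at h3
    rw [h2, sub_zero] at hp
    have hw : x i • w i = (x i * Q.v 0) • w i := by
      rw [mul_smul]
      exact congrArg _ (Q.v_smul_w i).symm
    rw [hw, map_smul]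
    exact hp.2 _
  have hcomb : ∀ a : E K (n + 1), fst (θ (Q.comb n a)) = a := by
    intro a
    have h2 : θ (Q.comb n a) = emb a := by
      rw [comb_apply, ← Q.sum_coef_smul emb hemb a, map_sum]
      refine Finset.sum_congr rfl fun i _ => ?_
      rw [map_smul]
      exact congrArg _ (hθ' i)
    rw [h2]
    rfl
  let φ : E K (n + 1) →ₗ[K] E K (n + 1) :=
    { toFun := fun a => fst (θ (e (Q.comb n a)))
      map_add' := fun a b => by rw [map_add, map_add, map_add, map_add]
      map_smul' := fun c a => by rw [map_smul, heK, hθK, map_smul]; rfl }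
  have hφ₁ : ∀ a, φ (eps _ a) = eps _ (φ a) := fun a => by
    change fst (θ (e (Q.comb n (eps _ a)))) = eps _ (fst (θ (e (Q.comb n a))))
    rw [comb_eps, map_smul, map_smul, hfα]
  have hφ₂ : ∀ a, eps _ (up _ (φ (up n a))) = up _ (φ (up n (eps _ a))) := fun a => by
    have h3 := congrArg (fun z => snd (θ (e z))) (Q.comb_rel n a)
    simp only [map_smul] at h3
    rwa [hμβ, hμs] at h3
  obtain ⟨c, hc⟩ := exists_sq_eq_zero n φ hφ₁ hφ₂
  have heF : ∀ m : M, fst (θ (e m)) = φ (fst (θ m)) := by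
    intro m
    obtain ⟨a, ha⟩ := Q.exists_sub_comb_mem_F m
    have h4 := hF _ ha
    rw [map_sub, map_sub, hcomb, sub_eq_zero] at h4
    have h5 := hF _ (Q.map_mem_F w (l := 0) e (fun i => (Q.pres n).mem_F_zero _) ha)
    rw [map_sub, map_sub, map_sub, sub_eq_zero] at h5
    rw [h5, h4]
    rfl
  refine ⟨c, fun i => ?_⟩
  obtain ⟨a, ha⟩ := Q.exists_sub_comb_mem_F (e (e (w i) - c • w i) - c • (e (w i) - c • w i))
  have h6 := hF _ ha
  rw [map_sub, map_sub, hcomb, sub_eq_zero] at h6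
  have h7 : a = 0 := by
    rw [← h6, ← hc (fst (θ (w i)))]
    rw [map_sub, map_sub, heF, hθK, map_smul, map_sub, map_sub, heF, hθK, map_smul]
  rw [h7, map_zero, sub_zero] at ha
  exact ha

end LoopKit

theorem LoopKit.not_isTauTiltingFinite {K Λ σ : Type} [Field K] [Ring Λ] [Algebra K Λ]
    [Fintype σ] (Q : LoopKit K Λᵐᵒᵖ σ) : ¬ IsTauTiltingFinite Λ := by
  obtain ⟨Φ, hΦ⟩ := Q.aug
  have hv1 : Q.v 1 ≠ 0 := by
    intro h
    obtain ⟨Ψ, -, h1, -⟩ := Q.rep K K 0 0 0 (fun _ => rfl) fun _ => rfl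
    have := h1 (0, 1)
    rw [h, map_zero] at this
    exact zero_ne_one (α := K) (congrArg Prod.snd this)
  exact not_isTauTiltingFinite_of_family K Λ (Q.hasIndecClassCount_two Φ hΦ hv1)
    (fun n => (Q.pres n).M) Q.isIndecModule (fun n => (Q.pres n).presentation)
    Q.rigid (RepMod Φ) (fun n => n + 1) (fun a b h => Nat.succ_lt_succ h)
    fun n => (Q.pres n).nonempty_hom_equiv Φ hΦ

namespace Quiver

open MulOpposite

variable {K σ : Type} [Field K]

/-- The anti-homomorphism from the free algebra determined by the images of the generators. -/
def ev {B : Type} [Ring B] [Algebra K B] (V : Fin 2 → B) (A : σ → B) :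
    FreeAlgebra K (TPGen σ) →ₐ[K] Bᵐᵒᵖ :=
  FreeAlgebra.lift K fun g => match g with
    | .v i => op (V i)
    | .ar a => op (A a)

section ev
variable {B : Type} [Ring B] [Algebra K B] (V : Fin 2 → B) (A : σ → B)

theorem ev_vtx (i : Fin 2) : ev V A (vtx K i) = op (V i) := FreeAlgebra.lift_ι_apply _ _

theorem ev_arr (a : σ) : ev V A (arr K a) = op (A a) := FreeAlgebra.lift_ι_apply _ _

theorem ev_arr_mul_arr (a b : σ) : ev V A (arr K a * arr K b) = op (A b * A a) := by
  rw [map_mul, ev_arr, ev_arr, op_mul]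

end ev

variable {s t : σ → Fin 2} {rels : Set (FreeAlgebra K (TPGen σ) × FreeAlgebra K (TPGen σ))}

variable (K s t rels) in
/-- The opposite of a bound quiver algebra. -/
abbrev Opp : Type := (BoundQuiverAlgebra K σ s t rels)ᵐᵒᵖ

variable (K s t rels) in
/-- The quotient map of the free algebra. -/
def mk : FreeAlgebra K (TPGen σ) →ₐ[K] BoundQuiverAlgebra K σ s t rels :=
  RingQuot.mkAlgHom K (QuivRel K σ s t rels)

theorem mk_eq {x y : FreeAlgebra K (TPGen σ)} (h : QuivRel K σ s t rels x y) :
    mk K s t rels x = mk K s t rels y := RingQuot.mkAlgHom_rel K h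

variable (K s t rels) in
/-- The vertex idempotents. -/
def v (i : Fin 2) : Opp K s t rels := op (mk K s t rels (vtx K i))

variable (K s t rels) in
/-- The arrows. -/
def ar (a : σ) : Opp K s t rels := op (mk K s t rels (arr K a))

theorem idem (i : Fin 2) : v K s t rels i * v K s t rels i = v K s t rels i := by
  rw [v, ← op_mul, ← map_mul, mk_eq (.idem i)]

theorem orth (i j : Fin 2) (h : i ≠ j) : v K s t rels i * v K s t rels j = 0 := by
  rw [v, v, ← op_mul, ← map_mul, mk_eq (.orth j i h.symm), map_zero, op_zero]

theorem vsum : v K s t rels 0 + v K s t rels 1 = 1 := by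
  rw [v, v, ← op_add, ← map_add, mk_eq .vsum, map_one, op_one]

theorem src (a : σ) : ar K s t rels a * v K s t rels (s a) = ar K s t rels a := by
  rw [v, ar, ← op_mul, ← map_mul, mk_eq (.src a)]

theorem tgt (a : σ) : v K s t rels (t a) * ar K s t rels a = ar K s t rels a := by
  rw [v, ar, ← op_mul, ← map_mul, mk_eq (.tgt a)]

theorem ar_mul_v {a : σ} {i : Fin 2} (h : s a ≠ i) : ar K s t rels a * v K s t rels i = 0 := by
  rw [← src, mul_assoc, orth _ _ h, mul_zero]

theorem v_mul_ar {a : σ} {i : Fin 2} (h : t a ≠ i) : v K s t rels i * ar K s t rels a = 0 := by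
  rw [← tgt, ← mul_assoc, orth _ _ h.symm, zero_mul]

theorem ar_mul_ar_of_ne {a b : σ} (h : s a ≠ t b) : ar K s t rels a * ar K s t rels b = 0 := by
  rw [← tgt b, ← mul_assoc, ar_mul_v h, zero_mul]

theorem ar_mul_ar_of_mem {a b : σ} (h : (arr K b * arr K a, 0) ∈ rels) :
    ar K s t rels a * ar K s t rels b = 0 := by
  rw [ar, ar, ← op_mul, ← map_mul, mk_eq (.rel _ h), map_zero, op_zero]

theorem induction {P : Opp K s t rels → Prop} (hK : ∀ c : K, P (algebraMap K _ c))
    (hv : ∀ i, P (v K s t rels i)) (har : ∀ a, P (ar K s t rels a))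
    (hadd : ∀ x y, P x → P y → P (x + y)) (hmul : ∀ x y, P x → P y → P (x * y))
    (r : Opp K s t rels) : P r := by
  obtain ⟨x, hx⟩ := RingQuot.mkAlgHom_surjective K (QuivRel K σ s t rels) r.unop
  have key : ∀ x, P (op (mk K s t rels x)) := fun x => by
    induction x using FreeAlgebra.induction with
    | grade0 c =>
      rw [AlgHom.commutes]
      exact hK c
    | grade1 g =>
      cases g with
      | v i => exact hv i
      | ar a => exact har a
    | mul x y hx hy =>
      rw [map_mul, op_mul]
      exact hmul _ _ hy hx
    | add x y hx hy =>
      rw [map_add, op_add]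
      exact hadd _ _ hx hy
  rw [← op_unop r, ← hx]
  exact key x

theorem exists_algHom {B : Type} [Ring B] [Algebra K B] (V : Fin 2 → B) (A : σ → B)
    (hidem : ∀ i, V i * V i = V i) (horth : ∀ i j, i ≠ j → V i * V j = 0) (hsum : V 0 + V 1 = 1)
    (hsrc : ∀ a, A a * V (s a) = A a) (htgt : ∀ a, V (t a) * A a = A a)
    (hrel : ∀ p ∈ rels, ev V A p.1 = ev V A p.2) :
    ∃ Φ : Opp K s t rels →ₐ[K] B, (∀ i, Φ (v K s t rels i) = V i) ∧
      ∀ a, Φ (ar K s t rels a) = A a := by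
  have h : ∀ ⦃x y⦄, QuivRel K σ s t rels x y → ev V A x = ev V A y := by
    intro x y h
    cases h with
    | idem i => rw [map_mul, ev_vtx, ← op_mul, hidem]
    | orth i j hij => rw [map_mul, ev_vtx, ev_vtx, ← op_mul, horth _ _ hij.symm, op_zero, map_zero]
    | vsum => rw [map_add, ev_vtx, ev_vtx, ← op_add, hsum, op_one, map_one]
    | src a => rw [map_mul, ev_vtx, ev_arr, ← op_mul, hsrc]
    | tgt a => rw [map_mul, ev_vtx, ev_arr, ← op_mul, htgt]
    | rel p hp => exact hrel p hp
  let Ψ : BoundQuiverAlgebra K σ s t rels →ₐ[K] Bᵐᵒᵖ := RingQuot.liftAlgHom K ⟨ev V A, h⟩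
  have hΨ : ∀ x, Ψ (mk K s t rels x) = ev V A x := fun x =>
    RingQuot.liftAlgHom_mkAlgHom_apply K _ h x
  refine ⟨AlgHom.opComm Ψ, fun i => ?_, fun a => ?_⟩
  · change (Ψ (mk K s t rels (vtx K i))).unop = V i
    rw [hΨ, ev_vtx, unop_op]
  · change (Ψ (mk K s t rels (arr K a))).unop = A a
    rw [hΨ, ev_arr, unop_op]

theorem exists_decomp [Fintype σ] (r : Opp K s t rels) :
    ∃ (c : Fin 2 → K) (y : σ → Opp K s t rels),
      r = ∑ i, c i • v K s t rels i + ∑ a, ar K s t rels a * y a := by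
  classical
  let W : Submodule K (Opp K s t rels) :=
    { carrier := {r | ∃ (c : Fin 2 → K) (y : σ → Opp K s t rels),
        r = ∑ i, c i • v K s t rels i + ∑ a, ar K s t rels a * y a}
      add_mem' := by
        rintro _ _ ⟨c, y, rfl⟩ ⟨d, z, rfl⟩
        refine ⟨c + d, y + z, ?_⟩
        simp only [Pi.add_apply, add_smul, mul_add, Finset.sum_add_distrib]
        abel
      zero_mem' := ⟨0, 0, by simp⟩
      smul_mem' := by
        rintro k _ ⟨c, y, rfl⟩
        refine ⟨k • c, k • y, ?_⟩
        simp only [Pi.smul_apply, smul_eq_mul, mul_smul, mul_smul_comm, smul_add,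
          Finset.smul_sum] }
  have hv : ∀ i, v K s t rels i ∈ W := fun i => ⟨Pi.single i 1, 0, by simp [Pi.single_apply]⟩
  have ha : ∀ a y, ar K s t rels a * y ∈ W := fun a y =>
    ⟨0, Pi.single a y, by simp [Pi.single_apply]⟩
  have hW : ∀ r, ∀ w ∈ W, w * r ∈ W := by
    have hred : ∀ r, (∀ i, v K s t rels i * r ∈ W) → ∀ w ∈ W, w * r ∈ W := by
      rintro r hr _ ⟨c, y, rfl⟩
      rw [add_mul, Finset.sum_mul, Finset.sum_mul]
      refine add_mem (sum_mem fun i _ => ?_) (sum_mem fun a _ => ?_)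
      · rw [smul_mul_assoc]
        exact W.smul_mem _ (hr i)
      · rw [mul_assoc]
        exact ha _ _
    intro r
    induction r using induction with
    | hK c =>
      intro w hw
      rw [← Algebra.commutes, ← Algebra.smul_def]
      exact W.smul_mem _ hw
    | hv j =>
      refine hred _ fun i => ?_
      by_cases h : i = j
      · rw [h, idem]
        exact hv j
      · rw [orth _ _ h]
        exact zero_mem _
    | har b =>
      refine hred _ fun i => ?_
      by_cases h : t b = i
      · rw [← h, tgt, ← mul_one (ar K s t rels b)]
        exact ha _ _
      · rw [v_mul_ar h]
        exact zero_mem _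
    | hadd x y hx hy =>
      intro w hw
      rw [mul_add]
      exact add_mem (hx w hw) (hy w hw)
    | hmul x y hx hy =>
      intro w hw
      rw [← mul_assoc]
      exact hy _ (hx w hw)
  have h1 : (1 : Opp K s t rels) ∈ W := by
    rw [← vsum]
    exact add_mem (hv 0) (hv 1)
  have h2 := hW r 1 h1
  rwa [one_mul] at h2

open Polynomial in
variable (K s t rels) in
/-- The elements of the free algebra which are homogeneous of degree `d`, as seen by the coaction
on the quotient. -/
def homogeneous (wt : σ → ℕ) (d : ℕ) : Submodule K (FreeAlgebra K (TPGen σ)) where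
  carrier := {x | ev (fun i => C (v K s t rels i)) (fun a => C (ar K s t rels a) * X ^ wt a) x =
    op (C (op (mk K s t rels x)) * X ^ d)}
  add_mem' {x y} hx hy := by
    simp only [Set.mem_ofPred_eq] at *
    rw [map_add, hx, hy, map_add, op_add, C_add, add_mul, op_add]
  zero_mem' := by simp
  smul_mem' c x hx := by
    simp only [Set.mem_ofPred_eq] at *
    rw [map_smul, hx, map_smul, op_smul, ← smul_C, smul_mul_assoc, op_smul]

theorem arr_mul_arr_mem_homogeneous (wt : σ → ℕ) (a b : σ) :
    arr K a * arr K b ∈ homogeneous K s t rels wt (wt a + wt b) := by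
  change ev _ _ _ = op (Polynomial.C (op (mk K s t rels (arr K a * arr K b))) * _)
  rw [ev_arr_mul_arr, map_mul]
  refine congrArg op ?_
  change _ = Polynomial.C (ar K s t rels b * ar K s t rels a) * _
  rw [Polynomial.C_mul, add_comm, pow_add, mul_assoc, mul_assoc, ← mul_assoc (Polynomial.X ^ _),
    Polynomial.X_pow_mul_C, mul_assoc]

/-- A quiver algebra with homogeneous relations is graded. -/
theorem exists_coaction (wt : σ → ℕ)
    (hrel : ∀ p ∈ rels, ∃ d, p.1 ∈ homogeneous K s t rels wt d ∧
      p.2 ∈ homogeneous K s t rels wt d) :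
    ∃ δ : Opp K s t rels →ₐ[K] Polynomial (Opp K s t rels),
      (∀ i, δ (v K s t rels i) = Polynomial.C (v K s t rels i)) ∧
      (∀ a, δ (ar K s t rels a) = Polynomial.C (ar K s t rels a) * Polynomial.X ^ wt a) ∧
      ∀ r, (δ r).eval 1 = r := by
  obtain ⟨δ, hδ, hδ'⟩ := exists_algHom (rels := rels) (s := s) (t := t)
    (fun i => Polynomial.C (v K s t rels i))
    (fun a => Polynomial.C (ar K s t rels a) * Polynomial.X ^ wt a)
    (fun i => by rw [← Polynomial.C_mul, idem])
    (fun i j h => by rw [← Polynomial.C_mul, orth _ _ h, Polynomial.C_0])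
    (by rw [← Polynomial.C_add, vsum, Polynomial.C_1])
    (fun a => by
      rw [mul_assoc, Polynomial.X_pow_mul_C, ← mul_assoc, ← Polynomial.C_mul, src])
    (fun a => by rw [← mul_assoc, ← Polynomial.C_mul, tgt])
    (fun p hp => by
      obtain ⟨d, h1, h2⟩ := hrel p hp
      rw [h1, h2, mk_eq (.rel p hp)])
  refine ⟨δ, hδ, hδ', fun r => ?_⟩
  let ε : Polynomial (Opp K s t rels) →+* Opp K s t rels :=
    Polynomial.eval₂RingHom' (RingHom.id _) 1 fun _ => Commute.one_right _
  change ε (δ r) = r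
  have hC : ∀ x, ε (Polynomial.C x) = x := fun x => Polynomial.eval₂_C _ _
  have hX : ε Polynomial.X = 1 := Polynomial.eval₂_X _ _
  induction r using induction with
  | hK c =>
    rw [AlgHom.commutes, Polynomial.algebraMap_apply, hC]
  | hv i => rw [hδ, hC]
  | har a => rw [hδ', map_mul, hC, map_pow, hX, one_pow, mul_one]
  | hadd x y hx hy => rw [map_add, map_add, hx, hy]
  | hmul x y hx hy => rw [map_mul, map_mul, hx, hy]

theorem exists_aug (hrel : ∀ p ∈ rels, ev (B := Module.End K K) (Pi.single 0 1) (0 : σ → _) p.1 =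
      ev (Pi.single 0 1) 0 p.2) :
    ∃ Φ : Opp K s t rels →ₐ[K] Module.End K K, Φ (v K s t rels 1) = 0 := by
  obtain ⟨Φ, hΦ, -⟩ := exists_algHom (s := s) (t := t) (rels := rels) (B := Module.End K K)
    (Pi.single 0 1) 0 (fun i => by fin_cases i <;> simp)
    (fun i j h => by fin_cases i <;> fin_cases j <;> simp at h ⊢)
    (by simp) (fun a => by simp) (fun a => by simp) hrel
  exact ⟨Φ, by rw [hΦ]; simp⟩

end Quiver

namespace Quiver

open MulOpposite

variable {K σ : Type} [Field K] {s t : σ → Fin 2}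
  {rels : Set (FreeAlgebra K (TPGen σ) × FreeAlgebra K (TPGen σ))}

variable (K σ) in
/-- The linear combinations of paths of length two in the free algebra. -/
def quad : Submodule K (FreeAlgebra K (TPGen σ)) :=
  Submodule.span K (Set.range fun p : σ × σ => arr K p.1 * arr K p.2)

theorem arr_mul_arr_mem_quad (a b : σ) : arr K a * arr K b ∈ quad K σ :=
  Submodule.subset_span ⟨(a, b), rfl⟩

theorem quad_le_homogeneous :
    quad K σ ≤ homogeneous K s t rels (fun _ => 1) 2 := by
  rw [quad, Submodule.span_le]
  rintro _ ⟨⟨a, b⟩, rfl⟩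
  exact arr_mul_arr_mem_homogeneous _ a b

theorem ev_eq_zero_of_mem_quad {B : Type} [Ring B] [Algebra K B] {V : Fin 2 → B} {A : σ → B}
    (hA : ∀ a b, A a * A b = 0) {x : FreeAlgebra K (TPGen σ)} (hx : x ∈ quad K σ) :
    ev V A x = 0 := by
  have h : quad K σ ≤ LinearMap.ker (ev V A).toLinearMap := by
    rw [quad, Submodule.span_le]
    rintro _ ⟨⟨a, b⟩, rfl⟩
    change ev V A _ = 0
    rw [ev_arr_mul_arr, hA, op_zero]
  exact h hx

/-- Representations of a two-point quiver in which arrows act as prescribed. -/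
theorem exists_rep {A B : Type} [AddCommGroup A] [Module K A] [AddCommGroup B]
    [Module K B] (f : σ → Module.End K (A × B)) (hs : ∀ a u, s a = 0 → f a u = f a (u.1, 0))
    (hs' : ∀ a u, s a = 1 → f a u = f a (0, u.2)) (ht : ∀ a u, t a = 0 → (f a u).2 = 0)
    (ht' : ∀ a u, t a = 1 → (f a u).1 = 0)
    (hrel : ∀ p ∈ rels, ∀ V : Fin 2 → Module.End K (A × B), ev V f p.1 = ev V f p.2) :
    ∃ Φ : Opp K s t rels →ₐ[K] Module.End K (A × B),
      (∀ u, Φ (v K s t rels 0) u = (u.1, 0)) ∧ (∀ u, Φ (v K s t rels 1) u = (0, u.2)) ∧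
      ∀ a, Φ (ar K s t rels a) = f a := by
  let V : Fin 2 → Module.End K (A × B) :=
    ![LinearMap.inl K A B ∘ₗ LinearMap.fst K A B, LinearMap.inr K A B ∘ₗ LinearMap.snd K A B]
  have h01 : ∀ i : Fin 2, i = 0 ∨ i = 1 := by decide
  have h0 : ∀ u, V 0 u = (u.1, 0) := fun u => rfl
  have h1 : ∀ u, V 1 u = (0, u.2) := fun u => rfl
  obtain ⟨Φ, hv, ha⟩ := exists_algHom (s := s) (t := t) (rels := rels) V f
    (fun i => by
      rcases h01 i with rfl | rfl <;> refine LinearMap.ext fun u => ?_ <;>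
        simp only [Module.End.mul_apply, h0, h1])
    (fun i j h => by
      rcases h01 i with rfl | rfl <;> rcases h01 j with rfl | rfl <;>
        first
        | exact absurd rfl h
        | exact LinearMap.ext fun u => by
            simp only [Module.End.mul_apply, h0, h1, LinearMap.zero_apply, Prod.mk_zero_zero])
    (LinearMap.ext fun u => by simp [h0, h1])
    (fun a => by
      rcases h01 (s a) with h | h <;> rw [h] <;> refine LinearMap.ext fun u => ?_
      · rw [Module.End.mul_apply, h0, ← hs a u h]
      · rw [Module.End.mul_apply, h1, ← hs' a u h])
    (fun a => by
      rcases h01 (t a) with h | h <;> rw [h] <;> refine LinearMap.ext fun u => ?_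
      · rw [Module.End.mul_apply, h0, ← ht a u h]
      · rw [Module.End.mul_apply, h1, ← ht' a u h])
    (fun p hp => hrel p hp V)
  exact ⟨Φ, fun u => by rw [hv, h0], fun u => by rw [hv, h1], ha⟩

/-- A two-point quiver with quadratic relations which contains a generalized Kronecker quiver
with suitable commutation of its arrows with the radical gives a `τ`-tilting infinite algebra. -/
theorem not_isTauTiltingFinite_of_kronecker [Fintype σ] {q : ℕ} (two_le : 2 ≤ q) (μ : Fin q → σ)
    (hμ : Function.Injective μ) (s_μ : ∀ k, s (μ k) = 0) (t_μ : ∀ k, t (μ k) = 1)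
    (ht : ∀ a, t a = 1 → ∃ k, a = μ k) (hrel : ∀ p ∈ rels, p.1 ∈ quad K σ ∧ p.2 ∈ quad K σ)
    (hc : ∀ k b, ar K s t rels (μ k) * ar K s t rels b = 0 ∨
      (∀ k', k' ≠ k → ar K s t rels (μ k') * ar K s t rels b = 0) ∨
      (s b = 1 ∧ ∀ d, ar K s t rels b * ar K s t rels d = 0)) :
    ¬ IsTauTiltingFinite (BoundQuiverAlgebra K σ s t rels) := by
  classical
  have hcoact := exists_coaction (s := s) (t := t) (rels := rels) (fun _ => 1) fun p hp =>
    ⟨2, quad_le_homogeneous (hrel p hp).1, quad_le_homogeneous (hrel p hp).2⟩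
  let Q : GradedKit K (Opp K s t rels) σ :=
    { v := v K s t rels
      ar := ar K s t rels
      s := s
      t := t
      wt := fun _ => 1
      idem := idem
      orth := orth
      vsum := vsum
      src := src
      tgt := tgt
      δ := hcoact.choose
      δ_v := hcoact.choose_spec.1
      δ_ar := hcoact.choose_spec.2.1
      eval_δ := hcoact.choose_spec.2.2
      decomp := exists_decomp
      wt_zero_mul := fun _ _ h => absurd h one_ne_zero }
  have hQ : ∀ r, ∃ (c : K) (y : σ → Opp K s t rels), r * v K s t rels 0 =
      c • v K s t rels 0 + ∑ a, ar K s t rels a * (y a * v K s t rels 0) := fun r => by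
    obtain ⟨c, y, h⟩ := Q.exists_mul_v_zero r
    have h' : r * v K s t rels 0 = c • v K s t rels 0 + ∑ a, ar K s t rels a * y a := h
    refine ⟨c, y, ?_⟩
    rw [← idem, ← mul_assoc, h', add_mul, smul_mul_assoc, idem, Finset.sum_mul]
    simp_rw [mul_assoc]
  have hone : ∀ k b (z : Opp K s t rels), ∃ y,
      ar K s t rels (μ k) * (ar K s t rels b * (z * v K s t rels 0)) =
        ar K s t rels (μ k) * y ∧ ∀ k', k' ≠ k → ar K s t rels (μ k') * y = 0 := by
    intro k b z
    rcases hc k b with h | h | ⟨h, h'⟩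
    · exact ⟨0, by rw [← mul_assoc, h, zero_mul, mul_zero], fun _ _ => mul_zero _⟩
    · exact ⟨_, rfl, fun k' hk => by rw [← mul_assoc, h k' hk, zero_mul]⟩
    · refine ⟨0, ?_, fun _ _ => mul_zero _⟩
      obtain ⟨c, y, hz⟩ := hQ z
      rw [hz, mul_add, mul_smul_comm, ar_mul_v (by rw [h]; decide), smul_zero, zero_add,
        Finset.mul_sum]
      simp_rw [← mul_assoc _ (ar K s t rels _), h', zero_mul, Finset.sum_const_zero]
  have hcorner : ∀ r, ∃ (c : Fin q → K) (y : Fin q → Opp K s t rels),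
      v K s t rels 1 * r * v K s t rels 0 = ∑ i, ar K s t rels (μ i) * (c i • 1 + y i) ∧
        ∀ i k, k ≠ i → ar K s t rels (μ k) * y i = 0 := by
    intro r
    obtain ⟨c₀, y, hr⟩ := hQ r
    have hk : ∀ k, ∃ (c : K) (z : Opp K s t rels),
        ar K s t rels (μ k) * (y (μ k) * v K s t rels 0) =
          ar K s t rels (μ k) * (c • 1 + z) ∧ ∀ k', k' ≠ k → ar K s t rels (μ k') * z = 0 := by
      intro k
      obtain ⟨c, z, hz⟩ := hQ (y (μ k))
      choose w hw hw' using fun b => hone k b (z b)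
      refine ⟨c, ∑ b, w b, ?_, fun k' hk' => ?_⟩
      · rw [hz, mul_add, mul_add, Finset.mul_sum, Finset.mul_sum, mul_smul_comm, mul_smul_comm,
          mul_one, ← s_μ k, src, s_μ k]
        simp_rw [hw]
      · rw [Finset.mul_sum]
        exact Finset.sum_eq_zero fun b _ => hw' b k' hk'
    choose c z hz hz' using hk
    refine ⟨c, z, ?_, hz'⟩
    rw [mul_assoc, hr, mul_add, mul_smul_comm, orth _ _ (by decide), smul_zero, zero_add,
      Finset.mul_sum, ← Finset.sum_subset (Finset.subset_univ (Finset.univ.image μ)),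
      Finset.sum_image hμ.injOn]
    · refine Finset.sum_congr rfl fun k _ => ?_
      rw [← mul_assoc, ← t_μ k, tgt, hz]
    · intro a _ ha
      rw [← mul_assoc, v_mul_ar, zero_mul]
      intro h
      obtain ⟨k, rfl⟩ := ht a h
      exact ha (Finset.mem_image_of_mem μ (Finset.mem_univ k))
  have haug : ∃ Φ : Opp K s t rels →ₐ[K] Module.End K K, Φ (v K s t rels 1) = 0 :=
    exists_aug fun p hp => by
      rw [ev_eq_zero_of_mem_quad (fun _ _ => mul_zero _) (hrel p hp).1,
        ev_eq_zero_of_mem_quad (fun _ _ => mul_zero _) (hrel p hp).2]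
  refine KroneckerKit.not_isTauTiltingFinite (K := K) (σ := σ) (q := q)
    { Q with
      two_le := two_le
      μ := μ
      s_μ := s_μ
      t_μ := t_μ
      wt_eq := fun _ => rfl
      corner := hcorner
      rep := fun m n x => ?_
      aug := haug }
  let g : σ → (Fin m → K) →ₗ[K] (Fin n → K) := fun a => ∑ k, if μ k = a then x k else 0
  have hg : ∀ k, g (μ k) = x k := fun k => by simp [g, hμ.eq_iff]
  have hg' : ∀ a, (∀ k, a ≠ μ k) → g a = 0 := fun a h =>
    Finset.sum_eq_zero fun k _ => if_neg (h k).symm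
  have hst : ∀ a, s a ≠ 0 ∨ t a ≠ 1 → g a = 0 := fun a h => hg' a fun k hk => by
    subst hk
    rcases h with h | h
    · exact h (s_μ k)
    · exact h (t_μ k)
  let f : σ → Module.End K ((Fin m → K) × (Fin n → K)) := fun a =>
    LinearMap.inr K _ _ ∘ₗ g a ∘ₗ LinearMap.fst K _ _
  have hf : ∀ a u, f a u = (0, g a u.1) := fun a u => rfl
  obtain ⟨Φ, h0, h1, ha⟩ := exists_rep (s := s) (t := t) (rels := rels) f
    (fun a u _ => rfl)
    (fun a u h => by rw [hf, hf, hst a (.inl (by rw [h]; decide))]; rfl)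
    (fun a u h => by rw [hf, hst a (.inr (by rw [h]; decide))]; rfl)
    (fun a u _ => rfl)
    (fun p hp V => by
      have hff : ∀ a b, f a * f b = 0 := fun a b => LinearMap.ext fun u => by
        rw [Module.End.mul_apply, hf, hf]
        simp
      rw [ev_eq_zero_of_mem_quad hff (hrel p hp).1, ev_eq_zero_of_mem_quad hff (hrel p hp).2])
  refine ⟨Φ, h0, h1, fun k u => ?_, fun a u => ?_⟩
  · change Φ (ar K s t rels (μ k)) u = _
    rw [ha, hf, hg]
  · change (Φ (ar K s t rels a) u).1 = 0
    rw [ha, hf]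

end Quiver

namespace Quiver

open MulOpposite

variable {K σ : Type} [Field K] {s t : σ → Fin 2}
  {rels : Set (FreeAlgebra K (TPGen σ) × FreeAlgebra K (TPGen σ))}

/-- A two-point quiver with a loop of square zero at each vertex, an arrow `μ` between the vertices
and possibly arrows in the other direction which annihilate `μ` gives a `τ`-tilting infinite
algebra. -/
theorem not_isTauTiltingFinite_of_loops [Fintype σ] {α β μ : σ} (s_α : s α = 0) (t_α : t α = 0)
    (s_β : s β = 1) (t_β : t β = 1) (s_μ : s μ = 0) (t_μ : t μ = 1)
    (hall : ∀ a, a = α ∨ a = β ∨ a = μ ∨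
      (s a = 1 ∧ t a = 0 ∧ (arr K a * arr K μ, 0) ∈ rels))
    (hα : (arr K α * arr K α, 0) ∈ rels) (hβ : (arr K β * arr K β, 0) ∈ rels)
    (hrel : ∀ p ∈ rels, ∃ a b, p = (arr K a * arr K b, 0) ∧
      (a = α ∧ b = α ∨ a = β ∧ b = β ∨ s a = 1 ∧ t a = 0 ∨ s b = 1 ∧ t b = 0)) :
    ¬ IsTauTiltingFinite (BoundQuiverAlgebra K σ s t rels) := by
  classical
  have hαβ : α ≠ β := fun h => by rw [h, s_β] at s_α; exact one_ne_zero s_α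
  have hαμ : α ≠ μ := fun h => by rw [h, t_μ] at t_α; exact one_ne_zero t_α
  have hβμ : β ≠ μ := fun h => by rw [h, s_μ] at s_β; exact zero_ne_one s_β
  let wt : σ → ℕ := fun a => if a = α ∨ a = β then 0 else 1
  have wt0 : ∀ a, wt a = 0 → a = α ∨ a = β := fun a h => by
    by_contra h'
    rw [show wt a = 1 from if_neg h'] at h
    exact one_ne_zero h
  have αα : ar K s t rels α * ar K s t rels α = 0 := ar_mul_ar_of_mem hα
  have ββ : ar K s t rels β * ar K s t rels β = 0 := ar_mul_ar_of_mem hβ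
  have hcoact := exists_coaction (s := s) (t := t) (rels := rels) wt fun p hp => by
    obtain ⟨a, b, rfl, -⟩ := hrel p hp
    exact ⟨_, arr_mul_arr_mem_homogeneous wt a b, zero_mem _⟩
  let Q : GradedKit K (Opp K s t rels) σ :=
    { v := v K s t rels
      ar := ar K s t rels
      s := s
      t := t
      wt := wt
      idem := idem
      orth := orth
      vsum := vsum
      src := src
      tgt := tgt
      δ := hcoact.choose
      δ_v := hcoact.choose_spec.1
      δ_ar := hcoact.choose_spec.2.1
      eval_δ := hcoact.choose_spec.2.2
      decomp := exists_decomp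
      wt_zero_mul := fun a b ha hb => by
        rcases wt0 a ha with rfl | rfl <;> rcases wt0 b hb with rfl | rfl
        · exact αα
        · exact ar_mul_ar_of_ne (by rw [s_α, t_β]; decide)
        · exact ar_mul_ar_of_ne (by rw [s_β, t_α]; decide)
        · exact ββ }
  have hQ : ∀ r, ∃ (c : K) (y : σ → Opp K s t rels), r * v K s t rels 0 =
      c • v K s t rels 0 + ∑ a, ar K s t rels a * y a := fun r => Q.exists_mul_v_zero r
  have hμν : ∀ a, a ≠ α → ar K s t rels μ * ar K s t rels a = 0 := fun a ha => by
    rcases hall a with rfl | rfl | rfl | ⟨-, -, h⟩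
    · exact absurd rfl ha
    · exact ar_mul_ar_of_ne (by rw [s_μ, t_β]; decide)
    · exact ar_mul_ar_of_ne (by rw [s_μ, t_μ]; decide)
    · exact ar_mul_ar_of_mem h
  have hμy : ∀ y, ∃ (c c' : K) (p : Opp K s t rels), ar K s t rels μ * p = 0 ∧
      ar K s t rels μ * (y * v K s t rels 0) =
        ar K s t rels μ * (c • 1 + c' • ar K s t rels α + ar K s t rels α * p) := by
    intro y
    obtain ⟨c, z, hz⟩ := hQ y
    obtain ⟨c', w, hw⟩ := hQ (z α)
    have hμv : ar K s t rels μ * v K s t rels 0 = ar K s t rels μ := by rw [← s_μ, src]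
    have hαv : ar K s t rels α * v K s t rels 0 = ar K s t rels α := by rw [← s_α, src]
    refine ⟨c, c', ∑ a ∈ Finset.univ.erase α, ar K s t rels a * w a, ?_, ?_⟩
    · rw [Finset.mul_sum]
      refine Finset.sum_eq_zero fun a ha => ?_
      rw [← mul_assoc, hμν a (Finset.ne_of_mem_erase ha), zero_mul]
    · have h1 : ar K s t rels μ * (y * v K s t rels 0) =
          c • ar K s t rels μ + ar K s t rels μ * (ar K s t rels α * z α) := by
        rw [hz, mul_add, mul_smul_comm, hμv, Finset.mul_sum, Finset.sum_eq_single α]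
        · intro a _ ha
          rw [← mul_assoc, hμν a ha, zero_mul]
        · intro h
          exact absurd (Finset.mem_univ α) h
      have h2 : ar K s t rels α * (z α * v K s t rels 0) = c' • ar K s t rels α +
          ar K s t rels α * ∑ a ∈ Finset.univ.erase α, ar K s t rels a * w a := by
        rw [hw, mul_add, mul_smul_comm, hαv,
          ← Finset.add_sum_erase Finset.univ (fun a => ar K s t rels a * w a) (Finset.mem_univ α),
          mul_add, ← mul_assoc _ (ar K s t rels α) (w α), αα, zero_mul, zero_add]
      have h3 : ar K s t rels μ * (y * v K s t rels 0) =
          c • ar K s t rels μ + ar K s t rels μ * (ar K s t rels α * (z α * v K s t rels 0)) := by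
        rw [← idem 0, ← mul_assoc y, ← mul_assoc (ar K s t rels μ), h1, add_mul, smul_mul_assoc,
          hμv, mul_assoc, mul_assoc, idem]
      rw [h3, h2, mul_add, mul_add, mul_add, mul_smul_comm, mul_smul_comm, mul_one, add_assoc]
  have hcorner : ∀ r, ∃ (c : Fin 4 → K) (p q : Opp K s t rels), ar K s t rels μ * p = 0 ∧
      ar K s t rels μ * q = 0 ∧ v K s t rels 1 * r * v K s t rels 0 =
        ar K s t rels μ * (c 0 • 1 + c 1 • ar K s t rels α + ar K s t rels α * p) +
        ar K s t rels β * ar K s t rels μ *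
          (c 2 • 1 + c 3 • ar K s t rels α + ar K s t rels α * q) := by
    intro r
    obtain ⟨c, y, hy⟩ := hQ r
    obtain ⟨d, z, hz⟩ := hQ (y β)
    obtain ⟨c₀, c₁, p, hp, h⟩ := hμy (y μ)
    obtain ⟨c₂, c₃, q, hq, h'⟩ := hμy (z μ)
    refine ⟨![c₀, c₁, c₂, c₃], p, q, hp, hq, ?_⟩
    have e1 : v K s t rels 1 * r * v K s t rels 0 =
        ar K s t rels μ * y μ + ar K s t rels β * y β := by
      rw [mul_assoc, hy, mul_add, mul_smul_comm, orth _ _ (by decide), smul_zero, zero_add,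
        Finset.mul_sum, Finset.sum_eq_add μ β hβμ.symm]
      · rw [← mul_assoc, ← mul_assoc, ← t_μ, tgt, t_μ, ← t_β, tgt]
      · intro a _ ha
        rw [← mul_assoc, v_mul_ar, zero_mul]
        rcases hall a with rfl | rfl | rfl | ⟨-, h, -⟩
        · rw [t_α]
          decide
        · exact absurd rfl ha.2
        · exact absurd rfl ha.1
        · rw [h]
          decide
      · intro h
        exact absurd (Finset.mem_univ μ) h
      · intro h
        exact absurd (Finset.mem_univ β) h
    have e2 : ar K s t rels β * (y β * v K s t rels 0) =
        ar K s t rels β * ar K s t rels μ * z μ := by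
      rw [hz, mul_add, mul_smul_comm, ar_mul_v (by rw [s_β]; decide), smul_zero, zero_add,
        Finset.mul_sum, Finset.sum_eq_single μ, mul_assoc]
      · intro a _ ha
        rw [← mul_assoc]
        rcases hall a with rfl | rfl | rfl | ⟨-, h, -⟩
        · rw [ar_mul_ar_of_ne (by rw [s_β, t_α]; decide), zero_mul]
        · rw [ββ, zero_mul]
        · exact absurd rfl ha
        · rw [ar_mul_ar_of_ne (by rw [s_β, h]; decide), zero_mul]
      · intro h
        exact absurd (Finset.mem_univ μ) h
    have hr : v K s t rels 1 * r * v K s t rels 0 =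
        v K s t rels 1 * r * v K s t rels 0 * v K s t rels 0 := by
      rw [mul_assoc, mul_assoc, mul_assoc, idem]
    have e3 : ar K s t rels β * (y β * v K s t rels 0) =
        ar K s t rels β * (y β * v K s t rels 0) * v K s t rels 0 := by
      rw [mul_assoc, mul_assoc, idem]
    rw [hr, e1, add_mul, mul_assoc, mul_assoc, h, e3, e2, mul_assoc, mul_assoc, h',
      ← mul_assoc (ar K s t rels β)]
    rfl
  have haug : ∃ Φ : Opp K s t rels →ₐ[K] Module.End K K, Φ (v K s t rels 1) = 0 :=
    exists_aug fun p hp => by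
      obtain ⟨a, b, rfl, -⟩ := hrel p hp
      rw [ev_arr_mul_arr, map_zero]
      exact congrArg op (mul_zero _)
  refine LoopKit.not_isTauTiltingFinite (K := K) (σ := σ)
    { Q with
      α := α
      β := β
      μ := μ
      s_α := s_α
      s_β := s_β
      t_β := t_β
      s_μ := s_μ
      t_μ := t_μ
      wt_α := if_pos (.inl rfl)
      wt_β := if_pos (.inr rfl)
      wt_μ := if_neg (by rintro (h | h) <;> [exact hαμ h.symm; exact hβμ h.symm])
      wt_cases := fun a => by
        by_cases h : a = α ∨ a = β
        · exact h.elim .inl fun h => .inr (.inl h)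
        · exact .inr (.inr (if_neg h))
      corner := hcorner
      rep := fun A B _ _ _ _ x a b haa hbb => ?_
      aug := haug }
  let f : σ → Module.End K (A × B) := fun c =>
    if c = α then LinearMap.inl K A B ∘ₗ a ∘ₗ LinearMap.fst K A B
    else if c = β then LinearMap.inr K A B ∘ₗ b ∘ₗ LinearMap.snd K A B
    else if c = μ then LinearMap.inr K A B ∘ₗ x ∘ₗ LinearMap.fst K A B
    else 0
  have hfα : ∀ u, f α u = (a u.1, 0) := fun u => by
    rw [show f α = _ from if_pos rfl]
    rfl
  have hfβ : ∀ u, f β u = (0, b u.2) := fun u => by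
    rw [show f β = _ from (if_neg hαβ.symm).trans (if_pos rfl)]
    rfl
  have hfμ : ∀ u, f μ u = (0, x u.1) := fun u => by
    rw [show f μ = _ from (if_neg hαμ.symm).trans ((if_neg hβμ.symm).trans (if_pos rfl))]
    rfl
  have hfν : ∀ c, s c = 1 → t c = 0 → f c = 0 := fun c hs ht => by
    refine (if_neg ?_).trans ((if_neg ?_).trans (if_neg ?_)) <;> rintro rfl
    · exact one_ne_zero (hs.symm.trans s_α)
    · exact one_ne_zero (t_β.symm.trans ht)
    · exact one_ne_zero (t_μ.symm.trans ht)
  have hcases : ∀ c, c = α ∨ c = β ∨ c = μ ∨ (s c = 1 ∧ t c = 0) := fun c =>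
    (hall c).imp_right (.imp_right (.imp_right fun h => ⟨h.1, h.2.1⟩))
  obtain ⟨Φ, h0, h1, hΦ⟩ := exists_rep (s := s) (t := t) (rels := rels) f
    (fun c u h => by
      rcases hcases c with rfl | rfl | rfl | hc
      · rw [hfα, hfα]
      · exact absurd (s_β.symm.trans h) one_ne_zero
      · rw [hfμ, hfμ]
      · exact absurd (hc.1.symm.trans h) one_ne_zero)
    (fun c u h => by
      rcases hcases c with rfl | rfl | rfl | hc
      · exact absurd (s_α.symm.trans h) zero_ne_one
      · rw [hfβ, hfβ]
      · exact absurd (s_μ.symm.trans h) zero_ne_one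
      · rw [hfν c hc.1 hc.2]
        rfl)
    (fun c u h => by
      rcases hcases c with rfl | rfl | rfl | hc
      · rw [hfα]
      · exact absurd (t_β.symm.trans h) one_ne_zero
      · exact absurd (t_μ.symm.trans h) one_ne_zero
      · rw [hfν c hc.1 hc.2]
        rfl)
    (fun c u h => by
      rcases hcases c with rfl | rfl | rfl | hc
      · exact absurd (t_α.symm.trans h) zero_ne_one
      · rw [hfβ]
      · rw [hfμ]
      · exact absurd (hc.2.symm.trans h) zero_ne_one)
    (fun p hp V => by
      obtain ⟨c, d, rfl, h⟩ := hrel p hp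
      rw [ev_arr_mul_arr, map_zero]
      refine congrArg op ?_
      rcases h with ⟨rfl, rfl⟩ | ⟨rfl, rfl⟩ | h | h
      · refine LinearMap.ext fun u => ?_
        rw [Module.End.mul_apply, hfα, hfα, haa]
        rfl
      · refine LinearMap.ext fun u => ?_
        rw [Module.End.mul_apply, hfβ, hfβ, hbb]
        rfl
      · rw [hfν c h.1 h.2, mul_zero]
      · rw [hfν d h.1 h.2, zero_mul])
  refine ⟨Φ, h0, h1, fun u => (congrArg (· u) (hΦ α)).trans (hfα u),
    fun u => (congrArg (· u) (hΦ β)).trans (hfβ u),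
    fun u => (congrArg (· u) (hΦ μ)).trans (hfμ u), fun c hc u => ?_⟩
  change (Φ (ar K s t rels c) u).1 = 0
  rw [hΦ]
  rcases hcases c with rfl | rfl | rfl | h
  · exact absurd rfl hc
  · rw [hfβ]
  · rw [hfμ]
  · rw [hfν c h.1 h.2]
    rfl

end Quiver

/-- Theorem 1.4(1).  The algebras `T₁, T₃, T₁₇` of Table T and
`W₁, W₂, W₃, W₅` of Table W are τ-tilting infinite (for all admissible parameters). -/
theorem tables_TW_tau_tilting_infinite (K : Type) [Field K] [IsAlgClosed K] :
    (∀ k1 k2 k3 k4 l1 l2 l3 l4 : K, k1 * k4 ≠ k2 * k3 → l1 * l4 ≠ l2 * l3 →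
      ¬ IsTauTiltingFinite (TabT1 K k1 k2 k3 k4 l1 l2 l3 l4)) ∧
    ¬ IsTauTiltingFinite (TabT3 K) ∧
    ¬ IsTauTiltingFinite (TabT17 K) ∧
    ¬ IsTauTiltingFinite (TabW1 K) ∧
    ¬ IsTauTiltingFinite (TabW2 K) ∧
    ¬ IsTauTiltingFinite (TabW3 K) ∧
    ¬ IsTauTiltingFinite (TabW5 K) := by
  refine ⟨fun k1 k2 k3 k4 l1 l2 l3 l4 _ _ => ?_, ?_, ?_, ?_, ?_, ?_, ?_⟩
  · refine Quiver.not_isTauTiltingFinite_of_kronecker le_rfl (![0, 1] : Fin 2 → Fin 4) (by decide)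
      (by decide) (by decide) (by decide) ?_ ?_
    · rintro p (rfl | rfl | rfl | rfl)
      · exact ⟨Quiver.arr_mul_arr_mem_quad _ _, zero_mem _⟩
      · exact ⟨Quiver.arr_mul_arr_mem_quad _ _, zero_mem _⟩
      all_goals
        refine ⟨?_, zero_mem _⟩
        simp only [add_mul, mul_add, smul_mul_smul_comm]
        exact add_mem (add_mem (Submodule.smul_mem _ _ (Quiver.arr_mul_arr_mem_quad _ _))
          (Submodule.smul_mem _ _ (Quiver.arr_mul_arr_mem_quad _ _)))
          (add_mem (Submodule.smul_mem _ _ (Quiver.arr_mul_arr_mem_quad _ _))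
          (Submodule.smul_mem _ _ (Quiver.arr_mul_arr_mem_quad _ _)))
    · intro k b
      fin_cases k <;> fin_cases b
      · exact .inl (Quiver.ar_mul_ar_of_ne (by decide))
      · exact .inl (Quiver.ar_mul_ar_of_ne (by decide))
      · exact .inl (Quiver.ar_mul_ar_of_mem (.inl rfl))
      · refine .inr (.inl fun k' hk' => ?_)
        fin_cases k'
        · exact absurd rfl hk'
        · exact Quiver.ar_mul_ar_of_mem (.inr (.inl rfl))
      · exact .inl (Quiver.ar_mul_ar_of_ne (by decide))
      · exact .inl (Quiver.ar_mul_ar_of_ne (by decide))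
      · refine .inr (.inl fun k' hk' => ?_)
        fin_cases k'
        · exact Quiver.ar_mul_ar_of_mem (.inl rfl)
        · exact absurd rfl hk'
      · exact .inl (Quiver.ar_mul_ar_of_mem (.inr (.inl rfl)))
  · refine Quiver.not_isTauTiltingFinite_of_loops (α := 0) (β := 2) (μ := 1) rfl rfl rfl rfl rfl
      rfl ?_ (.inl (Prod.ext (pow_two _).symm rfl)) (.inr (Prod.ext (pow_two _).symm rfl)) ?_
    · intro a
      fin_cases a
      · exact .inl rfl
      · exact .inr (.inr (.inl rfl))
      · exact .inr (.inl rfl)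
    · rintro p (rfl | rfl)
      · exact ⟨0, 0, Prod.ext (pow_two _) rfl, .inl ⟨rfl, rfl⟩⟩
      · exact ⟨2, 2, Prod.ext (pow_two _) rfl, .inr (.inl ⟨rfl, rfl⟩)⟩
  · refine Quiver.not_isTauTiltingFinite_of_loops (α := 0) (β := 1) (μ := 2) rfl rfl rfl rfl rfl
      rfl ?_ (.inl (Prod.ext (pow_two _).symm rfl)) (.inr (.inl (Prod.ext (pow_two _).symm rfl))) ?_
    · intro a
      fin_cases a
      · exact .inl rfl
      · exact .inr (.inl rfl)
      · exact .inr (.inr (.inl rfl))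
      · exact .inr (.inr (.inr ⟨rfl, rfl, .inr (.inr (.inl rfl))⟩))
    · rintro p (rfl | rfl | rfl | rfl)
      · exact ⟨0, 0, Prod.ext (pow_two _) rfl, .inl ⟨rfl, rfl⟩⟩
      · exact ⟨1, 1, Prod.ext (pow_two _) rfl, .inr (.inl ⟨rfl, rfl⟩)⟩
      · exact ⟨3, 2, rfl, .inr (.inr (.inl ⟨rfl, rfl⟩))⟩
      · exact ⟨2, 3, rfl, .inr (.inr (.inr ⟨rfl, rfl⟩))⟩
  · exact Quiver.not_isTauTiltingFinite_of_kronecker (q := 3) (by decide) id (fun _ _ h => h)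
      (by decide) (by decide) (by decide) (fun p hp => absurd hp (Set.notMem_empty p))
      fun k b => .inl (Quiver.ar_mul_ar_of_ne (by revert k b; decide))
  · refine Quiver.not_isTauTiltingFinite_of_kronecker le_rfl (![0, 1] : Fin 2 → Fin 3) (by decide)
      (by decide) (by decide) (by decide) ?_ ?_
    · rintro p (rfl | rfl) <;> exact ⟨Quiver.arr_mul_arr_mem_quad _ _, zero_mem _⟩
    · intro k b
      by_cases hb : b = 2
      · subst hb
        refine .inr (.inr ⟨rfl, fun d => ?_⟩)
        fin_cases d
        · exact Quiver.ar_mul_ar_of_mem (.inl rfl)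
        · exact Quiver.ar_mul_ar_of_mem (.inr rfl)
        · exact Quiver.ar_mul_ar_of_ne (by decide)
      · exact .inl (Quiver.ar_mul_ar_of_ne (by revert k b; decide))
  · refine Quiver.not_isTauTiltingFinite_of_kronecker le_rfl (![0, 1] : Fin 2 → Fin 4) (by decide)
      (by decide) (by decide) (by decide) ?_ ?_
    · rintro p (rfl | rfl | rfl | rfl | rfl | rfl)
      · exact ⟨Quiver.arr_mul_arr_mem_quad _ _, Quiver.arr_mul_arr_mem_quad _ _⟩
      all_goals exact ⟨Quiver.arr_mul_arr_mem_quad _ _, zero_mem _⟩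
    · intro k b
      fin_cases b
      · exact .inl (Quiver.ar_mul_ar_of_ne (by revert k; decide))
      · exact .inl (Quiver.ar_mul_ar_of_ne (by revert k; decide))
      · refine .inr (.inr ⟨rfl, fun d => ?_⟩)
        fin_cases d
        · exact Quiver.ar_mul_ar_of_mem (.inr (.inl rfl))
        · exact Quiver.ar_mul_ar_of_mem (.inr (.inr (.inl rfl)))
        · exact Quiver.ar_mul_ar_of_ne (by decide)
        · exact Quiver.ar_mul_ar_of_ne (by decide)
      · refine .inr (.inr ⟨rfl, fun d => ?_⟩)
        fin_cases d
        · exact Quiver.ar_mul_ar_of_mem (.inr (.inr (.inr (.inl rfl))))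
        · exact Quiver.ar_mul_ar_of_mem (.inr (.inr (.inr (.inr (.inl rfl)))))
        · exact Quiver.ar_mul_ar_of_ne (by decide)
        · exact Quiver.ar_mul_ar_of_ne (by decide)
  · refine Quiver.not_isTauTiltingFinite_of_kronecker le_rfl (![1, 2] : Fin 2 → Fin 3) (by decide)
      (by decide) (by decide) (by decide) ?_ ?_
    · rintro p (rfl | rfl | rfl)
      · refine ⟨?_, zero_mem _⟩
        rw [pow_two]
        exact Quiver.arr_mul_arr_mem_quad _ _
      all_goals exact ⟨Quiver.arr_mul_arr_mem_quad _ _, zero_mem _⟩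
    · intro k b
      by_cases hb : b = 0
      · subst hb
        left
        fin_cases k
        · exact Quiver.ar_mul_ar_of_mem (.inr (.inl rfl))
        · exact Quiver.ar_mul_ar_of_mem (.inr (.inr rfl))
      · exact .inl (Quiver.ar_mul_ar_of_ne (by revert k b; decide))

end TwoPoint
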